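/- arXiv:2602.11993 — 7 statements merged into one kernel-verified Lean document; each statement's English description precedes it below -/
import Mathlib

section
/- Let G be a finite connected graph with positive vertex weights p and total weight p(G), and let k ≥ 2 be an integer. If T is a 0-balanced k-splittable spanning tree of G (i.e., T ∈ B^0_k(G)), then T has a unique set of k − 1 edges whose removal partitions V(G) into k connected components each of total weight exactly p(G)/k. -/
open SimpleGraph

/-- The total weight of a connected component of a graph. -/
noncomputable def compWeight {V : Type*} (G : SimpleGraph V) (p : V → ℝ)
    (c : G.ConnectedComponent) : ℝ :=
  ∑ᶠ v ∈ c.supp, p v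

/-- `S` is a set of `k - 1` edges of `T` whose removal partitions the vertex set
into `k` connected components, each of total weight within `ε/2` of `p(G)/k`. -/
def IsBalancedCutSet {V : Type*} (T : SimpleGraph V) (p : V → ℝ) (k : ℕ) (ε : ℝ)
    (S : Finset (Sym2 V)) : Prop :=
  (S : Set (Sym2 V)) ⊆ T.edgeSet ∧ S.card = k - 1 ∧
    Nat.card (T.deleteEdges (S : Set (Sym2 V))).ConnectedComponent = k ∧
    ∀ c : (T.deleteEdges (S : Set (Sym2 V))).ConnectedComponent,
      compWeight _ p c ∈
        Set.Icc ((∑ᶠ v, p v) / k - ε / 2) ((∑ᶠ v, p v) / k + ε / 2)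

/-- `T ∈ B^ε_k(G)`: `T` is an `ε`-balanced `k`-splittable spanning tree of `G`. -/
def MemB {V : Type*} (G : SimpleGraph V) (p : V → ℝ) (k : ℕ) (ε : ℝ)
    (T : SimpleGraph V) : Prop :=
  T ≤ G ∧ T.IsTree ∧ ∃ S : Finset (Sym2 V), IsBalancedCutSet T p k ε S

/-- A step of the BUD walk on `B^ε_k(G)`: add an edge `e` of `G` not in `T`,
then remove an edge `f` of the resulting unique cycle (equivalently, an edge
whose removal leaves a tree), such that the result is again in `B^ε_k(G)`. -/
def BUDStep {V : Type*} (G : SimpleGraph V) (p : V → ℝ) (k : ℕ) (ε : ℝ)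
    (T T' : SimpleGraph V) : Prop :=
  MemB G p k ε T ∧ MemB G p k ε T' ∧
  ∃ e ∈ G.edgeSet \ T.edgeSet, ∃ f ∈ (T ⊔ SimpleGraph.fromEdgeSet {e}).edgeSet,
    T' = (T ⊔ SimpleGraph.fromEdgeSet {e}).deleteEdges {f}

open Classical in
lemma aux_closed {V : Type*} [Fintype V] (H : SimpleGraph V) (p : V → ℝ) (w : ℝ)
    (hw : ∀ c : H.ConnectedComponent, compWeight H p c = w) (A : Set V)
    (hA : ∀ x y, H.Adj x y → x ∈ A → y ∈ A) :
    ∃ m : ℤ, ∑ v with v ∈ A, p v = m * w := by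
  have hreach : ∀ x y, H.Reachable x y → x ∈ A → y ∈ A := by
    rintro x y ⟨q⟩
    induction q with
    | nil => exact id
    | cons h _ ih => exact fun hx => ih (hA _ _ h hx)
  have hc : ∀ c : H.ConnectedComponent, ∑ v with H.connectedComponentMk v = c, p v = w := by
    intro c
    rw [← hw c, compWeight, finsum_mem_eq_toFinset_sum]
    apply Finset.sum_congr _ (fun _ _ => rfl)
    ext v
    simp
  rw [← Finset.sum_fiberwise _ H.connectedComponentMk]
  have h1 : ∀ c : H.ConnectedComponent, ∃ m : ℤ,
      ∑ v ∈ Finset.univ.filter (· ∈ A) with H.connectedComponentMk v = c, p v = m * w := by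
    intro c
    induction c using SimpleGraph.ConnectedComponent.ind with
    | _ u =>
    by_cases hu : u ∈ A
    · refine ⟨1, ?_⟩
      rw [← hc (H.connectedComponentMk u)]
      simp only [Int.cast_one, one_mul]
      apply Finset.sum_congr _ (fun _ _ => rfl)
      ext v
      simp only [Finset.mem_filter, Finset.mem_univ, true_and, and_iff_right_iff_imp]
      intro h
      exact hreach _ _ (SimpleGraph.ConnectedComponent.exact h).symm hu
    · refine ⟨0, ?_⟩
      simp only [Int.cast_zero, zero_mul]
      apply Finset.sum_eq_zero
      intro v hv
      simp only [Finset.mem_filter, Finset.mem_univ, true_and] at hv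
      exact absurd (hreach _ _ (SimpleGraph.ConnectedComponent.exact hv.2) hv.1) hu
  choose m hm using h1
  refine ⟨∑ c, m c, ?_⟩
  rw [Finset.sum_congr rfl (fun c _ => hm c), ← Finset.sum_mul]
  push_cast
  rfl

open Classical in
lemma aux_sub {V : Type*} [Fintype V]
    (p : V → ℝ) (hp : ∀ v, 0 < p v) (k : ℕ)
    (T : SimpleGraph V) (hT : T.IsTree) (S S' : Finset (Sym2 V))
    (hS : IsBalancedCutSet T p k 0 S) (hS' : IsBalancedCutSet T p k 0 S') : S ⊆ S' := by
  obtain ⟨hsub, -, -, hbal⟩ := hS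
  obtain ⟨-, -, -, hbal'⟩ := hS'
  set w := (∑ᶠ v, p v) / k with hwdef
  have hw : ∀ c, compWeight (T.deleteEdges (S : Set (Sym2 V))) p c = w := by
    intro c
    obtain ⟨h1, h2⟩ := hbal c
    linarith
  have hw' : ∀ c, compWeight (T.deleteEdges (S' : Set (Sym2 V))) p c = w := by
    intro c
    obtain ⟨h1, h2⟩ := hbal' c
    linarith
  intro e he
  by_contra he'
  have heT : e ∈ T.edgeSet := hsub he
  induction e using Sym2.ind with
  | _ a b =>
  have hbr := (SimpleGraph.isAcyclic_iff_forall_edge_isBridge.1 hT.2) heT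
  rw [SimpleGraph.isBridge_iff] at hbr
  set A : Set V := {v | (T.deleteEdges {s(a, b)}).Reachable a v} with hAdef
  have haA : a ∈ A := SimpleGraph.Reachable.refl _
  have hbA : b ∉ A := hbr
  have hAcl : ∀ x y, T.Adj x y → s(x, y) ≠ s(a, b) → x ∈ A → y ∈ A := by
    intro x y hxy hne hx
    refine SimpleGraph.Reachable.trans hx (SimpleGraph.Adj.reachable ?_)
    simpa [SimpleGraph.deleteEdges_adj, hxy] using hne
  set H := T.deleteEdges (S' : Set (Sym2 V)) with hH
  set C : Set V := {v | H.Reachable a v} with hC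
  have haC : a ∈ C := SimpleGraph.Reachable.refl _
  have hab : H.Adj a b := by
    rw [hH, SimpleGraph.deleteEdges_adj]
    exact ⟨heT, by simpa using he'⟩
  have hbC : b ∈ C := hab.reachable
  obtain ⟨m, hm⟩ := aux_closed _ p w hw A (by
    intro x y hxy
    rw [SimpleGraph.deleteEdges_adj] at hxy
    refine hAcl x y hxy.1 ?_
    intro h
    rw [h] at hxy
    exact hxy.2 he)
  obtain ⟨m', hm'⟩ := aux_closed H p w hw' (A \ C) (by
    intro x y hxy hx
    have hyC : y ∉ C := fun h => hx.2 (SimpleGraph.Reachable.trans h hxy.symm.reachable)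
    refine ⟨hAcl x y (SimpleGraph.deleteEdges_adj.1 hxy).1 ?_ hx.1, hyC⟩
    intro h
    rcases Sym2.eq_iff.1 h with ⟨h1, h2⟩ | ⟨h1, h2⟩
    · exact hx.2 (h1 ▸ haC)
    · exact hx.2 (h1 ▸ hbC))
  have hCw : ∑ v with v ∈ C, p v = w := by
    rw [← hw' (H.connectedComponentMk a), compWeight, finsum_mem_eq_toFinset_sum]
    apply Finset.sum_congr _ (fun _ _ => rfl)
    ext v
    simp only [hC, Finset.mem_filter, Finset.mem_univ, true_and, Set.mem_setOf_eq,
      Set.mem_toFinset, SimpleGraph.ConnectedComponent.mem_supp_iff,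
      SimpleGraph.ConnectedComponent.eq]
    exact SimpleGraph.reachable_comm
  have hsplit : ∑ v with v ∈ A, p v
      = ∑ v with v ∈ A ∩ C, p v + ∑ v with v ∈ A \ C, p v := by
    rw [← Finset.sum_filter_add_sum_filter_not _ (· ∈ C), Finset.filter_filter,
      Finset.filter_filter]
    rfl
  have hpos : 0 < ∑ v with v ∈ A ∩ C, p v :=
    Finset.sum_pos (fun v _ => hp v) ⟨a, by simp [haA, haC]⟩
  have hlt : ∑ v with v ∈ A ∩ C, p v < ∑ v with v ∈ C, p v := by
    apply Finset.sum_lt_sum_of_subset (i := b) _ (by simpa using hbC) (by simp [hbA]) (hp b)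
      (fun v _ _ => (hp v).le)
    intro v
    simp
  have hwpos : 0 < w := by linarith
  have hx : ∑ v with v ∈ A ∩ C, p v = ((m - m' : ℤ) : ℝ) * w := by
    have e1 : ∑ v with v ∈ A, p v = m * w := by convert hm
    have e2 : ∑ v with v ∈ A \ C, p v = m' * w := by convert hm'
    rw [e1, e2] at hsplit
    push_cast
    linarith
  rw [hCw, hx] at hlt
  rw [hx] at hpos
  have h0 : (0 : ℝ) < ((m - m' : ℤ) : ℝ) := pos_of_mul_pos_left hpos hwpos.le
  have h1 : ((m - m' : ℤ) : ℝ) < 1 := by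
    by_contra h
    nlinarith
  have h0' : 0 < m - m' := by exact_mod_cast h0
  have h1' : m - m' < 1 := by exact_mod_cast h1
  omega

/-- If `T ∈ B^0_k(G)` for a finite connected graph `G` with positive vertex
weights, then `T` has a unique set of `k - 1` edges whose removal partitions
the vertex set into `k` connected components of weight exactly `p(G)/k`. -/
theorem stmt0 {V : Type*} [Fintype V] (G : SimpleGraph V) (hG : G.Connected)
    (p : V → ℝ) (hp : ∀ v, 0 < p v) (k : ℕ) (hk : 2 ≤ k)
    (T : SimpleGraph V) (hT : MemB G p k 0 T) :
    ∃! S : Finset (Sym2 V), IsBalancedCutSet T p k 0 S := by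
  obtain ⟨-, htree, S, hS⟩ := hT
  exact ⟨S, hS, fun S' hS' => Finset.Subset.antisymm
    (aux_sub p hp k T htree S' S hS' hS) (aux_sub p hp k T htree S S' hS hS')⟩
end

section
/- Let G be a finite connected graph with positive vertex weights and n vertices, and let k ≥ 2 be an integer. For any pair of trees T, T̃ ∈ B^0_k(G) such that P(T, k) = P(T̃, k), there exists a sequence of at most n − 1 BUD steps transforming T into T̃, in which every intermediate tree lies in B^0_k(G) and induces the same partition P(T, k). -/
open SimpleGraph

/-- Two trees in `B^0_k(G)` induce the same partition `P(T,k) = P(T',k)`: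
they have balanced cut sets whose removal yields the same reachability
(i.e. the same connected components). -/
def SamePartition {V : Type*} (p : V → ℝ) (k : ℕ) (T T' : SimpleGraph V) : Prop :=
  ∃ S S' : Finset (Sym2 V), IsBalancedCutSet T p k 0 S ∧ IsBalancedCutSet T' p k 0 S' ∧
    ∀ v w : V, (T.deleteEdges (S : Set (Sym2 V))).Reachable v w ↔
      (T'.deleteEdges (S' : Set (Sym2 V))).Reachable v w

theorem aux_side {V : Type*} (H : SimpleGraph V) (a b x : V) (h : H.Reachable x a) :
    (H.deleteEdges {s(a, b)}).Reachable x a ∨ (H.deleteEdges {s(a, b)}).Reachable x b := by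
  obtain ⟨w⟩ := h
  induction w with
  | nil => exact Or.inl (Reachable.refl _)
  | @cons u v c huv w ih =>
    by_cases hf : s(u, v) = s(c, b)
    · rcases Sym2.eq_iff.1 hf with ⟨rfl, rfl⟩ | ⟨rfl, rfl⟩
      · exact Or.inl (Reachable.refl _)
      · exact Or.inr (Reachable.refl _)
    · have hadj : (H.deleteEdges {s(c, b)}).Adj u v := by
        rw [deleteEdges_adj]
        exact ⟨huv, by simpa using hf⟩
      exact ih.imp (fun h => hadj.reachable.trans h) (fun h => hadj.reachable.trans h)

theorem aux_mono {V : Type*} (H D : SimpleGraph V) (h : ∀ u v, H.Adj u v → D.Reachable u v)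
    (v w : V) (hvw : H.Reachable v w) : D.Reachable v w := by
  obtain ⟨q⟩ := hvw
  induction q with
  | nil => exact Reachable.refl _
  | cons huv _ ih => exact (h _ _ huv).trans ih

theorem aux_swap {V : Type*} (H D : SimpleGraph V) (a b x y : V)
    (hx : H.Reachable x a) (hy : H.Reachable y a)
    (hxy : ¬ (H.deleteEdges {s(a, b)}).Reachable x y)
    (hle : H.deleteEdges {s(a, b)} ≤ D) (hD : D.Adj x y) (v w : V)
    (hvw : H.Reachable v w) : D.Reachable v w := by
  have hab : D.Reachable a b := by
    rcases aux_side H a b x hx with h1 | h1 <;> rcases aux_side H a b y hy with h2 | h2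
    · exact absurd (h1.trans h2.symm) hxy
    · exact ((h1.mono hle).symm.trans hD.reachable).trans (h2.mono hle)
    · exact ((h2.mono hle).symm.trans hD.symm.reachable).trans (h1.mono hle)
    · exact absurd (h1.trans h2.symm) hxy
  refine aux_mono H D (fun u v huv => ?_) v w hvw
  by_cases hf : s(u, v) = s(a, b)
  · rcases Sym2.eq_iff.1 hf with ⟨rfl, rfl⟩ | ⟨rfl, rfl⟩
    · exact hab
    · exact hab.symm
  · refine Adj.reachable (hle ?_)
    rw [deleteEdges_adj]
    exact ⟨huv, by simpa using hf⟩

/-- an edge of `H` crossing -/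
theorem aux_cross {V : Type*} (H K : SimpleGraph V) (a b : V) (h : H.Reachable a b)
    (hK : ¬ K.Reachable a b) :
    ∃ x y, H.Adj x y ∧ H.Reachable x a ∧ ¬ K.Reachable x y := by
  by_contra hc
  push Not at hc
  obtain ⟨q⟩ := h
  apply hK
  clear hK
  induction q with
  | nil => exact Reachable.refl _
  | @cons u v c huv q ih =>
    refine (hc u v huv (Reachable.refl _)).trans (ih ?_)
    intro x y hxy hx
    exact hc x y hxy (hx.trans huv.symm.reachable)

theorem aux_exchange {V : Type*} (U T' : SimpleGraph V) (A S' : Finset (Sym2 V))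
    (hU : U.IsTree) (hT' : T'.IsTree) (hA : (A : Set (Sym2 V)) ⊆ U.edgeSet)
    (hR : ∀ v w, (U.deleteEdges (A : Set (Sym2 V))).Reachable v w ↔
      (T'.deleteEdges (S' : Set (Sym2 V))).Reachable v w)
    (f : Sym2 V) (hfU : f ∈ U.edgeSet) (hfT : f ∉ T'.edgeSet) :
    ∃ e ∈ T'.edgeSet \ U.edgeSet, ∃ A' : Finset (Sym2 V),
      ((U ⊔ fromEdgeSet {e}).deleteEdges {f}).IsTree ∧
      (A' : Set (Sym2 V)) ⊆ ((U ⊔ fromEdgeSet {e}).deleteEdges {f}).edgeSet ∧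
      A'.card = A.card ∧
      ∀ v w, (((U ⊔ fromEdgeSet {e}).deleteEdges {f}).deleteEdges (A' : Set (Sym2 V))).Reachable v w
        ↔ (U.deleteEdges (A : Set (Sym2 V))).Reachable v w := by
  classical
  induction f with | _ a b
  have hbr : ¬ (U.deleteEdges {s(a, b)}).Reachable a b := by
    have := isAcyclic_iff_forall_isBridge.1 hU.isAcyclic hfU
    rwa [isBridge_iff] at this
  -- common part
  have key : ∀ x y, T'.Adj x y → ¬ (U.deleteEdges {s(a, b)}).Reachable x y →
      s(x, y) ∉ U.edgeSet ∧ ((U ⊔ fromEdgeSet {s(x, y)}).deleteEdges {s(a, b)}).IsTree ∧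
      U.deleteEdges {s(a, b)} ≤ (U ⊔ fromEdgeSet {s(x, y)}).deleteEdges {s(a, b)} ∧
      ((U ⊔ fromEdgeSet {s(x, y)}).deleteEdges {s(a, b)}).Adj x y := by
    intro x y hxy hn
    have hne : s(x, y) ≠ s(a, b) := by
      intro h; rw [← h] at hfT; exact hfT hxy
    have h1 : s(x, y) ∉ U.edgeSet := by
      intro h
      apply hn
      apply Adj.reachable
      rw [deleteEdges_adj]
      exact ⟨h, by simpa using hne⟩
    have hle : U.deleteEdges {s(a, b)} ≤ (U ⊔ fromEdgeSet {s(x, y)}).deleteEdges {s(a, b)} :=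
      deleteEdges_mono le_sup_left
    have hadj : ((U ⊔ fromEdgeSet {s(x, y)}).deleteEdges {s(a, b)}).Adj x y := by
      rw [deleteEdges_adj]
      refine ⟨?_, by simpa using hne⟩
      simp [hxy.ne]
    refine ⟨h1, ?_, hle, hadj⟩
    have := hU.connected.nonempty
    refine ⟨⟨fun v w => ?_⟩, ?_⟩
    · exact aux_swap U _ a b x y (hU.connected _ _) (hU.connected _ _) hn hle hadj v w
        (hU.connected _ _)
    · have hac : (U.deleteEdges {s(a, b)} ⊔ edge x y).IsAcyclic :=
        (hU.isAcyclic.anti (deleteEdges_le _)).sup_edge_of_not_reachable hn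
      refine hac.anti ?_
      intro u v huv
      simp only [deleteEdges_adj, sup_adj, edge, fromEdgeSet_adj] at huv ⊢
      tauto
  by_cases hfA : s(a, b) ∈ A
  · obtain ⟨x, y, hxy, -, hn⟩ := aux_cross T' _ a b (hT'.connected a b) hbr
    obtain ⟨h1, h2, h3, h4⟩ := key x y hxy hn
    refine ⟨s(x, y), ⟨hxy, h1⟩, insert s(x, y) (A.erase s(a, b)), h2, ?_, ?_, ?_⟩
    · intro g hg
      simp only [Finset.coe_insert, Finset.coe_erase, Set.mem_insert_iff, Set.mem_sdiff,
        Finset.mem_coe, Set.mem_singleton_iff] at hg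
      rcases hg with rfl | ⟨hg, hg'⟩
      · exact h4
      · have hgU := hA hg
        rw [edgeSet_deleteEdges, edgeSet_sup]
        exact ⟨Or.inl hgU, by simpa using hg'⟩
    · rw [Finset.card_insert_of_notMem, Finset.card_erase_add_one hfA]
      intro h
      exact h1 (hA (Finset.mem_of_mem_erase h))
    · have : ((U ⊔ fromEdgeSet {s(x, y)}).deleteEdges {s(a, b)}).deleteEdges
          ((insert s(x, y) (A.erase s(a, b)) : Finset (Sym2 V)) : Set (Sym2 V)) =
          U.deleteEdges (A : Set (Sym2 V)) := by
        ext u v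
        simp only [deleteEdges_adj, sup_adj, fromEdgeSet_adj, Finset.coe_insert, Finset.coe_erase,
          Set.mem_insert_iff, Set.mem_sdiff, Finset.mem_coe, Set.mem_singleton_iff]
        constructor
        · tauto
        · rintro ⟨huv, hnA⟩
          refine ⟨⟨Or.inl huv, ?_⟩, ?_⟩
          · intro h; rw [h] at hnA; exact hnA hfA
          · rintro (h | h)
            · rw [← h] at h1; exact h1 huv
            · exact hnA h.1
      intro v w
      rw [this]
  · have hadjab : (U.deleteEdges (A : Set (Sym2 V))).Adj a b := by
      rw [deleteEdges_adj]; exact ⟨hfU, by simpa using hfA⟩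
    obtain ⟨x, y, hxy, hxa, hn⟩ := aux_cross (T'.deleteEdges (S' : Set (Sym2 V))) _ a b
      ((hR a b).1 hadjab.reachable) hbr
    have hxyT : T'.Adj x y := deleteEdges_le _ hxy
    obtain ⟨h1, h2, h3, h4⟩ := key x y hxyT hn
    have hxA : s(x, y) ∉ A := fun h => h1 (hA h)
    refine ⟨s(x, y), ⟨hxyT, h1⟩, A, h2, ?_, rfl, ?_⟩
    · intro g hg
      have hgU := hA hg
      rw [edgeSet_deleteEdges, edgeSet_sup]
      refine ⟨Or.inl hgU, ?_⟩
      rintro rfl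
      exact hfA hg
    · intro v w
      have hxR := (hR x a).2 hxa
      have hxyR := (hR x y).2 hxy.reachable
      constructor
      · refine aux_mono _ _ ?_ v w
        intro u v huv
        simp only [deleteEdges_adj, sup_adj, fromEdgeSet_adj, Set.mem_singleton_iff] at huv
        obtain ⟨⟨h | ⟨h, -⟩, -⟩, hA'⟩ := huv
        · apply Adj.reachable
          rw [deleteEdges_adj]
          exact ⟨h, hA'⟩
        · rcases Sym2.eq_iff.1 h with ⟨rfl, rfl⟩ | ⟨rfl, rfl⟩
          · exact hxyR
          · exact hxyR.symm
      · refine aux_swap (U.deleteEdges (A : Set (Sym2 V))) _ a b x y hxR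
          (hxyR.symm.trans hxR) ?_ ?_ ?_ v w
        · intro h
          exact hn (h.mono (deleteEdges_mono (deleteEdges_le _)))
        · intro u v huv
          simp only [deleteEdges_adj, sup_adj] at huv ⊢
          tauto
        · rw [deleteEdges_adj]
          exact ⟨h4, by simpa using hxA⟩

theorem aux_balanced {V : Type*} (T U : SimpleGraph V) (p : V → ℝ) (k : ℕ) (ε : ℝ)
    (S A : Finset (Sym2 V)) (h : IsBalancedCutSet T p k ε S)
    (hA : (A : Set (Sym2 V)) ⊆ U.edgeSet) (hc : A.card = S.card)
    (hR : ∀ v w, (U.deleteEdges (A : Set (Sym2 V))).Reachable v w ↔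
      (T.deleteEdges (S : Set (Sym2 V))).Reachable v w) : IsBalancedCutSet U p k ε A := by
  obtain ⟨h1, h2, h3, h4⟩ := h
  refine ⟨hA, hc.trans h2, ?_, ?_⟩
  · rw [← h3]
    have : (U.deleteEdges (A : Set (Sym2 V))).Reachable =
      (T.deleteEdges (S : Set (Sym2 V))).Reachable := by
      ext v w; exact hR v w
    unfold ConnectedComponent
    rw [this]
  · intro c
    induction c using ConnectedComponent.ind with | _ v
    have := h4 ((T.deleteEdges (S : Set (Sym2 V))).connectedComponentMk v)
    have hs : ((T.deleteEdges (S : Set (Sym2 V))).connectedComponentMk v).supp =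
        ((U.deleteEdges (A : Set (Sym2 V))).connectedComponentMk v).supp := by
      ext w
      simp only [ConnectedComponent.mem_supp_iff, ConnectedComponent.eq]
      exact (hR w v).symm
    unfold compWeight at this ⊢
    rwa [hs] at this

theorem aux_chain {V : Type*} [Fintype V] (G : SimpleGraph V)
    (p : V → ℝ) (k : ℕ) (T T' : SimpleGraph V) (S S' : Finset (Sym2 V))
    (hT'G : T' ≤ G) (hT' : T'.IsTree)
    (hS : IsBalancedCutSet T p k 0 S)
    (hR : ∀ v w, (T.deleteEdges (S : Set (Sym2 V))).Reachable v w ↔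
      (T'.deleteEdges (S' : Set (Sym2 V))).Reachable v w) (d : ℕ) :
    ∀ (U : SimpleGraph V) (A : Finset (Sym2 V)), U ≤ G → U.IsTree →
      IsBalancedCutSet U p k 0 A →
      (∀ v w, (U.deleteEdges (A : Set (Sym2 V))).Reachable v w ↔
        (T.deleteEdges (S : Set (Sym2 V))).Reachable v w) →
      (U.edgeSet \ T'.edgeSet).ncard ≤ d →
      ∃ m ≤ d, ∃ c : ℕ → SimpleGraph V, c 0 = U ∧ c m = T' ∧
        (∀ i < m, BUDStep G p k 0 (c i) (c (i + 1))) ∧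
        (∀ i ≤ m, MemB G p k 0 (c i) ∧ SamePartition p k (c i) T) := by
  induction d with
  | zero =>
    intro U A hUG hU hA hUR hd
    have hsub : U.edgeSet ⊆ T'.edgeSet := by
      have := (Set.ncard_eq_zero (Set.toFinite _)).1 (Nat.le_zero.1 hd)
      exact Set.sdiff_eq_empty.1 this
    have hle : U ≤ T' := edgeSet_subset_edgeSet.1 hsub
    have hEq : U = T' :=
      le_antisymm hle ((isTree_iff_minimal_connected.1 hT').le_of_le hU.connected hle)
    refine ⟨0, le_rfl, fun _ => U, rfl, hEq, by simp, fun i _ => ⟨⟨hUG, hU, A, hA⟩, A, S, hA, hS, hUR⟩⟩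
  | succ d ih =>
    intro U A hUG hU hA hUR hd
    by_cases hsub : U.edgeSet ⊆ T'.edgeSet
    · obtain ⟨m, hm, h⟩ := ih U A hUG hU hA hUR (by rw [Set.sdiff_eq_empty.2 hsub]; simp)
      exact ⟨m, by omega, h⟩
    obtain ⟨f, hfU, hfT⟩ := Set.not_subset.1 hsub
    obtain ⟨e, he, A', h1, h2, h3, h4⟩ := aux_exchange U T' A S' hU hT' hA.1
      (fun v w => (hUR v w).trans (hR v w)) f hfU hfT
    set U' := (U ⊔ fromEdgeSet {e}).deleteEdges {f} with hU'
    have hbal := aux_balanced U U' p k 0 A A' hA h2 h3 h4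
    have hU'G : U' ≤ G := by
      refine (deleteEdges_le _).trans (sup_le hUG ?_)
      intro u v huv
      simp only [fromEdgeSet_adj, Set.mem_singleton_iff] at huv
      apply hT'G
      have := he.1
      rw [← huv.1] at this
      exact this
    have hcard : (U'.edgeSet \ T'.edgeSet).ncard ≤ d := by
      have : U'.edgeSet \ T'.edgeSet ⊂ U.edgeSet \ T'.edgeSet := by
        refine (Set.ssubset_iff_of_subset ?_).2 ⟨f, ⟨hfU, hfT⟩, ?_⟩
        · rintro g ⟨hg, hgT⟩
          rw [hU', edgeSet_deleteEdges, edgeSet_sup, edgeSet_fromEdgeSet] at hg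
          rcases hg.1 with h | h
          · exact ⟨h, hgT⟩
          · have : g = e := h.1
            exact absurd (this ▸ he.1) hgT
        · rintro ⟨hg, -⟩
          rw [hU', edgeSet_deleteEdges] at hg
          exact hg.2 rfl
      have := Set.ncard_lt_ncard this (Set.toFinite _)
      omega
    obtain ⟨m, hm, c, hc0, hcm, hstep, hmem⟩ := ih U' A' hU'G h1 hbal
      (fun v w => (h4 v w).trans (hUR v w)) hcard
    have hUB : MemB G p k 0 U := ⟨hUG, hU, A, hA⟩
    refine ⟨m + 1, by omega, fun i => Nat.casesOn i U c, rfl, hcm, ?_, ?_⟩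
    · intro i hi
      cases i with
      | zero =>
        change BUDStep G p k 0 U (c 0)
        rw [hc0]
        refine ⟨hUB, ⟨hU'G, h1, A', hbal⟩, e, ⟨?_, he.2⟩, f, ?_, hU'⟩
        · exact edgeSet_subset_edgeSet.2 hT'G he.1
        · rw [edgeSet_sup]; exact Or.inl hfU
      | succ i => exact hstep i (by omega)
    · intro i hi
      cases i with
      | zero => exact ⟨hUB, A, S, hA, hS, hUR⟩
      | succ i => exact hmem i (by omega)

theorem stmt1 {V : Type*} [Fintype V] (G : SimpleGraph V) (hG : G.Connected)
    (p : V → ℝ) (hp : ∀ v, 0 < p v) (k : ℕ) (hk : 2 ≤ k)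
    (T T' : SimpleGraph V) (hT : MemB G p k 0 T) (hT' : MemB G p k 0 T')
    (hsame : SamePartition p k T T') :
    ∃ m ≤ Fintype.card V - 1, ∃ c : ℕ → SimpleGraph V,
      c 0 = T ∧ c m = T' ∧
      (∀ i < m, BUDStep G p k 0 (c i) (c (i + 1))) ∧
      (∀ i ≤ m, MemB G p k 0 (c i) ∧ SamePartition p k (c i) T) := by
  obtain ⟨S, S', hS, hS', hR⟩ := hsame
  refine aux_chain G p k T T' S S' hT'.1 hT'.2.1 hS hR _ T S hT.1 hT.2.1 hS
    (fun _ _ => Iff.rfl) ?_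
  have h1 := (isTree_iff_connected_and_card.1 hT.2.1).2
  rw [Nat.card_eq_fintype_card (α := V)] at h1
  have h2 : (T.edgeSet \ T'.edgeSet).ncard ≤ T.edgeSet.ncard :=
    Set.ncard_le_ncard Set.diff_subset (Set.toFinite _)
  rw [← Nat.card_coe_set_eq T.edgeSet] at h2
  omega
end

section
/- Let G be a finite connected graph with positive vertex weights, k ≥ 2 an integer, and let P and P̃ be two distinct 0-balanced k-partitions of G. The following are equivalent: (1) there exist trees T, T̃ ∈ B^0_k(G) with P(T, k) = P and P(T̃, k) = P̃ such that T̃ is obtained from T by a single BUD step; (2) after re-indexing P = (P_1, …, P_k), there exist ℓ with 2 ≤ ℓ ≤ k, a cycle P_1 → P_2 → ⋯ → P_ℓ → P_1 in the quotient multigraph G/P, and nonempty subgraphs H_i ⊆ P_i for all i ∈ [ℓ] such that (a) for each i ∈ [ℓ], both H_i and P_i ∖ H_i are connected, and (b) P̃ is obtained from P by transferring H_i from P_i to P_{i+1} for all i ∈ [ℓ] (indices cyclic, so ℓ + 1 means 1). -/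
open SimpleGraph

/-- `P : V → Fin k` is a 0-balanced `k`-partition of `G`: each part induces a
connected subgraph of total weight exactly `p(G)/k`. -/
def IsBalancedPartition {V : Type*} (G : SimpleGraph V) (p : V → ℝ) (k : ℕ)
    (P : V → Fin k) : Prop :=
  (∀ i : Fin k, (G.induce (P ⁻¹' {i})).Connected) ∧
  (∀ i : Fin k, ∑ᶠ v ∈ P ⁻¹' {i}, p v = (∑ᶠ v, p v) / k)

/-- `T ∈ B^0_k(G)` induces the partition `P`, i.e. `P(T, k) = P`: the
components obtained by removing the balanced cut set are exactly the fibers of `P`. -/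
def InducesPartition {V : Type*} (T : SimpleGraph V) (p : V → ℝ) (k : ℕ)
    (P : V → Fin k) : Prop :=
  ∃ S : Finset (Sym2 V), IsBalancedCutSet T p k 0 S ∧
    ∀ v w : V, (T.deleteEdges (S : Set (Sym2 V))).Reachable v w ↔ P v = P w


theorem comps_le_of_inv {V β : Type*} [Finite V] (M : SimpleGraph V) (h : V → β)
    (hs : Function.Surjective h) (hc : ∀ v w, M.Adj v w → h v = h w) :
    Nat.card β ≤ Nat.card M.ConnectedComponent := by
  have hr : ∀ v w, M.Reachable v w → h v = h w := by
    rintro v w ⟨q⟩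
    induction q with
    | nil => rfl
    | cons a _ ih => exact (hc _ _ a).trans ih
  have : Finite M.ConnectedComponent := Quot.finite _
  refine Nat.card_le_card_of_surjective
    (fun c : M.ConnectedComponent => Quot.lift h (fun a b hab => hr a b hab) c) ?_
  intro b
  obtain ⟨v, rfl⟩ := hs b
  exact ⟨M.connectedComponentMk v, rfl⟩

theorem comps_le_of_reach {V β : Type*} [Finite β] (M : SimpleGraph V) (h : V → β)
    (hc : ∀ v w, h v = h w → M.Reachable v w) :
    Nat.card M.ConnectedComponent ≤ Nat.card β := by
  refine Nat.card_le_card_of_injective (fun c : M.ConnectedComponent => h c.out) ?_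
  intro c d hcd
  have := hc _ _ hcd
  rw [← Quot.out_eq c, ← Quot.out_eq d]
  exact Quot.sound this

theorem reach_of_adj {V : Type*} {M N : SimpleGraph V}
    (h : ∀ v w, M.Adj v w → N.Reachable v w) (v w : V) (hr : M.Reachable v w) :
    N.Reachable v w := by
  obtain ⟨q⟩ := hr
  induction q with
  | nil => exact Reachable.refl _
  | cons a _ ih => exact (h _ _ a).trans ih

theorem inv_of_reach {V β : Type*} {M : SimpleGraph V} (f : V → β)
    (h : ∀ v w, M.Adj v w → f v = f w) (v w : V) (hr : M.Reachable v w) : f v = f w := by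
  obtain ⟨q⟩ := hr
  induction q with
  | nil => rfl
  | cons a _ ih => exact (h _ _ a).trans ih

theorem comps_delete_one {V : Type*} [Finite V] (U : SimpleGraph V) (s : Sym2 V) :
    Nat.card (U.deleteEdges {s}).ConnectedComponent ≤ Nat.card U.ConnectedComponent + 1 := by
  classical
  induction s using Sym2.ind with
  | _ a b =>
  set U' := U.deleteEdges {s(a, b)} with hU'
  have : Finite U.ConnectedComponent := Quot.finite _
  have key : ∀ x y, U.Reachable x y → U'.Reachable x y ∨
      ((U'.Reachable x a ∨ U'.Reachable x b) ∧ (U'.Reachable y a ∨ U'.Reachable y b)) := by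
    rintro x y ⟨q⟩
    induction q with
    | nil => exact Or.inl (Reachable.refl _)
    | @cons x z y hxz _ ih =>
      by_cases hs : s(x, z) = s(a, b)
      · rw [Sym2.eq_iff] at hs
        right
        rcases hs with ⟨rfl, rfl⟩ | ⟨rfl, rfl⟩
        · refine ⟨Or.inl (Reachable.refl _), ?_⟩
          rcases ih with h | h
          · exact Or.inr h.symm
          · exact h.2
        · refine ⟨Or.inr (Reachable.refl _), ?_⟩
          rcases ih with h | h
          · exact Or.inl h.symm
          · exact h.2
      · have hr : U'.Reachable x z := by
          apply Adj.reachable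
          rw [hU', deleteEdges_adj]
          exact ⟨hxz, hs⟩
        rcases ih with h | h
        · exact Or.inl (hr.trans h)
        · exact Or.inr ⟨h.1.imp hr.trans hr.trans, h.2⟩
  have : Nat.card (Option U.ConnectedComponent) = Nat.card U.ConnectedComponent + 1 :=
    Finite.card_option
  rw [← this]
  refine Nat.card_le_card_of_injective (fun c : U'.ConnectedComponent =>
    if U'.Reachable c.out b then none else some (U.connectedComponentMk c.out)) ?_
  intro c d hcd
  rw [← Quot.out_eq c, ← Quot.out_eq d]
  apply Quot.sound
  simp only at hcd
  split_ifs at hcd with h1 h2 h2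
  · exact h1.trans h2.symm
  · have := key _ _ (ConnectedComponent.exact (Option.some.inj hcd))
    rcases this with h | ⟨h3, h4⟩
    · exact h
    · exact (h3.resolve_right h1).trans (h4.resolve_right h2).symm

theorem comps_delete {V : Type*} [Finite V] (U : SimpleGraph V) (F : Finset (Sym2 V)) :
    Nat.card (U.deleteEdges (F : Set (Sym2 V))).ConnectedComponent
      ≤ Nat.card U.ConnectedComponent + F.card := by
  classical
  induction F using Finset.induction_on with
  | empty => simp
  | insert s F hs ih =>
    have : U.deleteEdges ((insert s F : Finset (Sym2 V)) : Set (Sym2 V))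
        = (U.deleteEdges (F : Set (Sym2 V))).deleteEdges {s} := by
      rw [deleteEdges_deleteEdges, Finset.coe_insert, Set.insert_eq, Set.union_comm]
    rw [this, Finset.card_insert_of_notMem hs]
    have := comps_delete_one (U.deleteEdges (F : Set (Sym2 V))) s
    omega

theorem card_comps_conn {V : Type*} (U : SimpleGraph V) (h : U.Connected) :
    Nat.card U.ConnectedComponent = 1 := by
  have := h.nonempty
  rw [Nat.card_eq_one_iff_unique]
  refine ⟨h.preconnected.subsingleton_connectedComponent, inferInstance⟩

theorem comps_lt {V : Type*} [Finite V] (M N : SimpleGraph V) (hMN : M ≤ N) (u v : V)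
    (h1 : N.Reachable u v) (h2 : ¬ M.Reachable u v) :
    Nat.card N.ConnectedComponent < Nat.card M.ConnectedComponent := by
  classical
  have : Finite M.ConnectedComponent := Quot.finite _
  have : Finite N.ConnectedComponent := Quot.finite _
  have hsurj : Function.Surjective (ConnectedComponent.map (Hom.ofLE hMN)) := by
    intro c
    induction c using ConnectedComponent.ind with
    | _ v => exact ⟨M.connectedComponentMk v, rfl⟩
  apply lt_of_le_of_ne (Nat.card_le_card_of_surjective _ hsurj)
  intro he
  have hb := (Nat.bijective_iff_surjective_and_card _).2 ⟨hsurj, he.symm⟩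
  apply h2
  have := @hb.1 (M.connectedComponentMk u) (M.connectedComponentMk v)
    (ConnectedComponent.sound h1)
  exact ConnectedComponent.exact this

theorem exists_connecting {V : Type*} [Finite V] (G : SimpleGraph V) :
    ∀ (n : ℕ) (M : SimpleGraph V), M ≤ G → Nat.card M.ConnectedComponent = n →
    ∃ Z : Finset (Sym2 V), (Z : Set (Sym2 V)) ⊆ G.edgeSet ∧
      Z.card + Nat.card G.ConnectedComponent ≤ Nat.card M.ConnectedComponent ∧
      ∀ v w, G.Reachable v w → (M ⊔ fromEdgeSet (Z : Set (Sym2 V))).Reachable v w := by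
  classical
  intro n
  induction n using Nat.strong_induction_on with
  | _ n ih =>
  intro M hM hn
  by_cases hc : ∀ v w, G.Adj v w → M.Reachable v w
  · refine ⟨∅, by simp, ?_, ?_⟩
    · rw [Finset.card_empty, zero_add]
      have : Finite M.ConnectedComponent := Quot.finite _
      refine Nat.card_le_card_of_surjective (ConnectedComponent.map (Hom.ofLE hM)) ?_
      intro c
      induction c using ConnectedComponent.ind with
      | _ v => exact ⟨M.connectedComponentMk v, rfl⟩
    · intro v w h
      exact (reach_of_adj hc v w h).mono le_sup_left
  · push Not at hc
    obtain ⟨u, v, huv, hnr⟩ := hc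
    set M' := M ⊔ fromEdgeSet {s(u, v)} with hM'
    have hadj : M'.Adj u v := by
      rw [hM', sup_adj]; right; simp [huv.ne]
    have hM'G : M' ≤ G := by
      rw [hM']; refine sup_le hM ?_
      intro x y hxy
      rw [fromEdgeSet_adj] at hxy
      have := hxy.1
      rw [Set.mem_singleton_iff] at this
      rw [← mem_edgeSet, this]; exact huv
    have hlt := comps_lt M M' le_sup_left u v hadj.reachable hnr
    obtain ⟨Z, hZ1, hZ2, hZ3⟩ := ih _ (hn ▸ hlt) M' hM'G rfl
    refine ⟨insert s(u, v) Z, ?_, ?_, ?_⟩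
    · rw [Finset.coe_insert, Set.insert_subset_iff]
      exact ⟨huv, hZ1⟩
    · have := Finset.card_insert_le s(u, v) Z
      omega
    · intro x y h
      refine (hZ3 x y h).mono ?_
      rw [hM', sup_assoc, ← fromEdgeSet_union, Finset.coe_insert, Set.insert_eq]

theorem induce_conn {V : Type*} {M G : SimpleGraph V} (hMG : M ≤ G) (A : Set V)
    (hne : A.Nonempty) (hcl : ∀ v w, M.Adj v w → v ∈ A → w ∈ A)
    (hr : ∀ v ∈ A, ∀ w ∈ A, M.Reachable v w) : (G.induce A).Connected := by
  have key : ∀ v w (q : M.Walk v w) (hv : v ∈ A) (hw : w ∈ A),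
      (G.induce A).Reachable ⟨v, hv⟩ ⟨w, hw⟩ := by
    intro v w q
    induction q with
    | nil => intro hv hw; exact Reachable.refl _
    | @cons x y z a _ ih =>
      intro hv hw
      have hy := hcl _ _ a hv
      refine Reachable.trans ?_ (ih hy hw)
      apply Adj.reachable
      exact hMG a
  have : Nonempty A := hne.to_subtype
  refine ⟨?_⟩
  rintro ⟨v, hv⟩ ⟨w, hw⟩
  obtain ⟨q⟩ := hr v hv w hw
  exact key v w q hv hw

theorem crossing {V : Type*} {G : SimpleGraph V} (A B C : Set V) (hA : (G.induce A).Connected)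
    (hBC : A ⊆ B ∪ C) (hB : (A ∩ B).Nonempty) (hC : (A ∩ C).Nonempty) (hd : Disjoint B C) :
    ∃ u ∈ B, ∃ x ∈ C, G.Adj u x := by
  by_contra hcon
  push Not at hcon
  obtain ⟨b, hbA, hb⟩ := hB
  obtain ⟨c, hcA, hc⟩ := hC
  have := inv_of_reach (M := G.induce A) (fun v => (v : V) ∈ B) (by
    rintro ⟨v, hv⟩ ⟨w, hw⟩ h
    have h : G.Adj v w := h
    have h1 := hBC hv
    have h2 := hBC hw
    have h3 : v ∈ B → v ∉ C := fun h' => Set.disjoint_left.1 hd h'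
    have h4 : w ∈ B → w ∉ C := fun h' => Set.disjoint_left.1 hd h'
    have h5 := fun h1 h2 => hcon v h1 w h2 h
    have h6 := fun h1 h2 => hcon w h1 v h2 h.symm
    simp only [Set.mem_union] at h1 h2
    apply propext
    tauto) ⟨b, hbA⟩ ⟨c, hcA⟩ (hA.preconnected _ _)
  have h7 : c ∈ B := this ▸ hb
  exact Set.disjoint_left.1 hd h7 hc

theorem wt_eq {V : Type*} [Fintype V] (p : V → ℝ) (hp : ∀ v, 0 < p v) (A B : Set V)
    (hAB : A ⊆ B) (h : ∑ᶠ v ∈ A, p v = ∑ᶠ v ∈ B, p v) : A = B := by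
  classical
  rw [finsum_mem_eq_finite_toFinset_sum _ A.toFinite,
    finsum_mem_eq_finite_toFinset_sum _ B.toFinite] at h
  by_contra hne
  obtain ⟨x, hxB, hxA⟩ := Set.exists_of_ssubset (hAB.ssubset_of_ne hne)
  have : ∑ v ∈ A.toFinite.toFinset, p v < ∑ v ∈ B.toFinite.toFinset, p v := by
    refine Finset.sum_lt_sum_of_subset (i := x) ?_ ?_ ?_ (hp x) (fun j _ _ => (hp j).le)
    · simpa using hAB
    · simpa using hxB
    · simpa using hxA
  linarith

theorem dihedral {A I J : Type*} [Finite A] (π₁ : A → I) (π₂ : A → J) (α β : A → A)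
    (hα1 : ∀ x, π₁ (α x) = π₁ x) (hα2 : ∀ x, α x ≠ x)
    (hα3 : ∀ x y, π₁ y = π₁ x → y = x ∨ y = α x)
    (hβ1 : ∀ x, π₂ (β x) = π₂ x) (hβ2 : ∀ x, β x ≠ x)
    (hβ3 : ∀ x y, π₂ y = π₂ x → y = x ∨ y = β x)
    (hinj : ∀ x y, π₁ x = π₁ y → π₂ x = π₂ y → x = y) (a₀ : A) :
    ∃ (l : ℕ) (γ : Fin (l + 2) → A), Function.Injective (fun i => π₁ (γ i)) ∧
      (∀ i, γ (i + 1) = α (β (γ i))) ∧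
      (∀ x y, (∃ i, π₁ (γ i) = π₁ x) → π₂ x = π₂ y → ∃ i, π₁ (γ i) = π₁ y) := by
  have hαα : ∀ x, α (α x) = x := fun x => by
    rcases hα3 (α x) x (hα1 x).symm with h | h
    · exact absurd h.symm (hα2 x)
    · exact h.symm
  have hββ : ∀ x, β (β x) = x := fun x => by
    rcases hβ3 (β x) x (hβ1 x).symm with h | h
    · exact absurd h.symm (hβ2 x)
    · exact h.symm
  set g : A → A := fun x => α (β x) with hg
  have hginj : Function.Injective g := by
    intro x y h
    have : α (α (β x)) = α (α (β y)) := congrArg α h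
    rw [hαα, hαα] at this
    have := congrArg β this
    rwa [hββ, hββ] at this
  have hno : ∀ n x, α (g^[n] x) ≠ x := by
    intro n
    induction n using Nat.strong_induction_on with
    | _ n ih =>
    intro x
    match n with
    | 0 => exact hα2 x
    | 1 => simp only [Function.iterate_one, hg, hαα]; exact hβ2 x
    | m + 2 =>
      intro h
      rw [Function.iterate_succ_apply'] at h
      simp only [hg, hαα] at h
      have h2 := congrArg β h
      rw [hββ] at h2
      change g^[m+1] x = β x at h2
      rw [Function.iterate_succ_apply] at h2
      apply ih m (by omega) (g x)
      rw [h2]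
  have hαg : ∀ i x, g^[i] (α (g^[i] x)) = α x := by
    intro i
    induction i with
    | zero => intro x; rfl
    | succ i ih =>
      intro x
      rw [Function.iterate_succ_apply, Function.iterate_succ_apply']
      have : g (α (g (g^[i] x))) = α (g^[i] x) := by
        simp only [hg, hαα, hββ]
      rw [this, ih]
  have hper := hginj.mem_periodicPts a₀
  set n := Function.minimalPeriod g a₀ with hn
  have hpos : 0 < n := Function.minimalPeriod_pos_of_mem_periodicPts hper
  have hn1 : n ≠ 1 := by
    intro h1
    have : g a₀ = a₀ := by
      have := Function.iterate_minimalPeriod (f := g) (x := a₀)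
      rw [← hn, h1] at this
      exact this
    have h2 : β a₀ = α a₀ := by
      have := congrArg α this
      simpa only [hg, hαα] using this
    apply hα2 a₀
    apply hinj
    · exact hα1 _
    · rw [← h2]; exact hβ1 _
  obtain ⟨l, hl⟩ : ∃ l, n = l + 2 := ⟨n - 2, by omega⟩
  have hsucc : ∀ i : Fin (l + 2), g^[(i + 1 : Fin (l+2)).val] a₀ = α (β (g^[i.val] a₀)) := by
    intro i
    have h1 : (i + 1 : Fin (l + 2)).val = (i.val + 1) % n := by
      rw [Fin.val_add, Fin.val_one, hl]
    rw [h1, hn, Function.iterate_mod_minimalPeriod_eq, Function.iterate_succ_apply']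
  refine ⟨l, fun i => g^[i.val] a₀, ?_, hsucc, ?_⟩
  · intro i j hij
    rcases hα3 _ _ hij with h | h
    · apply Fin.ext
      exact Function.iterate_injOn_Iio_minimalPeriod (f := g) (x := a₀)
        (Set.mem_Iio.2 (by omega)) (Set.mem_Iio.2 (by omega)) h
    · exfalso
      have h1 := congrArg (g^[j.val]) h
      simp only at h1
      rw [hαg, ← Function.iterate_add_apply] at h1
      apply hno (j.val + i.val) a₀
      rw [h1, hαα]
  · rintro x y ⟨i, hi⟩ hxy
    simp only at hi ⊢
    rcases hβ3 x y hxy.symm with rfl | rfl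
    · exact ⟨i, hi⟩
    · rcases hα3 _ _ hi.symm with rfl | rfl
      · refine ⟨i + 1, ?_⟩
        rw [hsucc, hα1]
      · refine ⟨i - 1, ?_⟩
        have := hsucc (i - 1)
        rw [sub_add_cancel] at this
        rw [this, hαα, hββ]

theorem core {V : Type*} [Fintype V] {k : ℕ} (U : SimpleGraph V) (hU : U.Connected)
    (P Q : V → Fin k) (X Y : Finset (Sym2 V)) (hX : X.card = k) (hY : Y.card = k)
    (hXP : ∀ v w, (U.deleteEdges (X : Set (Sym2 V))).Reachable v w ↔ P v = P w)
    (hYQ : ∀ v w, (U.deleteEdges (Y : Set (Sym2 V))).Reachable v w ↔ Q v = Q w)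
    (hPs : Function.Surjective P)
    (hsub : ∀ i j, P ⁻¹' {i} ⊆ Q ⁻¹' {j} → P ⁻¹' {i} = Q ⁻¹' {j})
    (hgood : ∃ i, ∀ j, P ⁻¹' {i} ≠ Q ⁻¹' {j}) :
    (∀ v w, P v = P w → Q v = Q w → ∃ M : SimpleGraph V, M ≤ U ∧
      (∀ v w, M.Adj v w → P v = P w ∧ Q v = Q w) ∧ M.Reachable v w) ∧
    (∀ i, (∀ j, P ⁻¹' {i} ≠ Q ⁻¹' {j}) → Nat.card {j // ∃ v, P v = i ∧ Q v = j} = 2) ∧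
    (∀ h : V → Bool, (∀ v w, P v = P w → h v = h w) → (∀ v w, Q v = Q w → h v = h w) →
      (∃ v, (∀ j, P ⁻¹' {P v} ≠ Q ⁻¹' {j}) ∧ h v = true) →
      (∃ v, (∀ j, P ⁻¹' {P v} ≠ Q ⁻¹' {j}) ∧ h v = false) → False) := by
  classical
  set Bad := {i : Fin k // ∃ j, P ⁻¹' {i} = Q ⁻¹' {j}} with hBad
  -- invariants
  have hinv : ∀ {γ : Type} (h : V → γ) (hP : ∀ v w, P v = P w → h v = h w)
      (hQ : ∀ v w, Q v = Q w → h v = h w) (v w : V),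
      (U.deleteEdges ((X ∩ Y : Finset (Sym2 V)) : Set (Sym2 V))).Adj v w → h v = h w := by
    intro γ h hP hQ v w hvw
    rw [deleteEdges_adj] at hvw
    have h2 := hvw.2
    simp only [Finset.coe_inter, Set.mem_inter_iff, not_and_or] at h2
    rcases h2 with h2 | h2
    · apply hP; rw [← hXP]; apply Adj.reachable; rw [deleteEdges_adj]; exact ⟨hvw.1, h2⟩
    · apply hQ; rw [← hYQ]; apply Adj.reachable; rw [deleteEdges_adj]; exact ⟨hvw.1, h2⟩
  have hbadQ : ∀ v w, Q v = Q w → (∃ j, P ⁻¹' {P v} = Q ⁻¹' {j}) → P v = P w := by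
    rintro v w hvw ⟨j, hj⟩
    have hv : v ∈ Q ⁻¹' {j} := hj ▸ rfl
    have hw : w ∈ Q ⁻¹' {j} := by
      simp only [Set.mem_preimage, Set.mem_singleton_iff] at hv ⊢; rw [← hvw, hv]
    rw [← hj] at hw
    exact hw.symm
  have hbound : ∀ {γ : Type} [Finite γ] (h : V → γ), (∀ v w, P v = P w → h v = h w) →
      (∀ v w, Q v = Q w → h v = h w) →
      (∀ c, ∃ v, (∀ j, P ⁻¹' {P v} ≠ Q ⁻¹' {j}) ∧ h v = c) →
      Nat.card Bad + Nat.card γ ≤ 1 + (X ∩ Y).card := by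
    intro γ _ h hP hQ hs
    rw [← Nat.card_sum, ← card_comps_conn U hU]
    refine le_trans ?_ (comps_delete U (X ∩ Y))
    refine comps_le_of_inv _ (fun v => if hb : ∃ j, P ⁻¹' {P v} = Q ⁻¹' {j} then
      (Sum.inl ⟨P v, hb⟩ : Bad ⊕ γ) else Sum.inr (h v)) ?_ ?_
    · rintro (⟨i, hi⟩ | c)
      · obtain ⟨v, rfl⟩ := hPs i
        exact ⟨v, by simp only [hi, dite_true]⟩
      · obtain ⟨v, hv, rfl⟩ := hs c
        refine ⟨v, ?_⟩
        have : ¬ ∃ j, P ⁻¹' {P v} = Q ⁻¹' {j} := by push Not; exact hv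
        simp only [this, dite_false]
    · apply hinv
      · intro v w hvw
        have := hP v w hvw
        simp only [hvw, this]
      · intro v w hvw
        have h1 := hQ v w hvw
        by_cases hb : ∃ j, P ⁻¹' {P v} = Q ⁻¹' {j}
        · have := hbadQ v w hvw hb
          simp only [this, h1]
        · by_cases hb' : ∃ j, P ⁻¹' {P w} = Q ⁻¹' {j}
          · have := hbadQ w v hvw.symm hb'
            simp only [this, h1]
          · simp only [hb, hb', dite_false, h1]
  have hs : Nat.card Bad ≤ (X ∩ Y).card := by
    have := hbound (fun _ => ()) (fun _ _ _ => rfl) (fun _ _ _ => rfl) (by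
      intro c
      obtain ⟨i, hi⟩ := hgood
      obtain ⟨v, rfl⟩ := hPs i
      exact ⟨v, hi, rfl⟩)
    rw [Nat.card_unique (α := Unit)] at this
    omega
  -- atoms
  set M := U.deleteEdges ((X ∪ Y : Finset (Sym2 V)) : Set (Sym2 V)) with hM
  have hMadj : ∀ v w, M.Adj v w → P v = P w ∧ Q v = Q w := by
    intro v w hvw
    rw [hM, deleteEdges_adj] at hvw
    simp only [Finset.coe_union, Set.mem_union, not_or] at hvw
    constructor
    · rw [← hXP]; apply Adj.reachable; rw [deleteEdges_adj]; exact ⟨hvw.1, hvw.2.1⟩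
    · rw [← hYQ]; apply Adj.reachable; rw [deleteEdges_adj]; exact ⟨hvw.1, hvw.2.2⟩
  set A := {x : Fin k × Fin k // ∃ v, P v = x.1 ∧ Q v = x.2} with hA
  let at' : V → A := fun v => ⟨(P v, Q v), v, rfl, rfl⟩
  have hats : Function.Surjective at' := by
    rintro ⟨⟨i, j⟩, v, hi, hj⟩; exact ⟨v, Subtype.ext (Prod.ext hi hj)⟩
  have hupper : Nat.card M.ConnectedComponent ≤ 2 * k - (X ∩ Y).card := by
    have h1 := comps_delete (U.deleteEdges (X : Set (Sym2 V))) (Y \ X)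
    have h2 : (U.deleteEdges (X : Set (Sym2 V))).deleteEdges ((Y \ X : Finset (Sym2 V)) : Set (Sym2 V)) = M := by
      rw [deleteEdges_deleteEdges, hM, ← Finset.coe_union, Finset.union_sdiff_self_eq_union]
    rw [h2] at h1
    have h3 := comps_le_of_reach (U.deleteEdges (X : Set (Sym2 V))) P (fun v w h => (hXP v w).2 h)
    rw [Nat.card_fin] at h3
    have h4 := Finset.card_sdiff_add_card_inter Y X
    rw [Finset.inter_comm] at h4
    omega
  have hlow : Nat.card A ≤ Nat.card M.ConnectedComponent :=
    comps_le_of_inv M at' hats (fun v w h => by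
      have := hMadj v w h
      simp only [at', this.1, this.2])
  -- degrees
  let d : Fin k → ℕ := fun i => Nat.card {j // ∃ v, P v = i ∧ Q v = j}
  let c : Fin k → ℕ := fun i => if ∃ j, P ⁻¹' {i} = Q ⁻¹' {j} then 1 else 2
  have hAd : Nat.card A = ∑ i, d i := by
    rw [← Nat.card_sigma]
    exact Nat.card_congr
      { toFun := fun x => ⟨x.1.1, x.1.2, x.2⟩
        invFun := fun y => ⟨(y.1, y.2.1), y.2.2⟩
        left_inv := fun _ => rfl
        right_inv := fun _ => rfl }
  have hdc : ∀ i, c i ≤ d i := by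
    intro i
    obtain ⟨v, rfl⟩ := hPs i
    by_cases hb : ∃ j, P ⁻¹' {P v} = Q ⁻¹' {j}
    · simp only [c, hb, if_true, d]
      have : Nonempty {j // ∃ w, P w = P v ∧ Q w = j} := ⟨⟨Q v, v, rfl, rfl⟩⟩
      exact Nat.card_pos
    · simp only [c, hb, if_false, d]
      have : ∃ w, P w = P v ∧ Q w ≠ Q v := by
        by_contra hcon
        push Not at hcon
        exact hb ⟨Q v, hsub _ _ (fun w hw => hcon w hw)⟩
      obtain ⟨w, hw1, hw2⟩ := this
      have : Nontrivial {j // ∃ w, P w = P v ∧ Q w = j} :=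
        ⟨⟨Q v, v, rfl, rfl⟩, ⟨Q w, w, hw1, rfl⟩, fun h => hw2 (congrArg Subtype.val h).symm⟩
      exact Finite.one_lt_card
  have hc : ∑ i, c i + Nat.card Bad = 2 * k := by
    have h1 : Nat.card Bad = ∑ i : Fin k, if ∃ j, P ⁻¹' {i} = Q ⁻¹' {j} then 1 else 0 := by
      rw [Nat.card_eq_fintype_card, Fintype.card_subtype, Finset.card_filter]
    rw [h1, ← Finset.sum_add_distrib]
    have : ∀ i : Fin k, c i + (if ∃ j, P ⁻¹' {i} = Q ⁻¹' {j} then 1 else 0) = 2 := by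
      intro i
      simp only [c]
      split_ifs <;> rfl
    rw [Finset.sum_congr rfl (fun i _ => this i)]
    simp [mul_comm]
  have hcd : ∑ i, c i ≤ ∑ i, d i := Finset.sum_le_sum (fun i _ => hdc i)
  have hXY : (X ∩ Y).card ≤ k := hX ▸ Finset.card_le_card Finset.inter_subset_left
  refine ⟨?_, ?_, ?_⟩
  · intro v w h1 h2
    refine ⟨M, deleteEdges_le _, hMadj, ?_⟩
    by_contra hr
    have hfin : Finite M.ConnectedComponent := Quot.finite _
    let f : M.ConnectedComponent → A := fun c => Quot.lift at' (fun a b hab =>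
      inv_of_reach (M := M) at' (fun v w h => by
        have := hMadj v w h
        simp only [at', this.1, this.2]) a b hab) c
    have hfs : Function.Surjective f := by
      intro b
      obtain ⟨v, rfl⟩ := hats b
      exact ⟨M.connectedComponentMk v, rfl⟩
    have hb := (Nat.bijective_iff_surjective_and_card f).2 ⟨hfs, by omega⟩
    apply hr
    apply ConnectedComponent.exact
    apply hb.1
    change at' v = at' w
    simp only [at', h1, h2]
  · intro i hi
    have := (Finset.sum_eq_sum_iff_of_le (fun i _ => hdc i)).1 (le_antisymm hcd (by omega)) i
      (Finset.mem_univ i)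
    have h2 : ¬ ∃ j, P ⁻¹' {i} = Q ⁻¹' {j} := by push Not; exact hi
    simp only [c, h2, if_false] at this
    exact this.symm
  · intro h hP hQ ht hf
    have := hbound h hP hQ (by rintro (_ | _); exacts [hf, ht])
    simp only [Nat.card_eq_fintype_card (α := Bool), Fintype.card_bool] at this
    omega

theorem fwd {V : Type*} [Fintype V] (G : SimpleGraph V)
    (p : V → ℝ) (hp : ∀ v, 0 < p v) (k : ℕ) (hk : 2 ≤ k)
    (P Q : V → Fin k)
    (hP : IsBalancedPartition G p k P) (hQ : IsBalancedPartition G p k Q)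
    (hne : Set.range (fun i : Fin k => P ⁻¹' {i}) ≠
      Set.range (fun i : Fin k => Q ⁻¹' {i}))
    (T T' : SimpleGraph V) (hT : MemB G p k 0 T)
    (hTP : InducesPartition T p k P) (hTQ : InducesPartition T' p k Q)
    (hB : BUDStep G p k 0 T T') :
    (∃ l : ℕ, l + 2 ≤ k ∧ ∃ σ : Fin (l + 2) → Fin k, Function.Injective σ ∧
      ∃ H : Fin (l + 2) → Set V,
        (∀ i, (H i).Nonempty) ∧
        (∀ i, H i ⊆ P ⁻¹' {σ i}) ∧
        (∀ i, (G.induce (H i)).Connected) ∧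
        (∀ i, (G.induce (P ⁻¹' {σ i} \ H i)).Connected) ∧
        (∀ i, ∃ u ∈ P ⁻¹' {σ i}, ∃ x ∈ P ⁻¹' {σ (i + 1)}, G.Adj u x) ∧
        (∀ i : Fin (l + 2), ((P ⁻¹' {σ (i + 1)} \ H (i + 1)) ∪ H i) ∈
          Set.range (fun j : Fin k => Q ⁻¹' {j})) ∧
        (∀ j : Fin k, j ∉ Set.range σ →
          P ⁻¹' {j} ∈ Set.range (fun j' : Fin k => Q ⁻¹' {j'}))) := by
  classical
  obtain ⟨S, ⟨hS1, hS2, hS3, -⟩, hS5⟩ := hTP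
  obtain ⟨S', ⟨hS1', hS2', hS3', -⟩, hS5'⟩ := hTQ
  obtain ⟨-, -, e, ⟨heG, heT⟩, f, hf, rfl⟩ := hB
  set U := T ⊔ fromEdgeSet {e} with hU
  have hUG : U ≤ G := by
    refine sup_le hT.1 ?_
    intro x y hxy
    rw [fromEdgeSet_adj, Set.mem_singleton_iff] at hxy
    rw [← mem_edgeSet, hxy.1]; exact heG
  have hUc : U.Connected := hT.2.1.connected.mono le_sup_left
  have heS : e ∉ S := fun h => heT (hS1 h)
  have hfS : f ∉ S' := by
    intro h
    have := hS1' h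
    rw [edgeSet_deleteEdges] at this
    exact this.2 rfl
  have hXeq : U.deleteEdges ((insert e S : Finset (Sym2 V)) : Set (Sym2 V))
      = T.deleteEdges (S : Set (Sym2 V)) := by
    ext x y
    simp only [hU, deleteEdges_adj, sup_adj, fromEdgeSet_adj, Finset.coe_insert,
      Set.mem_insert_iff, Set.mem_singleton_iff, not_or]
    constructor
    · rintro ⟨h | h, h1, h2⟩
      · exact ⟨h, h2⟩
      · exact absurd h.1 h1
    · rintro ⟨h, h2⟩
      refine ⟨Or.inl h, ?_, h2⟩
      rintro rfl
      exact heT h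
  have hYeq : U.deleteEdges ((insert f S' : Finset (Sym2 V)) : Set (Sym2 V))
      = (U.deleteEdges {f}).deleteEdges (S' : Set (Sym2 V)) := by
    rw [deleteEdges_deleteEdges, Finset.coe_insert, Set.insert_eq]
  have hPs : Function.Surjective P := fun i => by
    obtain ⟨v, hv⟩ := (hP.1 i).nonempty
    exact ⟨v, hv⟩
  have hQs : Function.Surjective Q := fun i => by
    obtain ⟨v, hv⟩ := (hQ.1 i).nonempty
    exact ⟨v, hv⟩
  have hsub : ∀ i j, P ⁻¹' {i} ⊆ Q ⁻¹' {j} → P ⁻¹' {i} = Q ⁻¹' {j} := fun i j h =>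
    wt_eq p hp _ _ h ((hP.2 i).trans (hQ.2 j).symm)
  have hsub' : ∀ i j, Q ⁻¹' {i} ⊆ P ⁻¹' {j} → Q ⁻¹' {i} = P ⁻¹' {j} := fun i j h =>
    wt_eq p hp _ _ h ((hQ.2 i).trans (hP.2 j).symm)
  have hgood : ∃ i, ∀ j, P ⁻¹' {i} ≠ Q ⁻¹' {j} := by
    by_contra hcon
    push Not at hcon
    apply hne
    apply Set.Subset.antisymm
    · rintro _ ⟨i, rfl⟩
      obtain ⟨j, hj⟩ := hcon i
      exact ⟨j, hj.symm⟩
    · rintro _ ⟨j, rfl⟩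
      obtain ⟨v, rfl⟩ := hQs j
      obtain ⟨j, hj⟩ := hcon (P v)
      have : v ∈ Q ⁻¹' {j} := hj ▸ rfl
      have h2 : Q v = j := this
      exact ⟨P v, by simp only [hj, h2]⟩
  have hcol : ∀ v, (∀ j, P ⁻¹' {P v} ≠ Q ⁻¹' {j}) → ∀ j, Q ⁻¹' {Q v} ≠ P ⁻¹' {j} := by
    intro v h j hj
    have : v ∈ P ⁻¹' {j} := hj ▸ rfl
    have h2 : P v = j := this
    exact h (Q v) (by rw [hj, h2])
  have hcol' : ∀ v, (∀ j, Q ⁻¹' {Q v} ≠ P ⁻¹' {j}) → ∀ j, P ⁻¹' {P v} ≠ Q ⁻¹' {j} := by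
    intro v h j hj
    have : v ∈ Q ⁻¹' {j} := hj ▸ rfl
    have h2 : Q v = j := this
    exact h (P v) (by rw [hj, h2])
  have hgood' : ∃ i, ∀ j, Q ⁻¹' {i} ≠ P ⁻¹' {j} := by
    obtain ⟨i, hi⟩ := hgood
    obtain ⟨v, rfl⟩ := hPs i
    exact ⟨Q v, hcol v hi⟩
  have hXc : (insert e S).card = k := by rw [Finset.card_insert_of_notMem heS]; omega
  have hYc : (insert f S').card = k := by rw [Finset.card_insert_of_notMem hfS]; omega
  have hXP : ∀ v w, (U.deleteEdges ((insert e S : Finset (Sym2 V)) : Set (Sym2 V))).Reachable v w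
      ↔ P v = P w := by rw [hXeq]; exact hS5
  have hYQ : ∀ v w, (U.deleteEdges ((insert f S' : Finset (Sym2 V)) : Set (Sym2 V))).Reachable v w
      ↔ Q v = Q w := by rw [hYeq]; exact hS5'
  obtain ⟨c1, c2, c3⟩ := core U hUc P Q _ _ hXc hYc hXP hYQ hPs hsub hgood
  obtain ⟨-, r2, -⟩ := core U hUc Q P _ _ hYc hXc hYQ hXP hQs hsub' hgood'
  let A := {x : Fin k × Fin k // (∃ v, P v = x.1 ∧ Q v = x.2) ∧ ∀ j, P ⁻¹' {x.1} ≠ Q ⁻¹' {j}}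
  let at' : A → Set V := fun x => {v | P v = x.1.1 ∧ Q v = x.1.2}
  have hatne : ∀ x, (at' x).Nonempty := fun x => x.2.1
  have hatc : ∀ x, (G.induce (at' x)).Connected := by
    intro x
    obtain ⟨v0, hv0⟩ := hatne x
    have : ∃ M : SimpleGraph V, M ≤ U ∧ (∀ v w, M.Adj v w → P v = P w ∧ Q v = Q w) ∧
        ∀ v ∈ at' x, ∀ w ∈ at' x, M.Reachable v w := by
      refine ⟨SimpleGraph.mk (fun v w => U.Adj v w ∧ P v = P w ∧ Q v = Q w)
        ⟨fun v w h => ⟨h.1.symm, h.2.1.symm, h.2.2.symm⟩⟩ ⟨fun v h => h.1.ne rfl⟩,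
        fun v w h => h.1, fun v w h => h.2, ?_⟩
      intro v hv w hw
      obtain ⟨M, hM1, hM2, hM3⟩ := c1 v w (hv.1.trans hw.1.symm) (hv.2.trans hw.2.symm)
      exact hM3.mono (fun a b h => ⟨hM1 h, hM2 a b h⟩)
    obtain ⟨M, hM1, hM2, hM3⟩ := this
    refine induce_conn (hM1.trans hUG) _ (hatne x) ?_ hM3
    intro v w h hv
    exact ⟨(hM2 v w h).1 ▸ hv.1, (hM2 v w h).2 ▸ hv.2⟩
  have hα : ∀ x : A, ∃ y : A, y.1.1 = x.1.1 ∧ y ≠ x ∧ ∀ z : A, z.1.1 = x.1.1 → z = x ∨ z = y := by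
    rintro ⟨⟨i, j⟩, ⟨v, hv1, hv2⟩, hx⟩
    simp only at hv1 hv2 hx
    obtain ⟨⟨j', hj'⟩, hy1, hy2⟩ := (Nat.card_eq_two_iff' (⟨j, v, hv1, hv2⟩ :
      {j // ∃ v, P v = i ∧ Q v = j})).1 (c2 i hx)
    refine ⟨⟨(i, j'), hj', hx⟩, rfl, ?_, ?_⟩
    · intro h
      apply hy1
      apply Subtype.ext
      exact congrArg (fun z : A => z.1.2) h
    · rintro ⟨⟨i', j''⟩, hz1, hz2⟩ hi
      simp only at hi hz1
      subst hi
      by_cases h : j'' = j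
      · left; subst h; rfl
      · right
        have := hy2 ⟨j'', hz1⟩ (fun h' => h (congrArg Subtype.val h'))
        have := congrArg Subtype.val this
        simp only at this
        subst this; rfl
  have hβ : ∀ x : A, ∃ y : A, y.1.2 = x.1.2 ∧ y ≠ x ∧ ∀ z : A, z.1.2 = x.1.2 → z = x ∨ z = y := by
    rintro ⟨⟨i, j⟩, ⟨v, hv1, hv2⟩, hx⟩
    simp only at hv1 hv2 hx
    have hx' : ∀ i', Q ⁻¹' {j} ≠ P ⁻¹' {i'} := by
      subst hv1 hv2; exact hcol v hx
    obtain ⟨⟨i', w, hw1, hw2⟩, hy1, hy2⟩ := (Nat.card_eq_two_iff' (⟨i, v, hv2, hv1⟩ :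
      {i // ∃ v, Q v = j ∧ P v = i})).1 (r2 j hx')
    refine ⟨⟨(i', j), ⟨w, hw2, hw1⟩, ?_⟩, rfl, ?_, ?_⟩
    · simp only
      rw [← hw2]; apply hcol'; rw [hw1]; exact hx'
    · intro h
      apply hy1
      apply Subtype.ext
      exact congrArg (fun z : A => z.1.1) h
    · rintro ⟨⟨i'', j'⟩, ⟨u, hu1, hu2⟩, hz2⟩ hi
      simp only at hi hu1 hu2
      subst hi
      by_cases h : i'' = i
      · left; subst h; rfl
      · right
        have := hy2 ⟨i'', u, hu2, hu1⟩ (fun h' => h (congrArg Subtype.val h'))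
        have := congrArg Subtype.val this
        simp only at this
        subst this; rfl
  choose α hα1 hα2 hα3 using hα
  choose β hβ1 hβ2 hβ3 using hβ
  obtain ⟨i0, hi0⟩ := hgood
  obtain ⟨v0, rfl⟩ := hPs i0
  obtain ⟨l, γ, hγ1, hγ2, hγ3⟩ := dihedral (fun x : A => x.1.1) (fun x : A => x.1.2) α β
    hα1 hα2 hα3 hβ1 hβ2 hβ3 (fun x y h1 h2 => Subtype.ext (Prod.ext h1 h2))
    ⟨(P v0, Q v0), ⟨v0, rfl, rfl⟩, hi0⟩
  have hαα : ∀ x, α (α x) = x := fun x => by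
    rcases hα3 (α x) x (hα1 x).symm with h | h
    · exact absurd h.symm (hα2 x)
    · exact h.symm
  have hat2 : ∀ x : A, P ⁻¹' {x.1.1} \ at' x = at' (α x) := by
    intro x
    ext v
    simp only [Set.mem_sdiff, Set.mem_preimage, Set.mem_singleton_iff, at', Set.mem_ofPred_eq]
    constructor
    · rintro ⟨h1, h2⟩
      rcases hα3 x ⟨(P v, Q v), ⟨v, rfl, rfl⟩, by rw [h1]; exact x.2.2⟩ h1 with h | h
      · exact absurd ⟨h1, congrArg (fun z : A => z.1.2) h⟩ h2
      · rw [← h]; exact ⟨rfl, rfl⟩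
    · rintro ⟨h1, h2⟩
      have h3 := hα1 x
      refine ⟨h1.trans h3, ?_⟩
      rintro ⟨h4, h5⟩
      exact hα2 x (Subtype.ext (Prod.ext h3 (h2.symm.trans h5)))
  have hatQ : ∀ x : A, Q ⁻¹' {x.1.2} = at' (β x) ∪ at' x := by
    intro x
    have hx2 : ∀ i', Q ⁻¹' {x.1.2} ≠ P ⁻¹' {i'} := by
      obtain ⟨v, h1, h2⟩ := x.2.1
      rw [← h2]; apply hcol; rw [h1]; exact x.2.2
    ext v
    simp only [Set.mem_union, Set.mem_preimage, Set.mem_singleton_iff, at', Set.mem_ofPred_eq]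
    constructor
    · intro h1
      rcases hβ3 x ⟨(P v, Q v), ⟨v, rfl, rfl⟩, hcol' v (by rw [h1]; exact hx2)⟩ h1 with h | h
      · right; rw [← h]; exact ⟨rfl, rfl⟩
      · left; rw [← h]; exact ⟨rfl, rfl⟩
    · rintro (h | h)
      · exact h.2.trans (hβ1 x)
      · exact h.2
  have hQi : ∀ i, Q ⁻¹' {(γ i).1.2} = (P ⁻¹' {(γ (i + 1)).1.1} \ at' (γ (i + 1))) ∪ at' (γ i) := by
    intro i
    rw [hat2, hγ2, hαα, hatQ]
  refine ⟨l, ?_, fun i => (γ i).1.1, hγ1, fun i => at' (γ i), fun i => hatne _,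
    fun i v hv => hv.1, fun i => hatc _, fun i => ?_, fun i => ?_, fun i => ?_, fun j hj => ?_⟩
  · simpa using Fintype.card_le_of_injective _ hγ1
  · rw [hat2]; exact hatc _
  · have hs : Q ⁻¹' {(γ i).1.2} ⊆ P ⁻¹' {(γ i).1.1} ∪ P ⁻¹' {(γ (i + 1)).1.1} := by
      rw [hQi]
      rintro v (hv | hv)
      · exact Or.inr hv.1
      · exact Or.inl hv.1
    refine crossing _ _ _ (hQ.1 (γ i).1.2) hs ?_ ?_ ?_
    · obtain ⟨v, hv⟩ := hatne (γ i)
      exact ⟨v, hv.2, hv.1⟩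
    · obtain ⟨v, hv⟩ := hatne (α (γ (i + 1)))
      refine ⟨v, ?_, ?_⟩
      · rw [hQi, hat2]; exact Or.inl hv
      · rw [← hat2] at hv; exact hv.1
    · rw [Set.disjoint_left]
      intro v h1 h2
      have h3 : (γ i).1.1 = (γ (i + 1)).1.1 := Eq.trans (Eq.symm h1) h2
      have := hγ1 h3
      simp at this
  · exact ⟨_, hQi i⟩
  · by_contra hcon
    have hjg : ∀ j', P ⁻¹' {j} ≠ Q ⁻¹' {j'} := fun j' h => hcon ⟨j', h.symm⟩
    obtain ⟨w, rfl⟩ := hPs j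
    refine c3 (fun v => decide (∃ i, (γ i).1.1 = P v)) ?_ ?_ ?_ ?_
    · intro v w h; simp only [h]
    · have key : ∀ v w, Q v = Q w → (∃ i, (γ i).1.1 = P v) → ∃ i, (γ i).1.1 = P w := by
        rintro v w hvw ⟨i, hi⟩
        have hvg : ∀ j, P ⁻¹' {P v} ≠ Q ⁻¹' {j} := by rw [← hi]; exact (γ i).2.2
        have hwg : ∀ j, P ⁻¹' {P w} ≠ Q ⁻¹' {j} := hcol' w (by rw [← hvw]; exact hcol v hvg)
        exact hγ3 ⟨(P v, Q v), ⟨v, rfl, rfl⟩, hvg⟩ ⟨(P w, Q w), ⟨w, rfl, rfl⟩, hwg⟩ ⟨i, hi⟩ hvw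
      intro v w h
      rw [decide_eq_decide]
      exact ⟨key v w h, key w v h.symm⟩
    · obtain ⟨v, h1, h2⟩ := (γ 0).2.1
      exact ⟨v, by rw [h1]; exact (γ 0).2.2, by simp only [decide_eq_true_eq]; exact ⟨0, h1.symm⟩⟩
    · refine ⟨w, hjg, ?_⟩
      simp only [decide_eq_false_iff_not]
      exact hj

theorem cut_ok {V : Type*} [Fintype V] (G : SimpleGraph V) (p : V → ℝ) (k : ℕ) (hk : 2 ≤ k)
    (P : V → Fin k) (hP : IsBalancedPartition G p k P) (T : SimpleGraph V) (hTG : T ≤ G)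
    (hT : T.IsTree) (S : Finset (Sym2 V)) (hS : (S : Set (Sym2 V)) ⊆ T.edgeSet)
    (hc : S.card ≤ k - 1)
    (hadj : ∀ v w, (T.deleteEdges (S : Set (Sym2 V))).Adj v w → P v = P w) :
    MemB G p k 0 T ∧ InducesPartition T p k P := by
  classical
  set M := T.deleteEdges (S : Set (Sym2 V)) with hM
  have hPs : Function.Surjective P := fun i => by
    obtain ⟨v, hv⟩ := (hP.1 i).nonempty
    exact ⟨v, hv⟩
  have h1 := comps_le_of_inv M P hPs hadj
  have h2 := comps_delete T S
  rw [card_comps_conn T hT.connected, ← hM] at h2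
  rw [Nat.card_fin] at h1
  have hfin : Finite M.ConnectedComponent := Quot.finite _
  have hr : ∀ v w, M.Reachable v w ↔ P v = P w := by
    intro v w
    refine ⟨inv_of_reach P hadj v w, fun h => ?_⟩
    let f : M.ConnectedComponent → Fin k := fun c => Quot.lift P (fun a b hab =>
      inv_of_reach (M := M) P hadj a b hab) c
    have hfs : Function.Surjective f := by
      intro b
      obtain ⟨v, rfl⟩ := hPs b
      exact ⟨M.connectedComponentMk v, rfl⟩
    have hb := (Nat.bijective_iff_surjective_and_card f).2 ⟨hfs, by rw [Nat.card_fin]; omega⟩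
    apply ConnectedComponent.exact
    apply hb.1
    exact h
  have hcut : IsBalancedCutSet T p k 0 S := by
    refine ⟨hS, by omega, by rw [← hM]; omega, ?_⟩
    change ∀ c : M.ConnectedComponent, compWeight M p c ∈ _
    intro c
    induction c using ConnectedComponent.ind with
    | _ v =>
    have : (M.connectedComponentMk v).supp = P ⁻¹' {P v} := by
      ext w
      rw [ConnectedComponent.mem_supp_iff, ConnectedComponent.eq, hr]
      rfl
    have h3 : compWeight M p (M.connectedComponentMk v) = (∑ᶠ v, p v) / k := by
      unfold compWeight
      rw [this]; exact hP.2 _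
    rw [h3]
    simp
  exact ⟨⟨hTG, hT, S, hcut⟩, S, hcut, hr⟩

theorem conn_reach {V : Type*} {G N : SimpleGraph V} (A : Set V) (hA : (G.induce A).Connected)
    (hN : ∀ v ∈ A, ∀ w ∈ A, G.Adj v w → N.Reachable v w) :
    ∀ v ∈ A, ∀ w ∈ A, N.Reachable v w := by
  intro v hv w hw
  obtain ⟨q⟩ := hA.preconnected ⟨v, hv⟩ ⟨w, hw⟩
  have key : ∀ x y : A, (G.induce A).Walk x y → N.Reachable (x : V) (y : V) := by
    intro x y q
    induction q with
    | nil => exact Reachable.refl _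
    | @cons x y z a _ ih => exact (hN _ x.2 _ y.2 a).trans ih
  exact key _ _ q

theorem bwd {V : Type*} [Fintype V] (G : SimpleGraph V) (hG : G.Connected)
    (p : V → ℝ) (k : ℕ) (hk : 2 ≤ k)
    (P Q : V → Fin k)
    (hP : IsBalancedPartition G p k P) (hQ : IsBalancedPartition G p k Q)
    (l : ℕ) (σ : Fin (l + 2) → Fin k) (hσ : Function.Injective σ)
    (H : Fin (l + 2) → Set V)
    (hH1 : ∀ i, (H i).Nonempty)
    (hH2 : ∀ i, H i ⊆ P ⁻¹' {σ i})
    (hH3 : ∀ i, (G.induce (H i)).Connected)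
    (hH4 : ∀ i, (G.induce (P ⁻¹' {σ i} \ H i)).Connected)
    (hH6 : ∀ i : Fin (l + 2), ((P ⁻¹' {σ (i + 1)} \ H (i + 1)) ∪ H i) ∈
          Set.range (fun j : Fin k => Q ⁻¹' {j}))
    (hH7 : ∀ j : Fin k, j ∉ Set.range σ →
          P ⁻¹' {j} ∈ Set.range (fun j' : Fin k => Q ⁻¹' {j'})) :
    ∃ T T' : SimpleGraph V, MemB G p k 0 T ∧ MemB G p k 0 T' ∧
        InducesPartition T p k P ∧ InducesPartition T' p k Q ∧
        BUDStep G p k 0 T T' := by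
  classical
  have hPs : Function.Surjective P := fun i => by
    obtain ⟨v, hv⟩ := (hP.1 i).nonempty
    exact ⟨v, hv⟩
  have hPH : ∀ {i v}, v ∈ H i → P v = σ i := fun {i v} h => hH2 i h
  have hdisj : ∀ {i j v}, v ∈ H i → v ∈ H j → i = j := fun h1 h2 =>
    hσ ((hPH h1).symm.trans (hPH h2))
  have hsucc : ∀ i : Fin (l + 2), i + 1 ≠ i := by
    intro i h
    simp at h
  let at' : V → Fin k ⊕ Fin (l + 2) := fun v =>
    if h : ∃ i, v ∈ H i then Sum.inr h.choose else Sum.inl (P v)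
  have hatr : ∀ v i, at' v = Sum.inr i ↔ v ∈ H i := by
    intro v i
    by_cases h : ∃ i, v ∈ H i
    · simp only [at', h, dite_true, Sum.inr.injEq]
      constructor
      · rintro rfl; exact h.choose_spec
      · intro h'; exact hdisj h.choose_spec h'
    · simp only [at', h, dite_false, reduceCtorEq, false_iff]
      exact fun h' => h ⟨i, h'⟩
  have hatl : ∀ v j, at' v = Sum.inl j ↔ P v = j ∧ ∀ i, v ∉ H i := by
    intro v i
    by_cases h : ∃ i, v ∈ H i
    · simp only [at', h, dite_true, reduceCtorEq, false_iff]
      rintro ⟨-, h'⟩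
      exact h' _ h.choose_spec
    · simp only [at', h, dite_false, Sum.inl.injEq]
      push Not at h
      tauto
  have hD : ∀ v i, at' v = Sum.inl (σ i) ↔ v ∈ P ⁻¹' {σ i} \ H i := by
    intro v i
    rw [hatl]
    refine ⟨fun h => ⟨h.1, h.2 i⟩, fun h => ⟨h.1, fun j hj => h.2 ?_⟩⟩
    have : j = i := hσ ((hPH hj).symm.trans h.1)
    exact this ▸ hj
  have hats : Function.Surjective at' := by
    rintro (j | i)
    · by_cases hj : ∃ i, σ i = j
      · obtain ⟨i, rfl⟩ := hj
        obtain ⟨v, hv⟩ := (hH4 i).nonempty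
        exact ⟨v, (hD v i).2 hv⟩
      · obtain ⟨v, rfl⟩ := hPs j
        exact ⟨v, (hatl v _).2 ⟨rfl, fun i hi => hj ⟨i, (hPH hi).symm⟩⟩⟩
    · obtain ⟨v, hv⟩ := hH1 i
      exact ⟨v, (hatr v i).2 hv⟩
  have hatP : ∀ v w, at' v = at' w → P v = P w := by
    intro v w h
    rcases hw : at' w with j | i
    · rw [hw] at h
      rw [((hatl _ _).1 h).1, ((hatl _ _).1 hw).1]
    · rw [hw] at h
      rw [hPH ((hatr _ _).1 h), hPH ((hatr _ _).1 hw)]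
  have hQ1 : ∀ i v w, v ∈ (P ⁻¹' {σ (i + 1)} \ H (i + 1)) ∪ H i →
      w ∈ (P ⁻¹' {σ (i + 1)} \ H (i + 1)) ∪ H i → Q v = Q w := by
    intro i v w hv hw
    obtain ⟨j, hj⟩ := hH6 i
    simp only at hj
    rw [← hj] at hv hw
    exact Eq.trans hv (Eq.symm hw)
  have hatQ : ∀ v w, at' v = at' w → Q v = Q w := by
    intro v w h
    rcases hw : at' w with j | i
    · rw [hw] at h
      by_cases hj : ∃ i, σ i = j
      · obtain ⟨i, rfl⟩ := hj
        rw [hD] at h hw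
        rw [show i = (i - 1) + 1 by rw [sub_add_cancel]] at h hw
        exact hQ1 (i - 1) v w (Or.inl h) (Or.inl hw)
      · obtain ⟨j', hj'⟩ := hH7 j hj
        simp only at hj'
        have h1 : v ∈ P ⁻¹' {j} := ((hatl _ _).1 h).1
        have h2 : w ∈ P ⁻¹' {j} := ((hatl _ _).1 hw).1
        rw [← hj'] at h1 h2
        exact Eq.trans h1 (Eq.symm h2)
    · rw [hw] at h
      exact hQ1 i v w (Or.inr ((hatr _ _).1 h)) (Or.inr ((hatr _ _).1 hw))
  -- spanning forest of the atoms
  let GA : SimpleGraph V := SimpleGraph.mk (fun v w => G.Adj v w ∧ at' v = at' w)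
        ⟨fun v w h => ⟨h.1.symm, h.2.symm⟩⟩ ⟨fun v h => h.1.ne rfl⟩
  have hGAr : ∀ v w, at' v = at' w → GA.Reachable v w := by
    have hfib : ∀ x, (G.induce (at' ⁻¹' {x})).Connected := by
      rintro (j | i)
      · by_cases hj : ∃ i, σ i = j
        · obtain ⟨i, rfl⟩ := hj
          have : at' ⁻¹' {Sum.inl (σ i)} = P ⁻¹' {σ i} \ H i := by
            ext v; exact hD v i
          rw [this]; exact hH4 i
        · have : at' ⁻¹' {Sum.inl j} = P ⁻¹' {j} := by
            ext v
            refine (hatl v j).trans ⟨fun h => h.1, fun h => ⟨h, fun i hi => hj ⟨i, ?_⟩⟩⟩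
            exact (hPH hi).symm.trans h
          rw [this]; exact hP.1 j
      · have : at' ⁻¹' {Sum.inr i} = H i := by
          ext v; exact hatr v i
        rw [this]; exact hH3 i
    intro v w h
    refine conn_reach (N := GA) _ (hfib (at' w)) ?_ v h w rfl
    intro x hx y hy hxy
    apply Adj.reachable
    exact ⟨hxy, Eq.trans hx (Eq.symm hy)⟩
  obtain ⟨F0, hF1, hF2, hF3⟩ := exists_connecting GA _ ⊥ bot_le rfl
  have hF4 : F0.card + (k + (l + 2)) ≤ Nat.card V := by
    have h1 := comps_le_of_reach (⊥ : SimpleGraph V) id (fun v w h => by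
      simp only [id] at h; rw [h])
    have h2 := comps_le_of_inv GA at' hats (fun v w h => h.2)
    rw [Nat.card_sum, Nat.card_fin, Nat.card_fin] at h2
    omega
  have hF5 : ∀ v w, s(v, w) ∈ F0 → G.Adj v w ∧ at' v = at' w := fun v w h => hF1 h
  have hF6 : ∀ v w, at' v = at' w → (fromEdgeSet (F0 : Set (Sym2 V))).Reachable v w := by
    intro v w h
    have := hF3 v w (hGAr v w h)
    rwa [bot_sup_eq] at this
  -- connecting edges
  have ha : ∀ i : Fin (l + 2), ∃ u ∈ P ⁻¹' {σ (i + 1)} \ H (i + 1), ∃ x ∈ H i, G.Adj u x := by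
    intro i
    obtain ⟨j, hj⟩ := hH6 i
    simp only at hj
    obtain ⟨v, hv⟩ := (hH4 (i + 1)).nonempty
    obtain ⟨w, hw⟩ := hH1 i
    refine crossing _ _ _ (hQ.1 j) hj.subset ⟨v, hj ▸ Or.inl hv, hv⟩ ⟨w, hj ▸ Or.inr hw, hw⟩ ?_
    rw [Set.disjoint_left]
    intro x hx hx'
    exact hsucc i (hσ (Eq.trans (Eq.symm hx.1) (hPH hx')))
  have hc : ∀ i : Fin (l + 2), ∃ u ∈ P ⁻¹' {σ i} \ H i, ∃ x ∈ H i, G.Adj u x := by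
    intro i
    obtain ⟨v, hv⟩ := (hH4 i).nonempty
    obtain ⟨w, hw⟩ := hH1 i
    refine crossing _ _ _ (hP.1 (σ i)) ?_ ⟨v, hv.1, hv⟩ ⟨w, hH2 i hw, hw⟩ Set.disjoint_sdiff_left
    intro x hx
    by_cases h : x ∈ H i
    · exact Or.inr h
    · exact Or.inl ⟨hx, h⟩
  choose au hau ax hax haG using ha
  choose cu hcu cx hcx hcG using hc
  let a : Fin (l + 2) → Sym2 V := fun i => s(au i, ax i)
  let c : Fin (l + 2) → Sym2 V := fun i => s(cu i, cx i)
  have ham : ∀ i, Sym2.map at' (a i) = s(Sum.inl (σ (i + 1)), Sum.inr i) := by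
    intro i
    simp only [a, Sym2.map_mk]
    rw [(hD _ _).2 (hau i), (hatr _ _).2 (hax i)]
  have hcm : ∀ i, Sym2.map at' (c i) = s(Sum.inl (σ i), Sum.inr i) := by
    intro i
    simp only [c, Sym2.map_mk]
    rw [(hD _ _).2 (hcu i), (hatr _ _).2 (hcx i)]
  have haa : ∀ i j, a i = a j → i = j := by
    intro i j h
    have := congrArg (Sym2.map at') h
    rw [ham, ham] at this
    simp at this
    exact this.2
  have hcc : ∀ i j, c i = c j → i = j := by
    intro i j h
    have := congrArg (Sym2.map at') h
    rw [hcm, hcm] at this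
    simp at this
    exact this.2
  have hac : ∀ i j, a i ≠ c j := by
    intro i j h
    have := congrArg (Sym2.map at') h
    rw [ham, hcm] at this
    simp only [Sym2.eq_iff, Sum.inl.injEq, Sum.inr.injEq, reduceCtorEq, and_self, or_false] at this
    rw [← this.2] at this
    exact hsucc i (hσ this.1)
  have haF : ∀ i, a i ∉ F0 := by
    intro i h
    have := (hF5 _ _ h).2
    rw [(hD _ _).2 (hau i), (hatr _ _).2 (hax i)] at this
    cases this
  have hcF : ∀ i, c i ∉ F0 := by
    intro i h
    have := (hF5 _ _ h).2
    rw [(hD _ _).2 (hcu i), (hatr _ _).2 (hcx i)] at this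
    cases this
  let aS : Finset (Sym2 V) := Finset.univ.image a
  let cS : Finset (Sym2 V) := Finset.univ.image c
  have haS : aS.card ≤ l + 2 := Finset.card_image_le.trans (by simp)
  have hcS : cS.card ≤ l + 2 := Finset.card_image_le.trans (by simp)
  have haSm : ∀ i, a i ∈ aS := fun i => Finset.mem_image_of_mem _ (Finset.mem_univ i)
  have hcSm : ∀ i, c i ∈ cS := fun i => Finset.mem_image_of_mem _ (Finset.mem_univ i)
  -- everything on the cycle is mutually reachable
  have hrel : ∀ N : SimpleGraph V, (∀ v w, at' v = at' w → N.Reachable v w) →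
      (∀ i : Fin (l + 1), N.Reachable (cu i.castSucc) (cx i.castSucc)) →
      (∀ i : Fin (l + 1), N.Reachable (au i.castSucc) (ax i.castSucc)) →
      (N.Reachable (cu (Fin.last _)) (cx (Fin.last _)) ∨
        N.Reachable (au (Fin.last _)) (ax (Fin.last _))) →
      ∀ v w, P v ∈ Set.range σ → P w ∈ Set.range σ → N.Reachable v w := by
    intro N h1 h2 h3 h4
    have hd : ∀ i, N.Reachable (cu i) (cu 0) := by
      intro i
      induction i using Fin.induction with
      | zero => exact Reachable.refl _
      | succ i ih =>
        refine Reachable.trans ?_ ih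
        have e1 : N.Reachable (cx i.castSucc) (ax i.castSucc) :=
          h1 _ _ (by rw [(hatr _ _).2 (hax _), (hatr _ _).2 (hcx _)])
        have e2 : N.Reachable (au i.castSucc) (cu i.succ) :=
          h1 _ _ (by
            rw [(hD _ _).2 (hau _), (hD _ _).2 (hcu _), Fin.coeSucc_eq_succ])
        exact ((h2 i).trans (e1.trans ((h3 i).symm.trans e2))).symm
    have hh : ∀ i, N.Reachable (cx i) (cu 0) := by
      intro i
      induction i using Fin.lastCases with
      | cast i => exact (h2 i).symm.trans (hd _)
      | last =>
        rcases h4 with h4 | h4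
        · exact h4.symm.trans (hd _)
        · have e1 : N.Reachable (cx (Fin.last (l + 1))) (ax (Fin.last (l + 1))) :=
            h1 _ _ (by rw [(hatr _ _).2 (hax _), (hatr _ _).2 (hcx _)])
          have e2 : N.Reachable (au (Fin.last (l + 1))) (cu (Fin.last (l + 1) + 1)) :=
            h1 _ _ (by rw [(hD _ _).2 (hau _), (hD _ _).2 (hcu _)])
          exact e1.trans (h4.symm.trans (e2.trans (hd _)))
    have hv : ∀ v, P v ∈ Set.range σ → N.Reachable v (cu 0) := by
      rintro v ⟨i, hi⟩
      by_cases hvi : v ∈ H i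
      · exact (h1 _ _ (by rw [(hatr _ _).2 hvi, (hatr _ _).2 (hcx i)])).trans (hh i)
      · have : v ∈ P ⁻¹' {σ i} \ H i := ⟨hi.symm, hvi⟩
        exact (h1 _ _ (by rw [(hD _ _).2 this, (hD _ _).2 (hcu i)])).trans (hd i)
    intro v w h h'
    exact (hv v h).trans (hv w h').symm
  let E0 : Finset (Sym2 V) := F0 ∪ cS ∪ aS
  have hE0G : ∀ v w, s(v, w) ∈ E0 → G.Adj v w := by
    intro v w h
    simp only [E0, aS, cS, Finset.mem_union, Finset.mem_image, Finset.mem_univ, true_and] at h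
    rw [← mem_edgeSet]
    rcases h with (h | ⟨i, h⟩) | ⟨i, h⟩
    · exact (hF5 _ _ h).1
    · rw [← h]; exact hcG i
    · rw [← h]; exact haG i
  have hU0adj : ∀ v w, s(v, w) ∈ E0 → (fromEdgeSet (E0 : Set (Sym2 V))).Adj v w := by
    intro v w h
    rw [fromEdgeSet_adj]
    exact ⟨h, (hE0G v w h).ne⟩
  have hU0G : fromEdgeSet (E0 : Set (Sym2 V)) ≤ G := by
    intro v w h
    rw [fromEdgeSet_adj] at h
    exact hE0G v w h.1
  have haE : ∀ i, a i ∈ E0 := fun i => Finset.mem_union_right _ (haSm i)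
  have hcE : ∀ i, c i ∈ E0 := fun i =>
    Finset.mem_union_left _ (Finset.mem_union_right _ (hcSm i))
  have hFE : F0 ⊆ E0 := fun x hx => Finset.mem_union_left _ (Finset.mem_union_left _ hx)
  have hU0at : ∀ v w, at' v = at' w → (fromEdgeSet (E0 : Set (Sym2 V))).Reachable v w :=
    fun v w h => (hF6 v w h).mono (fromEdgeSet_mono (by exact_mod_cast hFE))
  have hU0comps : Nat.card (fromEdgeSet (E0 : Set (Sym2 V))).ConnectedComponent
      + (l + 2) ≤ k + 1 := by
    have h1 := comps_le_of_reach (fromEdgeSet (E0 : Set (Sym2 V)))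
      (fun v => if h : P v ∈ Set.range σ then none else
        (some ⟨P v, h⟩ : Option {j // ¬ j ∈ Set.range σ})) (by
      intro v w hvw
      by_cases hv : P v ∈ Set.range σ
      · by_cases hw : P w ∈ Set.range σ
        · exact hrel _ hU0at (fun i => (hU0adj _ _ (hcE _)).reachable)
            (fun i => (hU0adj _ _ (haE _)).reachable)
            (Or.inl (hU0adj _ _ (hcE _)).reachable) v w hv hw
        · simp only [hv, hw, dite_true, dite_false, reduceCtorEq] at hvw
      · by_cases hw : P w ∈ Set.range σ
        · simp only [hv, hw, dite_true, dite_false, reduceCtorEq] at hvw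
        · simp only [hv, hw, dite_false, Option.some.injEq, Subtype.mk.injEq] at hvw
          apply hU0at
          rw [(hatl v (P v)).2 ⟨rfl, fun i hi => hv ⟨i, (hPH hi).symm⟩⟩,
            (hatl w (P v)).2 ⟨hvw.symm, fun i hi => hw ⟨i, (hPH hi).symm⟩⟩])
    rw [Finite.card_option] at h1
    have h2 : Nat.card {j // j ∈ Set.range σ} + Nat.card {j // ¬ j ∈ Set.range σ} = k := by
      rw [← Nat.card_sum, Nat.card_congr (Equiv.sumCompl _), Nat.card_fin]
    have h3 : Nat.card {j // j ∈ Set.range σ} = l + 2 := by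
      have := Nat.card_range_of_injective hσ
      rw [Nat.card_fin] at this
      exact this
    omega
  obtain ⟨Z, hZ1, hZ2, hZ3⟩ := exists_connecting G _ _ hU0G rfl
  rw [card_comps_conn G hG] at hZ2
  have hZc : Z.card + (l + 2) ≤ k := by omega
  let EU : Finset (Sym2 V) := E0 ∪ Z
  have hEUG : ∀ v w, s(v, w) ∈ EU → G.Adj v w := by
    intro v w h
    rcases Finset.mem_union.1 h with h | h
    · exact hE0G v w h
    · exact hZ1 h
  have hEUc : EU.card ≤ Nat.card V := by
    have h1 : EU.card ≤ E0.card + Z.card := Finset.card_union_le _ _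
    have h2 : E0.card ≤ (F0 ∪ cS).card + aS.card := Finset.card_union_le _ _
    have h3 : (F0 ∪ cS).card ≤ F0.card + cS.card := Finset.card_union_le _ _
    omega
  set U : SimpleGraph V := fromEdgeSet (EU : Set (Sym2 V)) with hU
  have hUG : U ≤ G := by
    intro v w h
    rw [hU, fromEdgeSet_adj] at h
    exact hEUG v w h.1
  have hUadj : ∀ v w, U.Adj v w ↔ s(v, w) ∈ EU := by
    intro v w
    rw [hU, fromEdgeSet_adj]
    exact ⟨fun h => h.1, fun h => ⟨h, (hEUG v w h).ne⟩⟩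
  have hUr : ∀ v w, U.Reachable v w := by
    intro v w
    refine (hZ3 v w (hG.preconnected v w)).mono ?_
    rw [← fromEdgeSet_union, hU, ← Finset.coe_union]
  have hne := hG.nonempty
  have htree : ∀ g ∈ EU, (∀ v w, s(v, w) = g → (U.deleteEdges {g}).Reachable v w) →
      (U.deleteEdges {g}).IsTree := by
    intro g hg hr
    have hconn : (U.deleteEdges {g}).Connected := by
      refine ⟨fun v w => reach_of_adj ?_ v w (hUr v w)⟩
      intro x y hxy
      by_cases h : s(x, y) = g
      · exact hr x y h
      · apply Adj.reachable
        rw [deleteEdges_adj]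
        exact ⟨hxy, h⟩
    rw [isTree_iff_connected_and_card]
    refine ⟨hconn, ?_⟩
    have h1 := hconn.card_vert_le_card_edgeSet_add_one
    have h2 : Nat.card (U.deleteEdges {g}).edgeSet ≤ (EU.erase g).card := by
      rw [Nat.card_coe_set_eq, ← Set.ncard_coe_finset]
      refine Set.ncard_le_ncard ?_ (Finset.finite_toSet _)
      intro x hx
      rw [edgeSet_deleteEdges] at hx
      induction x using Sym2.ind with
      | _ x y =>
      rw [Finset.mem_coe, Finset.mem_erase]
      exact ⟨hx.2, (hUadj x y).1 hx.1⟩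
    rw [Finset.card_erase_of_mem hg] at h2
    have h3 : 0 < EU.card := Finset.card_pos.2 ⟨g, hg⟩
    omega
  have haEU : ∀ i, a i ∈ EU := fun i => Finset.mem_union_left _ (haE i)
  have hcEU : ∀ i, c i ∈ EU := fun i => Finset.mem_union_left _ (hcE i)
  have hdel : ∀ g v w, s(v, w) ∈ EU → s(v, w) ≠ g → (U.deleteEdges {g}).Reachable v w := by
    intro g v w h1 h2
    apply Adj.reachable
    rw [deleteEdges_adj]
    exact ⟨(hUadj v w).2 h1, h2⟩
  have hdelat : ∀ g, g ∉ F0 → ∀ v w, at' v = at' w → (U.deleteEdges {g}).Reachable v w := by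
    intro g hg v w h
    refine reach_of_adj ?_ v w (hF6 v w h)
    intro x y hxy
    rw [fromEdgeSet_adj] at hxy
    refine hdel g x y (Finset.mem_union_left _ (hFE hxy.1)) ?_
    rintro rfl
    exact hg hxy.1
  have haP : ∀ i v w, s(v, w) = a i → P v ∈ Set.range σ ∧ P w ∈ Set.range σ := by
    intro i v w h
    have h1 : P (au i) = σ (i + 1) := (hau i).1
    have h2 : P (ax i) = σ i := hPH (hax i)
    rcases Sym2.eq_iff.1 h with ⟨rfl, rfl⟩ | ⟨rfl, rfl⟩
    · exact ⟨⟨_, h1.symm⟩, ⟨_, h2.symm⟩⟩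
    · exact ⟨⟨_, h2.symm⟩, ⟨_, h1.symm⟩⟩
  have hcP : ∀ i v w, s(v, w) = c i → P v = σ i ∧ P w = σ i := by
    intro i v w h
    have h1 : P (cu i) = σ i := (hcu i).1
    have h2 : P (cx i) = σ i := hPH (hcx i)
    rcases Sym2.eq_iff.1 h with ⟨rfl, rfl⟩ | ⟨rfl, rfl⟩
    · exact ⟨h1, h2⟩
    · exact ⟨h2, h1⟩
  have haQ : ∀ i v w, s(v, w) = a i → Q v = Q w := by
    intro i v w h
    have := hQ1 i (au i) (ax i) (Or.inl (hau i)) (Or.inr (hax i))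
    rcases Sym2.eq_iff.1 h with ⟨rfl, rfl⟩ | ⟨rfl, rfl⟩
    · exact this
    · exact this.symm
  have hT : (U.deleteEdges {a (Fin.last _)}).IsTree := by
    refine htree _ (haEU _) (fun v w h => ?_)
    refine hrel _ (hdelat _ (haF _)) (fun i => hdel _ _ _ (hcEU _) (fun h => hac _ _ h.symm))
      (fun i => hdel _ _ _ (haEU _) (fun h => ?_))
      (Or.inl (hdel _ _ _ (hcEU _) (fun h => hac _ _ h.symm))) v w (haP _ v w h).1 (haP _ v w h).2
    exact absurd (haa _ _ h) (Fin.castSucc_ne_last i)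
  have hT' : (U.deleteEdges {c (Fin.last _)}).IsTree := by
    refine htree _ (hcEU _) (fun v w h => ?_)
    refine hrel _ (hdelat _ (hcF _)) (fun i => hdel _ _ _ (hcEU _) (fun h => ?_))
      (fun i => hdel _ _ _ (haEU _) (fun h => hac _ _ h))
      (Or.inr (hdel _ _ _ (haEU _) (fun h => hac _ _ h))) v w
      ⟨_, (hcP _ v w h).1.symm⟩ ⟨_, (hcP _ v w h).2.symm⟩
    exact absurd (hcc _ _ h) (Fin.castSucc_ne_last i)
  have hgen : ∀ (g : Sym2 V) (B : Finset (Sym2 V)), g ∈ B → B ⊆ EU → B.card ≤ k →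
      ((B.erase g : Finset (Sym2 V)) : Set (Sym2 V)) ⊆ (U.deleteEdges {g}).edgeSet ∧
      (B.erase g).card ≤ k - 1 ∧ (∀ v w, ((U.deleteEdges {g}).deleteEdges
        ((B.erase g : Finset (Sym2 V)) : Set (Sym2 V))).Adj v w → s(v, w) ∈ EU ∧ s(v, w) ∉ B) := by
    intro g B hg hB hBc
    refine ⟨?_, ?_, ?_⟩
    · intro x hx
      rw [Finset.mem_coe, Finset.mem_erase] at hx
      rw [edgeSet_deleteEdges]
      refine ⟨?_, hx.1⟩
      induction x using Sym2.ind with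
      | _ x y => exact (hUadj x y).2 (hB hx.2)
    · rw [Finset.card_erase_of_mem hg]; omega
    · intro v w h
      simp only [deleteEdges_adj, hUadj, Set.mem_singleton_iff, Finset.mem_coe,
        Finset.mem_erase] at h
      exact ⟨h.1.1, fun hb => h.2 ⟨h.1.2, hb⟩⟩
  obtain ⟨s1, s2, s3⟩ := hgen (a (Fin.last _)) (aS ∪ Z) (Finset.mem_union_left _ (haSm _))
    (Finset.union_subset_union_left Finset.subset_union_right)
    ((Finset.card_union_le _ _).trans (by omega))
  obtain ⟨t1, t2, t3⟩ := hgen (c (Fin.last _)) (cS ∪ Z) (Finset.mem_union_left _ (hcSm _))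
    (Finset.union_subset_union_left (Finset.subset_union_right.trans Finset.subset_union_left))
    ((Finset.card_union_le _ _).trans (by omega))
  have hmem : ∀ x, x ∈ EU → (x ∈ F0 ∨ (∃ i, c i = x)) ∨ x ∈ aS ∪ Z := by
    intro x hx
    simp only [EU, E0, cS, Finset.mem_union, Finset.mem_image, Finset.mem_univ, true_and] at hx ⊢
    tauto
  have hmem' : ∀ x, x ∈ EU → (x ∈ F0 ∨ (∃ i, a i = x)) ∨ x ∈ cS ∪ Z := by
    intro x hx
    simp only [EU, E0, aS, Finset.mem_union, Finset.mem_image, Finset.mem_univ, true_and] at hx ⊢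
    tauto
  obtain ⟨m1, m2⟩ := cut_ok G p k hk P hP _ ((deleteEdges_le _).trans hUG) hT _ s1 s2 (by
    intro v w h
    obtain ⟨h1, h2⟩ := s3 v w h
    rcases (hmem _ h1).resolve_right h2 with h3 | ⟨i, h3⟩
    · exact hatP _ _ (hF5 _ _ h3).2
    · have := hcP i v w h3.symm
      rw [this.1, this.2])
  obtain ⟨n1, n2⟩ := cut_ok G p k hk Q hQ _ ((deleteEdges_le _).trans hUG) hT' _ t1 t2 (by
    intro v w h
    obtain ⟨h1, h2⟩ := t3 v w h
    rcases (hmem' _ h1).resolve_right h2 with h3 | ⟨i, h3⟩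
    · exact hatQ _ _ (hF5 _ _ h3).2
    · exact haQ i v w h3.symm)
  have hback : U.deleteEdges {a (Fin.last _)} ⊔ fromEdgeSet {a (Fin.last _)} = U := by
    ext v w
    simp only [sup_adj, deleteEdges_adj, fromEdgeSet_adj, Set.mem_singleton_iff]
    constructor
    · rintro (h | h)
      · exact h.1
      · rw [hUadj, h.1]; exact haEU _
    · intro h
      by_cases h' : s(v, w) = a (Fin.last _)
      · exact Or.inr ⟨h', h.ne⟩
      · exact Or.inl ⟨h, h'⟩
  refine ⟨_, _, m1, n1, m2, n2, m1, n1, a (Fin.last _), ⟨haG _, ?_⟩, c (Fin.last _), ?_, ?_⟩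
  · rw [edgeSet_deleteEdges]
    exact fun h => h.2 rfl
  · rw [hback]
    exact (hUadj _ _).2 (hcEU _)
  · rw [hback]

/-- Characterization of single BUD steps at the level of partitions:
for distinct 0-balanced `k`-partitions `P`, `Q` of `G`, there are trees
`T, T' ∈ B^0_k(G)` inducing them that differ by a single BUD step iff,
after re-indexing, there is a cycle of `ℓ` parts (`2 ≤ ℓ ≤ k`) in the
quotient multigraph and nonempty subgraphs `H i ⊆ P i` with `H i` and
`P i \ H i` connected, such that `Q` is obtained by cyclically transferring
each `H i` from part `i` to part `i + 1`. -/
theorem stmt2 {V : Type*} [Fintype V] (G : SimpleGraph V) (hG : G.Connected)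
    (p : V → ℝ) (hp : ∀ v, 0 < p v) (k : ℕ) (hk : 2 ≤ k)
    (P Q : V → Fin k)
    (hP : IsBalancedPartition G p k P) (hQ : IsBalancedPartition G p k Q)
    (hne : Set.range (fun i : Fin k => P ⁻¹' {i}) ≠
      Set.range (fun i : Fin k => Q ⁻¹' {i})) :
    (∃ T T' : SimpleGraph V, MemB G p k 0 T ∧ MemB G p k 0 T' ∧
        InducesPartition T p k P ∧ InducesPartition T' p k Q ∧
        BUDStep G p k 0 T T')
    ↔
    (∃ l : ℕ, l + 2 ≤ k ∧ ∃ σ : Fin (l + 2) → Fin k, Function.Injective σ ∧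
      ∃ H : Fin (l + 2) → Set V,
        (∀ i, (H i).Nonempty) ∧
        (∀ i, H i ⊆ P ⁻¹' {σ i}) ∧
        (∀ i, (G.induce (H i)).Connected) ∧
        (∀ i, (G.induce (P ⁻¹' {σ i} \ H i)).Connected) ∧
        (∀ i, ∃ u ∈ P ⁻¹' {σ i}, ∃ x ∈ P ⁻¹' {σ (i + 1)}, G.Adj u x) ∧
        (∀ i : Fin (l + 2), ((P ⁻¹' {σ (i + 1)} \ H (i + 1)) ∪ H i) ∈
          Set.range (fun j : Fin k => Q ⁻¹' {j})) ∧
        (∀ j : Fin k, j ∉ Set.range σ →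
          P ⁻¹' {j} ∈ Set.range (fun j' : Fin k => Q ⁻¹' {j'}))) := by
  constructor
  · rintro ⟨T, T', h1, h2, h3, h4, h5⟩
    exact fwd G p hp k hk P Q hP hQ hne T T' h1 h3 h4 h5
  · rintro ⟨l, hl, σ, hσ, H, h1, h2, h3, h4, h5, h6, h7⟩
    exact bwd G hG p k hk P Q hP hQ l σ hσ H h1 h2 h3 h4 h6 h7
end

section
/- Let G be a finite connected graph with positive vertex weights, k ≥ 2 an integer, and let P and P̃ be two distinct 0-balanced k-partitions of G. The following are equivalent: (1) P and P̃ differ by a set of disjoint BUD steps on partitions, i.e., by simultaneously performing a collection of vertex-disjoint cyclic transfers, each as in the single-BUD-step characterization (a cycle P_{i_1} → ⋯ → P_{i_ℓ} → P_{i_1} in G/P together with connected subgraphs H_j ⊆ P_{i_j} with each P_{i_j} ∖ H_j connected, where each H_j is transferred from P_{i_j} to P_{i_{j+1}}); (2) there exists a choice of spanning tree on each part of P and on each part of P̃ such that the number of parts of P that are not parts of P̃ equals the number of edges lying in the union of the chosen trees of P but not in the union of the chosen trees of P̃. -/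
open SimpleGraph

/-- `t` is a spanning tree of the subgraph of `G` induced by `s`. -/
def IsSpanningTreeOn {V : Type*} (G : SimpleGraph V) (s : Set V)
    (t : SimpleGraph V) : Prop :=
  t ≤ G ∧ (∀ u v, t.Adj u v → u ∈ s ∧ v ∈ s) ∧ (t.induce s).IsTree

/-- Both pieces conditions: the pieces are connected and each part of `P` meets at most two
parts of `Q`. -/
def BudGood {V : Type*} (G : SimpleGraph V) (k : ℕ) (P Q : V → Fin k) : Prop :=
  (∀ i j, (P ⁻¹' {i} ∩ Q ⁻¹' {j}).Nonempty → (G.induce (P ⁻¹' {i} ∩ Q ⁻¹' {j})).Connected) ∧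
  (∀ u v w, P u = P v → P u = P w → Q u = Q v ∨ Q u = Q w ∨ Q v = Q w)

theorem bud_weight {V : Type*} [Fintype V] {G : SimpleGraph V} {p : V → ℝ} {k : ℕ}
    {P : V → Fin k} (hP : IsBalancedPartition G p k P) (i : Fin k) :
    ∑ v with P v = i, p v = (∑ v, p v) / k := by
  classical
  have := hP.2 i
  rw [← finsum_eq_sum_of_fintype p, ← this, finsum_mem_eq_toFinset_sum]
  apply Finset.sum_congr _ (fun _ _ => rfl)
  ext v; simp

theorem bud_sub {V : Type*} [Fintype V] {G : SimpleGraph V} {p : V → ℝ} (hp : ∀ v, 0 < p v)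
    {k : ℕ} {P Q : V → Fin k} (hP : IsBalancedPartition G p k P)
    (hQ : IsBalancedPartition G p k Q) (i j : Fin k) (h : ∀ v, P v = i → Q v = j) :
    P ⁻¹' {i} = Q ⁻¹' {j} := by
  classical
  ext v
  simp only [Set.mem_preimage, Set.mem_singleton_iff]
  refine ⟨h v, fun hv => ?_⟩
  by_contra hne
  have : ∑ v with P v = i, p v < ∑ v with Q v = j, p v := by
    apply Finset.sum_lt_sum_of_subset (i := v)
    · intro w; simpa using h w
    · simpa using hv
    · simpa using hne
    · exact hp v
    · intro w _ _; exact (hp w).le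
  rw [bud_weight hP, bud_weight hQ] at this
  exact lt_irrefl _ this

theorem bud_hall {V : Type*} [Fintype V] {G : SimpleGraph V} {p : V → ℝ} (hp : ∀ v, 0 < p v)
    {k : ℕ} {P Q : V → Fin k} (hP : IsBalancedPartition G p k P)
    (hQ : IsBalancedPartition G p k Q) :
    ∃ f : Fin k → Fin k, Function.Bijective f ∧ ∀ i, ∃ v, P v = i ∧ Q v = f i := by
  classical
  have key := (Finset.all_card_le_biUnion_card_iff_exists_injective
    (fun i : Fin k => Finset.univ.filter (fun j => ∃ v, P v = i ∧ Q v = j))).1 ?_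
  · obtain ⟨f, hf, h⟩ := key
    refine ⟨f, Finite.injective_iff_bijective.1 hf, fun i => by simpa using h i⟩
  intro S
  set N := S.biUnion (fun i : Fin k => Finset.univ.filter (fun j => ∃ v, P v = i ∧ Q v = j))
  have e : ∀ (R : V → Fin k) (hR : IsBalancedPartition G p k R) (T : Finset (Fin k)),
      ∑ v with R v ∈ T, p v = T.card * ((∑ v, p v) / k) := by
    intro R hR T
    rw [← Finset.sum_fiberwise_of_maps_to (t := T) (g := R) (by simp), ← nsmul_eq_mul,
      ← Finset.sum_const]
    apply Finset.sum_congr rfl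
    intro i hi
    rw [← bud_weight hR i, Finset.filter_filter]
    apply Finset.sum_congr _ (fun _ _ => rfl)
    ext v; simp only [Finset.mem_filter, Finset.mem_univ, true_and]
    exact ⟨fun h => h.2, fun h => ⟨h ▸ hi, h⟩⟩
  have hle : ∑ v with P v ∈ S, p v ≤ ∑ v with Q v ∈ N, p v := by
    apply Finset.sum_le_sum_of_subset_of_nonneg
    · intro v hv
      simp only [Finset.mem_filter, Finset.mem_univ, true_and, N, Finset.mem_biUnion] at hv ⊢
      exact ⟨P v, hv, v, rfl, rfl⟩
    · intro v _ _; exact (hp v).le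
  rw [e P hP, e Q hQ] at hle
  rcases S.eq_empty_or_nonempty with rfl | ⟨i, hi⟩
  · simp
  have hpos : 0 < (∑ v, p v) / k := by
    rw [← bud_weight hP i]
    obtain ⟨⟨v, hv⟩⟩ := (hP.1 i).nonempty
    exact Finset.sum_pos (fun v _ => hp v) ⟨v, by simpa using hv⟩
  exact_mod_cast le_of_mul_le_mul_right hle hpos

theorem bud_reach_induce {V : Type*} {G t : SimpleGraph V} (h : t ≤ G) {S : Set V}
    (hS : ∀ u v, t.Adj u v → u ∈ S → v ∈ S) {u v : V} (huv : t.Reachable u v) (hu : u ∈ S) :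
    ∃ hv : v ∈ S, (G.induce S).Reachable ⟨u, hu⟩ ⟨v, hv⟩ := by
  obtain ⟨w⟩ := huv
  induction w with
  | nil => exact ⟨hu, Reachable.refl _⟩
  | cons hadj _ ih =>
    obtain ⟨hv, hr⟩ := ih (hS _ _ hadj hu)
    refine ⟨hv, Reachable.trans (Adj.reachable ?_) hr⟩
    exact h hadj

theorem bud_conn {V : Type*} {G t : SimpleGraph V} (h : t ≤ G) {S : Set V}
    (hne : S.Nonempty)
    (hS : ∀ u v, t.Adj u v → u ∈ S → v ∈ S) (hr : ∀ u ∈ S, ∀ v ∈ S, t.Reachable u v) :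
    (G.induce S).Connected := by
  rw [connected_iff]
  refine ⟨?_, hne.to_subtype⟩
  rintro ⟨u, hu⟩ ⟨v, hv⟩
  exact (bud_reach_induce h hS (hr u hu v hv) hu).2

/-- From reachability in an induced graph to reachability in another graph. -/
theorem bud_reach_of_induce {V : Type*} {G t : SimpleGraph V} {S : Set V}
    (h : ∀ u v, G.Adj u v → u ∈ S → v ∈ S → t.Adj u v) {u v : S}
    (huv : (G.induce S).Reachable u v) : t.Reachable u.1 v.1 := by
  obtain ⟨w⟩ := huv
  induction w with
  | nil => exact Reachable.refl _
  | cons hadj _ ih => exact (h _ _ hadj (Subtype.prop _) (Subtype.prop _)).reachable.trans ih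

/-- A function changing along a connected set changes along an edge. -/
theorem bud_cross {V α : Type*} {G : SimpleGraph V} {S : Set V} (hS : (G.induce S).Connected)
    (f : V → α) {u v : V} (hu : u ∈ S) (hv : v ∈ S) (hne : f u ≠ f v) :
    ∃ a ∈ S, ∃ b ∈ S, G.Adj a b ∧ f a = f u ∧ f b ≠ f u := by
  by_contra hcon
  push Not at hcon
  apply hne
  have : ∀ x y : S, (G.induce S).Reachable x y → f x = f u → f y = f u := by
    rintro x y ⟨w⟩
    induction w with
    | nil => exact id
    | cons hadj _ ih => 
      intro hx
      exact ih (hcon _ (Subtype.prop _) _ (Subtype.prop _) hadj hx)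
  exact (this ⟨u, hu⟩ ⟨v, hv⟩ (hS.preconnected _ _) rfl).symm

theorem bud_tree_exists {V : Type*} {G : SimpleGraph V} {k : ℕ} {P : V → Fin k}
    {M : SimpleGraph V} (hne : ∀ i, ∃ v, P v = i) (hM : M ≤ G) (hMP : ∀ u v, M.Adj u v → P u = P v)
    (hac : M.IsAcyclic) (hr : ∀ u v, P u = P v → M.Reachable u v) :
    ∃ t : Fin k → SimpleGraph V, (∀ i, IsSpanningTreeOn G (P ⁻¹' {i}) (t i)) ∧
      (⋃ i, (t i).edgeSet) = M.edgeSet := by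
  let t : Fin k → SimpleGraph V := fun i =>
    { Adj := fun u v => M.Adj u v ∧ P u = i ∧ P v = i
      symm := ⟨fun u v h => ⟨h.1.symm, h.2.2, h.2.1⟩⟩
      loopless := ⟨fun u h => M.loopless.irrefl u h.1⟩ }
  have htM : ∀ i, t i ≤ M := fun i u v h => h.1
  refine ⟨t, fun i => ⟨(htM i).trans hM, fun u v h => h.2, ⟨?_, ?_⟩⟩, ?_⟩
  · obtain ⟨v, hv⟩ := hne i
    have : (t i).induce (P ⁻¹' {i}) = M.induce (P ⁻¹' {i}) := by
      ext ⟨u, hu⟩ ⟨v, hv⟩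
      simp only [comap_adj, Function.Embedding.subtype_apply]
      exact ⟨fun h => h.1, fun h => ⟨h, hu, hv⟩⟩
    rw [this]
    refine bud_conn le_rfl ⟨v, hv⟩ ?_ ?_
    · intro u v h hu; exact (hMP u v h).symm.trans hu
    · intro u hu v hv; exact hr u v (Eq.trans hu (Eq.symm hv))
  · exact (hac.anti (htM i)).induce _
  · ext e
    induction e with | _ u v
    simp only [Set.mem_iUnion, mem_edgeSet]
    exact ⟨fun ⟨i, h⟩ => h.1, fun h => ⟨P u, h, rfl, (hMP u v h).symm⟩⟩

/-- Lower bound: a changed part has a tree edge outside the trees of `Q`. -/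
theorem bud_edge {V : Type*} {G : SimpleGraph V} {k : ℕ} {P Q : V → Fin k}
    (hsub : ∀ i j, (∀ v, P v = i → Q v = j) → P ⁻¹' {i} = Q ⁻¹' {j})
    {tP tQ : Fin k → SimpleGraph V}
    (htP : ∀ i, IsSpanningTreeOn G (P ⁻¹' {i}) (tP i))
    (htQ : ∀ i, IsSpanningTreeOn G (Q ⁻¹' {i}) (tQ i)) (i : Fin k)
    (hi : P ⁻¹' {i} ∉ Set.range (fun j : Fin k => Q ⁻¹' {j})) :
    ∃ e ∈ (tP i).edgeSet, e ∉ ⋃ j, (tQ j).edgeSet := by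
  have hc := (htP i).2.2.connected
  obtain ⟨⟨x, hx⟩⟩ := hc.nonempty
  have : ∃ y, P y = i ∧ Q x ≠ Q y := by
    by_contra hcon
    push Not at hcon
    exact hi ⟨Q x, (hsub i (Q x) fun v hv => (hcon v hv).symm).symm⟩
  obtain ⟨y, hy, hxy⟩ := this
  obtain ⟨a, ha, b, hb, hab, h1, h2⟩ := bud_cross hc Q hx hy hxy
  refine ⟨s(a, b), hab, ?_⟩
  simp only [Set.mem_iUnion, mem_edgeSet, not_exists]
  intro j hj
  have := (htQ j).2.1 a b hj
  exact h2 ((Eq.trans this.2 (Eq.symm this.1)).trans h1)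

theorem bud_card {V : Type*} {k : ℕ} {P Q : V → Fin k} (hne : ∀ i, ∃ v, P v = i) :
    Nat.card ↥(Set.range (fun i : Fin k => P ⁻¹' {i}) \ Set.range (fun j : Fin k => Q ⁻¹' {j}))
      = Nat.card {i : Fin k // P ⁻¹' {i} ∉ Set.range (fun j : Fin k => Q ⁻¹' {j})} := by
  symm
  refine Nat.card_congr (Equiv.ofBijective (fun i => ⟨P ⁻¹' {i.1}, ⟨i.1, rfl⟩, i.2⟩) ⟨?_, ?_⟩)
  · rintro ⟨i, hi⟩ ⟨j, hj⟩ h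
    obtain ⟨v, hv⟩ := hne i
    have h' : P ⁻¹' {i} = P ⁻¹' {j} := congrArg Subtype.val h
    have : v ∈ P ⁻¹' {j} := h' ▸ hv
    exact Subtype.ext (hv.symm.trans this)
  · rintro ⟨_, ⟨i, rfl⟩, hi⟩
    exact ⟨⟨i, hi⟩, rfl⟩

theorem bud_perm {k : ℕ} (π : Equiv.Perm (Fin k)) :
    ∃ (m : ℕ) (L : Fin m → ℕ) (σ : (j : Fin m) → Fin (L j + 2) → Fin k),
      (∀ j, Function.Injective (σ j)) ∧
      (∀ (j j' : Fin m) (i : Fin (L j + 2)) (i' : Fin (L j' + 2)),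
        σ j i = σ j' i' → j = j') ∧
      (∀ j i, σ j (i + 1) = π (σ j i)) ∧
      (∀ t, π t ≠ t → ∃ j i, σ j i = t) := by
  classical
  let e := π.cycleFactorsFinset.equivFin.symm
  have hc : ∀ j, (e j).1.IsCycle := fun j => (Equiv.Perm.mem_cycleFactorsFinset_iff.1 (e j).2).1
  have hx : ∀ j, ∃ x, (e j).1 x ≠ x := fun j => (hc j).imp fun x h => h.1
  choose x hx using hx
  have hL : ∀ j, orderOf (e j).1 = ((e j).1.support.card - 2) + 2 := by
    intro j
    rw [(hc j).orderOf, Nat.sub_add_cancel (hc j).two_le_card_support]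
  have hs : ∀ j (n : ℕ), ((e j).1 ^ n) (x j) ∈ (e j).1.support := by
    intro j n
    rw [Equiv.Perm.pow_apply_mem_support, Equiv.Perm.mem_support]; exact hx j
  refine ⟨_, fun j => (e j).1.support.card - 2, fun j i => ((e j).1 ^ (i : ℕ)) (x j),
    ?_, ?_, ?_, ?_⟩
  · intro j a b hab
    have := (hc j).pow_eq_pow_iff.2 ⟨x j, hx j, hab⟩
    have := pow_injOn_Iio_orderOf (x := (e j).1) (by simp [hL]) (by simp [hL]) this
    exact Fin.ext this
  · intro j j' i i' h
    by_contra hne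
    have hd := π.cycleFactorsFinset_pairwise_disjoint (e j).2 (e j').2
      (fun h => hne (e.injective (Subtype.ext h)))
    rw [Equiv.Perm.disjoint_iff_disjoint_support, Finset.disjoint_left] at hd
    apply hd (hs j i)
    have := hs j' i'
    simp only at h
    rwa [h]
  · intro j i
    have : ((i + 1 : Fin _) : ℕ) = (i.val + 1) % orderOf (e j).1 := by
      rw [hL, Fin.val_add]; simp
    simp only [this, pow_mod_orderOf]
    rw [pow_succ', Equiv.Perm.mul_apply]
    exact (Equiv.Perm.mem_cycleFactorsFinset_iff.1 (e j).2).2 _ (hs j i)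
  · intro t ht
    have hmem : π.cycleOf t ∈ π.cycleFactorsFinset := by
      rw [Equiv.Perm.cycleOf_mem_cycleFactorsFinset_iff, Equiv.Perm.mem_support]; exact ht
    obtain ⟨j, hj⟩ := e.surjective ⟨_, hmem⟩
    have hj' : (e j).1 = π.cycleOf t := by rw [hj]
    obtain ⟨n, hn⟩ := (hc j).exists_pow_eq (hx j) (y := t) (by
      rw [hj', Equiv.Perm.cycleOf_apply_self]; exact ht)
    refine ⟨j, ⟨n % orderOf (e j).1, ?_⟩, ?_⟩
    · rw [← hL]; exact Nat.mod_lt _ (by rw [hL]; omega)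
    · simp only [pow_mod_orderOf]; exact hn

theorem bud_reach_two {V : Type*} {t t' : SimpleGraph V} {a b : V}
    (h : ∀ u v, t.Adj u v → s(u, v) ≠ s(a, b) → t'.Adj u v) {v : V} (hv : t.Reachable v a) :
    t'.Reachable v a ∨ t'.Reachable v b := by
  obtain ⟨w⟩ := hv
  induction w with
  | nil => exact Or.inl (Reachable.refl _)
  | @cons x y z hadj _ ih =>
    by_cases hxy : s(x, y) = s(z, b)
    · rw [Sym2.eq_iff] at hxy
      rcases hxy with ⟨rfl, _⟩ | ⟨rfl, _⟩
      · exact Or.inl (Reachable.refl _)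
      · exact Or.inr (Reachable.refl _)
    · have := (h _ _ hadj hxy).reachable
      exact (ih h).imp this.trans this.trans

/-- (2) implies the pieces condition. -/
theorem bud_two_good {V : Type*} [Finite V] {G : SimpleGraph V} {k : ℕ} {P Q : V → Fin k}
    (hPc : ∀ i, (G.induce (P ⁻¹' {i})).Connected)
    (hsub : ∀ i j, (∀ v, P v = i → Q v = j) → P ⁻¹' {i} = Q ⁻¹' {j})
    {tP tQ : Fin k → SimpleGraph V}
    (htP : ∀ i, IsSpanningTreeOn G (P ⁻¹' {i}) (tP i))
    (htQ : ∀ i, IsSpanningTreeOn G (Q ⁻¹' {i}) (tQ i))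
    (hcard : Nat.card {i : Fin k // P ⁻¹' {i} ∉ Set.range (fun j : Fin k => Q ⁻¹' {j})} =
      Nat.card ↥((⋃ i, (tP i).edgeSet) \ ⋃ i, (tQ i).edgeSet)) :
    BudGood G k P Q := by
  classical
  have hdisj : ∀ i j e, e ∈ (tP i).edgeSet → e ∈ (tP j).edgeSet → i = j := by
    intro i j e
    induction e with | _ u v
    intro h1 h2
    exact Eq.trans (Eq.symm ((htP i).2.1 u v h1).1) ((htP j).2.1 u v h2).1
  -- at most one edge per part
  have huniq : ∀ i e e', e ∈ (tP i).edgeSet → e' ∈ (tP i).edgeSet →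
      e ∉ ⋃ j, (tQ j).edgeSet → e' ∉ ⋃ j, (tQ j).edgeSet → e = e' := by
    have hex := fun i : {i : Fin k // P ⁻¹' {i} ∉ Set.range (fun j : Fin k => Q ⁻¹' {j})} =>
      bud_edge hsub htP htQ i.1 i.2
    choose c hc1 hc2 using hex
    let F : {i : Fin k // P ⁻¹' {i} ∉ Set.range (fun j : Fin k => Q ⁻¹' {j})} →
      ↥((⋃ i, (tP i).edgeSet) \ ⋃ i, (tQ i).edgeSet) :=
      fun i => ⟨c i, Set.mem_iUnion.2 ⟨i.1, hc1 i⟩, hc2 i⟩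
    have hF : Function.Injective F := by
      intro i j hij
      have : c i = c j := congrArg Subtype.val hij
      exact Subtype.ext (hdisj _ _ _ (hc1 i) (this ▸ hc1 j))
    have hFb : Function.Bijective F := by
      exact (Nat.bijective_iff_injective_and_card F).2 ⟨hF, hcard⟩
    have hsur : ∀ i e, e ∈ (tP i).edgeSet → e ∉ ⋃ j, (tQ j).edgeSet →
        ∃ h, e = c ⟨i, h⟩ := by
      intro i e h1 h2
      obtain ⟨⟨j, hj⟩, hj'⟩ := hFb.2 ⟨e, Set.mem_iUnion.2 ⟨i, h1⟩, h2⟩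
      have hj2 : c ⟨j, hj⟩ = e := congrArg Subtype.val hj'
      have : i = j := hdisj i j e h1 (hj2 ▸ hc1 ⟨j, hj⟩)
      subst this
      exact ⟨hj, hj2.symm⟩
    intro i e e' h1 h2 h3 h4
    obtain ⟨h, rfl⟩ := hsur i e h1 h3
    obtain ⟨h', rfl⟩ := hsur i e' h2 h4
    rfl
  -- structure of a part
  have hQadj : ∀ u v, s(u, v) ∈ (⋃ j, (tQ j).edgeSet) → Q u = Q v := by
    intro u v h
    obtain ⟨j, hj⟩ := Set.mem_iUnion.1 h
    have := (htQ j).2.1 u v hj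
    exact Eq.trans this.1 (Eq.symm this.2)
  have hreachP : ∀ i u v, P u = i → P v = i → (tP i).Reachable u v := by
    intro i u v hu hv
    exact bud_reach_of_induce (S := P ⁻¹' {i}) (fun _ _ h _ _ => h)
      ((htP i).2.2.connected.preconnected ⟨u, hu⟩ ⟨v, hv⟩)
  have hstruct : ∀ i, (∃ j, ∀ v, P v = i → Q v = j) ∨
      ∃ (t : SimpleGraph V) (a b : V), t ≤ G ∧ (∀ u v, t.Adj u v → P u = i ∧ P v = i ∧ Q u = Q v) ∧
        P a = i ∧ P b = i ∧ Q a ≠ Q b ∧ ∀ v, P v = i → t.Reachable v a ∨ t.Reachable v b := by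
    intro i
    by_cases hi : ∃ j, ∀ v, P v = i → Q v = j
    · exact Or.inl hi
    right
    obtain ⟨e, he1, he2⟩ := bud_edge hsub htP htQ i (by
      rintro ⟨j, hj⟩
      exact hi ⟨j, fun v hv => by
        have : v ∈ P ⁻¹' {i} := hv
        rw [← hj] at this; exact this⟩)
    induction e with | _ a b
    let t : SimpleGraph V := (tP i).deleteEdges {s(a, b)}
    have htle : t ≤ tP i := deleteEdges_le _
    have htQ' : ∀ u v, t.Adj u v → Q u = Q v := by
      intro u v h
      apply hQadj
      by_contra hcon
      rw [deleteEdges_adj] at h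
      exact h.2 (huniq i _ _ h.1 he1 hcon he2)
    have hrr : ∀ v, P v = i → t.Reachable v a ∨ t.Reachable v b := by
      intro v hv
      apply bud_reach_two (t := tP i)
      · intro u v h1 h2
        rw [deleteEdges_adj]
        exact ⟨h1, h2⟩
      · exact hreachP i v a hv ((htP i).2.1 a b he1).1
    have hQr : ∀ u v, t.Reachable u v → Q u = Q v := by
      rintro u v ⟨w⟩
      induction w with
      | nil => rfl
      | cons h _ ih => exact (htQ' _ _ h).trans ih
    refine ⟨t, a, b, htle.trans (htP i).1, fun u v h => ⟨((htP i).2.1 u v (htle h)).1,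
      ((htP i).2.1 u v (htle h)).2, htQ' u v h⟩, ((htP i).2.1 a b he1).1,
      ((htP i).2.1 a b he1).2, ?_, hrr⟩
    intro hab
    apply hi
    refine ⟨Q a, fun v hv => ?_⟩
    rcases hrr v hv with h | h
    · exact hQr _ _ h
    · exact (hQr _ _ h).trans hab.symm
  have hQr : ∀ t : SimpleGraph V, (∀ u v, t.Adj u v → Q u = Q v) →
      ∀ u v, t.Reachable u v → Q u = Q v := by
    rintro t ht u v ⟨w⟩
    induction w with
    | nil => rfl
    | cons h _ ih => exact (ht _ _ h).trans ih
  constructor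
  · intro i j hne
    rcases hstruct i with ⟨j', hj'⟩ | ⟨t, a, b, htG, htPQ, ha, hb, hab, hr⟩
    · obtain ⟨v, hv1, hv2⟩ := hne
      have : j = j' := Eq.trans (Eq.symm hv2) (hj' v hv1)
      subst this
      have : P ⁻¹' {i} ∩ Q ⁻¹' {j} = P ⁻¹' {i} :=
        Set.inter_eq_left.2 (fun v hv => hj' v hv)
      rw [this]; exact hPc i
    · have hq := hQr t (fun u v h => (htPQ u v h).2.2)
      apply bud_conn htG hne
      · intro u v h hu
        exact ⟨(htPQ u v h).2.1, (htPQ u v h).2.2.symm.trans hu.2⟩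
      · rintro u ⟨hu1, hu2⟩ v ⟨hv1, hv2⟩
        have huv : Q u = Q v := Eq.trans hu2 (Eq.symm hv2)
        rcases hr u hu1 with h1 | h1 <;> rcases hr v hv1 with h2 | h2
        · exact h1.trans h2.symm
        · exact absurd ((hq _ _ h1).symm.trans (huv.trans (hq _ _ h2))) hab
        · exact absurd ((hq _ _ h2).symm.trans (huv.symm.trans (hq _ _ h1))) hab
        · exact h1.trans h2.symm
  · intro u v w huv huw
    rcases hstruct (P u) with ⟨j', hj'⟩ | ⟨t, a, b, htG, htPQ, ha, hb, hab, hr⟩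
    · left; rw [hj' u rfl, hj' v huv.symm]
    · have hq := hQr t (fun u v h => (htPQ u v h).2.2)
      have h1 := (hr u rfl).imp (hq _ _) (hq _ _)
      have h2 := (hr v huv.symm).imp (hq _ _) (hq _ _)
      have h3 := (hr w huw.symm).imp (hq _ _) (hq _ _)
      grind

/-- The pieces condition implies (2). -/
theorem bud_good_two {V : Type*} [Finite V] {G : SimpleGraph V} {k : ℕ} {P Q : V → Fin k}
    (hPc : ∀ i, (G.induce (P ⁻¹' {i})).Connected)
    (hQc : ∀ i, (G.induce (Q ⁻¹' {i})).Connected)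
    (hsub : ∀ i j, (∀ v, P v = i → Q v = j) → P ⁻¹' {i} = Q ⁻¹' {j})
    (hgood : BudGood G k P Q) :
    ∃ tP tQ : Fin k → SimpleGraph V,
      (∀ i, IsSpanningTreeOn G (P ⁻¹' {i}) (tP i)) ∧
      (∀ i, IsSpanningTreeOn G (Q ⁻¹' {i}) (tQ i)) ∧
      Nat.card {i : Fin k // P ⁻¹' {i} ∉ Set.range (fun j : Fin k => Q ⁻¹' {j})} =
        Nat.card ↥((⋃ i, (tP i).edgeSet) \ ⋃ i, (tQ i).edgeSet) := by
  classical
  have hneP : ∀ i, ∃ v, P v = i := fun i => by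
    obtain ⟨⟨v, hv⟩⟩ := (hPc i).nonempty; exact ⟨v, hv⟩
  have hneQ : ∀ i, ∃ v, Q v = i := fun i => by
    obtain ⟨⟨v, hv⟩⟩ := (hQc i).nonempty; exact ⟨v, hv⟩
  let G' : SimpleGraph V :=
    { Adj := fun u v => G.Adj u v ∧ P u = P v ∧ Q u = Q v
      symm := ⟨fun u v h => ⟨h.1.symm, h.2.1.symm, h.2.2.symm⟩⟩
      loopless := ⟨fun u h => G.loopless.irrefl u h.1⟩ }
  let GQ : SimpleGraph V :=
    { Adj := fun u v => G.Adj u v ∧ Q u = Q v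
      symm := ⟨fun u v h => ⟨h.1.symm, h.2.symm⟩⟩
      loopless := ⟨fun u h => G.loopless.irrefl u h.1⟩ }
  have hG'r : ∀ u v, P u = P v → Q u = Q v → G'.Reachable u v := by
    intro u v h1 h2
    have := hgood.1 (P u) (Q u) ⟨u, rfl, rfl⟩
    exact bud_reach_of_induce (t := G') (S := P ⁻¹' {P u} ∩ Q ⁻¹' {Q u})
      (fun a b h ha hb => ⟨h, Eq.trans ha.1 (Eq.symm hb.1), Eq.trans ha.2 (Eq.symm hb.2)⟩)
      (this.preconnected ⟨u, rfl, rfl⟩ ⟨v, h1.symm, h2.symm⟩)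
  have hGQr : ∀ u v, Q u = Q v → GQ.Reachable u v := by
    intro u v h2
    exact bud_reach_of_induce (t := GQ) (S := Q ⁻¹' {Q u})
      (fun a b h ha hb => ⟨h, Eq.trans ha (Eq.symm hb)⟩)
      ((hQc (Q u)).preconnected ⟨u, rfl⟩ ⟨v, h2.symm⟩)
  obtain ⟨F, hFG, hFac, hFr⟩ := G'.exists_isAcyclic_reachable_eq_le
  have hFGQ : F ≤ GQ := fun u v h => ⟨(hFG h).1, (hFG h).2.2⟩
  obtain ⟨MQ, hFM, hMG, hMac, hMr⟩ :=
    GQ.exists_isAcyclic_reachable_eq_le_of_le_of_isAcyclic hFGQ hFac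
  obtain ⟨tQ, htQ, hUQ⟩ := bud_tree_exists (G := G) (P := Q) (M := MQ) hneQ
    (fun u v h => (hMG h).1) (fun u v h => (hMG h).2) hMac
    (fun u v h => by rw [hMr]; exact hGQr u v h)
  -- crossing edges
  have hcr : ∀ i : {i : Fin k // P ⁻¹' {i} ∉ Set.range (fun j : Fin k => Q ⁻¹' {j})},
      ∃ a b, G.Adj a b ∧ P a = i.1 ∧ P b = i.1 ∧ Q a ≠ Q b := by
    rintro ⟨i, hi⟩
    obtain ⟨x, hx⟩ := hneP i
    have : ∃ y, P y = i ∧ Q x ≠ Q y := by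
      by_contra hcon
      push Not at hcon
      exact hi ⟨Q x, (hsub i (Q x) fun v hv => (hcon v hv).symm).symm⟩
    obtain ⟨y, hy, hxy⟩ := this
    obtain ⟨a, ha, b, hb, hab, h1, h2⟩ := bud_cross (hPc i) Q hx hy hxy
    exact ⟨a, b, hab, ha, hb, fun h => h2 (h.symm.trans h1)⟩
  choose ca cb hc1 hc2 hc3 hc4 using hcr
  let X : Set (Sym2 V) := Set.range (fun i => s(ca i, cb i))
  let K : SimpleGraph V := F ⊔ fromEdgeSet X
  have hKadj : ∀ u v, K.Adj u v → F.Adj u v ∨ s(u, v) ∈ X := by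
    intro u v h
    rcases h with h | h
    · exact Or.inl h
    · exact Or.inr ((fromEdgeSet_adj _).1 h).1
  have hXG : ∀ u v, s(u, v) ∈ X → G.Adj u v ∧ P u = P v := by
    rintro u v ⟨i, hi⟩
    rcases Sym2.eq_iff.1 hi with ⟨rfl, rfl⟩ | ⟨rfl, rfl⟩
    · exact ⟨hc1 i, (hc2 i).trans (hc3 i).symm⟩
    · exact ⟨(hc1 i).symm, (hc3 i).trans (hc2 i).symm⟩
  have hKr0 : ∀ u v, P u = P v → Q u = Q v → K.Reachable u v := by
    intro u v h1 h2
    have : F.Reachable u v := by rw [hFr]; exact hG'r u v h1 h2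
    exact this.mono le_sup_left
  have hKr : ∀ u v, P u = P v → K.Reachable u v := by
    intro u v h
    by_cases hq : Q u = Q v
    · exact hKr0 u v h hq
    have hi : P ⁻¹' {P u} ∉ Set.range (fun j : Fin k => Q ⁻¹' {j}) := by
      rintro ⟨j, hj⟩
      have h1 : u ∈ P ⁻¹' {P u} := rfl
      have h2 : v ∈ P ⁻¹' {P u} := h.symm
      rw [← hj] at h1 h2
      exact hq (Eq.trans h1 (Eq.symm h2))
    let i : {i : Fin k // P ⁻¹' {i} ∉ Set.range (fun j : Fin k => Q ⁻¹' {j})} := ⟨P u, hi⟩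
    have hadj : K.Reachable (ca i) (cb i) := by
      apply Adj.reachable
      right
      rw [fromEdgeSet_adj]
      exact ⟨⟨i, rfl⟩, (hc1 i).ne⟩
    have e1 : P (ca i) = P u := hc2 i
    have e2 : P (cb i) = P u := hc3 i
    have g1 := hgood.2 (ca i) (cb i) u (e1.trans e2.symm) e1
    have g2 := hgood.2 (ca i) (cb i) v (e1.trans e2.symm) (e1.trans h)
    have hne := hc4 i
    rcases g1 with g1 | g1 | g1
    · exact absurd g1 hne
    · have hv : Q (cb i) = Q v := by
        rcases g2 with g2 | g2 | g2
        · exact absurd g2 hne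
        · exact absurd (g1.symm.trans g2) hq
        · exact g2
      exact (hKr0 u (ca i) e1.symm g1.symm).trans (hadj.trans (hKr0 _ v (e2.trans h) hv))
    · have hv : Q (ca i) = Q v := by
        rcases g2 with g2 | g2 | g2
        · exact absurd g2 hne
        · exact g2
        · exact absurd (g1.symm.trans g2) hq
      exact (hKr0 u (cb i) e2.symm g1.symm).trans (hadj.symm.trans (hKr0 _ v (e1.trans h) hv))
  obtain ⟨MP, hMPK, hMPac, hMPr⟩ := K.exists_isAcyclic_reachable_eq_le
  obtain ⟨tP, htP, hUP⟩ := bud_tree_exists (G := G) (P := P) (M := MP) hneP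
    (fun u v h => (hKadj u v (hMPK h)).elim (fun h => (hFG h).1) (fun h => (hXG u v h).1))
    (fun u v h => (hKadj u v (hMPK h)).elim (fun h => (hFG h).2.1) (fun h => (hXG u v h).2)) hMPac
    (fun u v h => by rw [hMPr]; exact hKr u v h)
  refine ⟨tP, tQ, htP, htQ, le_antisymm ?_ ?_⟩
  · have hex := fun i : {i : Fin k // P ⁻¹' {i} ∉ Set.range (fun j : Fin k => Q ⁻¹' {j})} =>
      bud_edge hsub htP htQ i.1 i.2
    choose c h1 h2 using hex
    apply Nat.card_le_card_of_injective (fun i => (⟨c i, Set.mem_iUnion.2 ⟨i.1, h1 i⟩, h2 i⟩ :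
      ↥((⋃ i, (tP i).edgeSet) \ ⋃ i, (tQ i).edgeSet)))
    intro i j hij
    have hij' : c i = c j := congrArg Subtype.val hij
    have h3 := h1 i
    have h4 := h1 j
    rw [← hij'] at h4
    apply Subtype.ext
    generalize c i = e at h3 h4
    induction e with | _ u v
    exact Eq.trans (Eq.symm ((htP i.1).2.1 u v h3).1) ((htP j.1).2.1 u v h4).1
  · have hsubset : ((⋃ i, (tP i).edgeSet) \ ⋃ i, (tQ i).edgeSet) ⊆ X := by
      rw [hUP, hUQ]
      rintro e ⟨h1, h2⟩
      induction e with | _ u v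
      rcases hKadj u v (hMPK h1) with h | h
      · exact absurd (hFM h) h2
      · exact h
    calc _ ≤ Nat.card X := Nat.card_mono (Set.toFinite _) hsubset
      _ ≤ _ := Finite.card_range_le _

theorem bud_fin_ne {n : ℕ} (i : Fin (n + 2)) : i + 1 ≠ i := by
  intro h
  have : (1 : Fin (n + 2)) = 0 := by simpa using h
  exact absurd this (by simp)

/-- (1) implies the pieces condition. -/
theorem bud_one_good {V : Type*} {G : SimpleGraph V} {k : ℕ} {P Q : V → Fin k}
    (hPc : ∀ i, (G.induce (P ⁻¹' {i})).Connected)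
    {m : ℕ} {L : Fin m → ℕ} {σ : (j : Fin m) → Fin (L j + 2) → Fin k}
    (hinj : ∀ j, Function.Injective (σ j))
    {H : (j : Fin m) → Fin (L j + 2) → Set V}
    (hHP : ∀ j i, H j i ⊆ P ⁻¹' {σ j i})
    (hHc : ∀ j i, (G.induce (H j i)).Connected)
    (hHc' : ∀ j i, (G.induce (P ⁻¹' {σ j i} \ H j i)).Connected)
    (hQ : ∀ j i, ((P ⁻¹' {σ j (i + 1)} \ H j (i + 1)) ∪ H j i) ∈
          Set.range (fun t : Fin k => Q ⁻¹' {t}))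
    (hrest : ∀ t : Fin k, (∀ j i, σ j i ≠ t) →
          P ⁻¹' {t} ∈ Set.range (fun t' : Fin k => Q ⁻¹' {t'})) :
    BudGood G k P Q := by
  have claim : ∀ t, ∃ a b : Fin k, (∀ v, P v = t → Q v = a ∨ Q v = b) ∧
      (G.induce (P ⁻¹' {t} ∩ Q ⁻¹' {a})).Connected ∧
      (G.induce (P ⁻¹' {t} ∩ Q ⁻¹' {b})).Connected := by
    intro t
    by_cases ht : ∀ j i, σ j i ≠ t
    · obtain ⟨a, ha⟩ := hrest t ht
      simp only at ha
      have : (G.induce (P ⁻¹' {t} ∩ Q ⁻¹' {a})).Connected := by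
        rw [ha, Set.inter_self]; exact hPc t
      refine ⟨a, a, fun v hv => Or.inl ?_, this, this⟩
      have : v ∈ P ⁻¹' {t} := hv
      rw [← ha] at this; exact this
    push Not at ht
    obtain ⟨j, i, rfl⟩ := ht
    obtain ⟨i', rfl⟩ : ∃ i', i' + 1 = i := ⟨i - 1, by simp⟩
    obtain ⟨a, ha⟩ := hQ j (i' + 1)
    obtain ⟨b, hb⟩ := hQ j i'
    simp only at ha hb
    have n1 : σ j (i' + 1 + 1) ≠ σ j (i' + 1) := fun h => bud_fin_ne _ (hinj j h)
    have n2 : σ j (i' + 1) ≠ σ j i' := fun h => bud_fin_ne _ (hinj j h)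
    have ea : P ⁻¹' {σ j (i' + 1)} ∩ Q ⁻¹' {a} = H j (i' + 1) := by
      rw [ha]
      ext v
      have := @hHP j (i' + 1) v
      simp only [Set.mem_preimage, Set.mem_singleton_iff] at this
      simp only [Set.mem_inter_iff, Set.mem_preimage, Set.mem_singleton_iff, Set.mem_union,
        Set.mem_sdiff]
      constructor
      · rintro ⟨h1, ⟨h2, h3⟩ | h2⟩
        · exact absurd (h2.symm.trans h1) n1
        · exact h2
      · intro h; exact ⟨this h, Or.inr h⟩
    have eb : P ⁻¹' {σ j (i' + 1)} ∩ Q ⁻¹' {b} = P ⁻¹' {σ j (i' + 1)} \ H j (i' + 1) := by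
      rw [hb]
      ext v
      have := @hHP j i' v
      simp only [Set.mem_preimage, Set.mem_singleton_iff] at this
      simp only [Set.mem_inter_iff, Set.mem_preimage, Set.mem_singleton_iff, Set.mem_union,
        Set.mem_sdiff]
      constructor
      · rintro ⟨h1, h2 | h2⟩
        · exact h2
        · exact absurd (h1.symm.trans (this h2)) n2
      · intro h; exact ⟨h.1, Or.inl h⟩
    refine ⟨a, b, fun v hv => ?_, by rw [ea]; exact hHc _ _, by rw [eb]; exact hHc' _ _⟩
    by_cases hv' : v ∈ H j (i' + 1)
    · rw [← ea] at hv'; exact Or.inl hv'.2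
    · have : v ∈ P ⁻¹' {σ j (i' + 1)} \ H j (i' + 1) := ⟨hv, hv'⟩
      rw [← eb] at this; exact Or.inr this.2
  constructor
  · rintro i j ⟨v, hv1, hv2⟩
    obtain ⟨a, b, h, ha, hb⟩ := claim i
    rcases h v hv1 with h | h
    · have : j = a := Eq.trans (Eq.symm hv2) h
      rw [this]; exact ha
    · have : j = b := Eq.trans (Eq.symm hv2) h
      rw [this]; exact hb
  · intro u v w huv huw
    obtain ⟨a, b, h, -, -⟩ := claim (P u)
    have h1 := h u rfl
    have h2 := h v huv.symm
    have h3 := h w huw.symm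
    grind

/-- The pieces condition implies (1). -/
theorem bud_good_one {V : Type*} {G : SimpleGraph V} {k : ℕ} {P Q : V → Fin k}
    (hQc : ∀ i, (G.induce (Q ⁻¹' {i})).Connected)
    (hsub : ∀ i j, (∀ v, P v = i → Q v = j) → P ⁻¹' {i} = Q ⁻¹' {j})
    (hsub' : ∀ i j, (∀ v, Q v = i → P v = j) → Q ⁻¹' {i} = P ⁻¹' {j})
    (hall : ∃ f : Fin k → Fin k, Function.Bijective f ∧ ∀ i, ∃ v, P v = i ∧ Q v = f i)
    (hgood : BudGood G k P Q) :
    (∃ (m : ℕ) (L : Fin m → ℕ) (σ : (j : Fin m) → Fin (L j + 2) → Fin k),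
      (∀ j, L j + 2 ≤ k) ∧
      (∀ j, Function.Injective (σ j)) ∧
      (∀ (j j' : Fin m) (i : Fin (L j + 2)) (i' : Fin (L j' + 2)),
        σ j i = σ j' i' → j = j') ∧
      ∃ H : (j : Fin m) → Fin (L j + 2) → Set V,
        (∀ j i, (H j i).Nonempty) ∧
        (∀ j i, H j i ⊆ P ⁻¹' {σ j i}) ∧
        (∀ j i, (G.induce (H j i)).Connected) ∧
        (∀ j i, (G.induce (P ⁻¹' {σ j i} \ H j i)).Connected) ∧
        (∀ j i, ∃ u ∈ P ⁻¹' {σ j i}, ∃ x ∈ P ⁻¹' {σ j (i + 1)}, G.Adj u x) ∧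
        (∀ j i, ((P ⁻¹' {σ j (i + 1)} \ H j (i + 1)) ∪ H j i) ∈
          Set.range (fun t : Fin k => Q ⁻¹' {t})) ∧
        (∀ t : Fin k, (∀ j i, σ j i ≠ t) →
          P ⁻¹' {t} ∈ Set.range (fun t' : Fin k => Q ⁻¹' {t'}))) := by
  classical
  obtain ⟨f, hf, hfv⟩ := hall
  have hg : ∀ i, ∃ j, (∃ v, P v = i ∧ Q v = j) ∧ ∀ v, P v = i → Q v = f i ∨ Q v = j := by
    intro i
    obtain ⟨v0, h1, h2⟩ := hfv i
    by_cases h : ∃ v, P v = i ∧ Q v ≠ f i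
    · obtain ⟨v, hv1, hv2⟩ := h
      refine ⟨Q v, ⟨v, hv1, rfl⟩, fun w hw => ?_⟩
      have := hgood.2 w v0 v (hw.trans h1.symm) (hw.trans hv1.symm)
      grind
    · push Not at h
      exact ⟨f i, ⟨v0, h1, h2⟩, fun v hv => Or.inl (h v hv)⟩
  choose g n1 n2 using hg
  have gsur : Function.Surjective g := by
    intro j
    obtain ⟨i0, rfl⟩ := hf.2 j
    by_cases h : ∃ v, Q v = f i0 ∧ P v ≠ i0
    · obtain ⟨v, h1, h2⟩ := h
      rcases n2 (P v) v rfl with h | h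
      · exact absurd (hf.1 (h.symm.trans h1)) h2
      · exact ⟨P v, h.symm.trans h1⟩
    · push Not at h
      have e := hsub' (f i0) i0 h
      obtain ⟨v, hv1, hv2⟩ := n1 i0
      have : v ∈ P ⁻¹' {i0} := hv1
      rw [← e] at this
      exact ⟨i0, hv2.symm.trans this⟩
  have gbij : Function.Bijective g := Finite.surjective_iff_bijective.1 gsur
  let π : Equiv.Perm (Fin k) := (Equiv.ofBijective g gbij).trans (Equiv.ofBijective f hf).symm
  have hπ : ∀ i, f (π i) = g i := by
    intro i
    exact Equiv.apply_symm_apply (Equiv.ofBijective f hf) (g i)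
  obtain ⟨m, L, σ, s1, s2, s3, s4⟩ := bud_perm π
  have hπne : ∀ j i, π (σ j i) ≠ σ j i := by
    intro j i h
    rw [← s3] at h
    exact bud_fin_ne _ (s1 j h)
  have hfg : ∀ j i, g (σ j i) ≠ f (σ j i) := by
    intro j i h
    rw [← hπ] at h
    exact hπne j i (hf.1 h)
  have hdiff : ∀ j i, P ⁻¹' {σ j i} \ (P ⁻¹' {σ j i} ∩ Q ⁻¹' {g (σ j i)}) =
      P ⁻¹' {σ j i} ∩ Q ⁻¹' {f (σ j i)} := by
    intro j i
    ext v
    have h1 := n2 (σ j i) v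
    have h2 := hfg j i
    simp only [Set.mem_inter_iff, Set.mem_preimage, Set.mem_singleton_iff, Set.mem_sdiff]
    grind
  refine ⟨m, L, σ, fun j => ?_, s1, s2, fun j i => P ⁻¹' {σ j i} ∩ Q ⁻¹' {g (σ j i)},
    ?_, ?_, ?_, ?_, ?_, ?_, ?_⟩
  · simpa using Fintype.card_le_of_injective _ (s1 j)
  · intro j i
    obtain ⟨v, h1, h2⟩ := n1 (σ j i)
    exact ⟨v, h1, h2⟩
  · intro j i; exact Set.inter_subset_left
  · intro j i
    obtain ⟨v, h1, h2⟩ := n1 (σ j i)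
    exact hgood.1 _ _ ⟨v, h1, h2⟩
  · intro j i
    beta_reduce
    rw [hdiff]
    obtain ⟨v, h1, h2⟩ := hfv (σ j i)
    exact hgood.1 _ _ ⟨v, h1, h2⟩
  · intro j i
    obtain ⟨u, hu1, hu2⟩ := n1 (σ j i)
    obtain ⟨x, hx1, hx2⟩ := hfv (π (σ j i))
    rw [hπ] at hx2
    obtain ⟨a, ha, b, hb, hab, e1, e2⟩ := bud_cross (hQc (g (σ j i))) P hu2 hx2
      (by rw [hu1, hx1]; exact (hπne j i).symm)
    refine ⟨a, e1.trans hu1, b, ?_, hab⟩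
    rw [s3]
    have hb' : Q b = g (σ j i) := hb
    rcases n2 (P b) b rfl with h | h
    · apply hf.1
      rw [hπ, ← h, hb']
    · exact absurd ((gbij.1 (h.symm.trans hb')).trans hu1.symm) e2
  · intro j i
    refine ⟨g (σ j i), ?_⟩
    simp only [hdiff]
    rw [s3, hπ]
    ext v
    simp only [Set.mem_inter_iff, Set.mem_preimage, Set.mem_singleton_iff, Set.mem_union]
    constructor
    · intro hv
      rcases n2 (P v) v rfl with h | h
      · left
        exact ⟨hf.1 (by rw [hπ, ← h, hv]), hv⟩
      · right
        exact ⟨gbij.1 (h.symm.trans hv), hv⟩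
    · rintro (h | h) <;> exact h.2
  · intro t ht
    have : π t = t := by
      by_contra h
      obtain ⟨j, i, h⟩ := s4 t h
      exact ht j i h
    have hgf : g t = f t := by rw [← hπ, this]
    refine ⟨f t, (hsub t (f t) fun v hv => ?_).symm⟩
    have := n2 t v hv
    rw [hgf] at this
    exact this.elim id id

/-- `P` and `Q` differ by a set of disjoint BUD steps on partitions iff there
are spanning trees on the parts of each partition such that the number of parts
of `P` that are not parts of `Q` equals the number of edges in the union of the
trees of `P` but not in the union of the trees of `Q`. -/
theorem stmt3 {V : Type*} [Fintype V] (G : SimpleGraph V) (hG : G.Connected)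
    (p : V → ℝ) (hp : ∀ v, 0 < p v) (k : ℕ) (hk : 2 ≤ k)
    (P Q : V → Fin k)
    (hP : IsBalancedPartition G p k P) (hQ : IsBalancedPartition G p k Q)
    (hne : Set.range (fun i : Fin k => P ⁻¹' {i}) ≠
      Set.range (fun i : Fin k => Q ⁻¹' {i})) :
    (∃ (m : ℕ) (L : Fin m → ℕ) (σ : (j : Fin m) → Fin (L j + 2) → Fin k),
      (∀ j, L j + 2 ≤ k) ∧
      (∀ j, Function.Injective (σ j)) ∧
      (∀ (j j' : Fin m) (i : Fin (L j + 2)) (i' : Fin (L j' + 2)),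
        σ j i = σ j' i' → j = j') ∧
      ∃ H : (j : Fin m) → Fin (L j + 2) → Set V,
        (∀ j i, (H j i).Nonempty) ∧
        (∀ j i, H j i ⊆ P ⁻¹' {σ j i}) ∧
        (∀ j i, (G.induce (H j i)).Connected) ∧
        (∀ j i, (G.induce (P ⁻¹' {σ j i} \ H j i)).Connected) ∧
        (∀ j i, ∃ u ∈ P ⁻¹' {σ j i}, ∃ x ∈ P ⁻¹' {σ j (i + 1)}, G.Adj u x) ∧
        (∀ j i, ((P ⁻¹' {σ j (i + 1)} \ H j (i + 1)) ∪ H j i) ∈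
          Set.range (fun t : Fin k => Q ⁻¹' {t})) ∧
        (∀ t : Fin k, (∀ j i, σ j i ≠ t) →
          P ⁻¹' {t} ∈ Set.range (fun t' : Fin k => Q ⁻¹' {t'})))
    ↔
    (∃ tP tQ : Fin k → SimpleGraph V,
      (∀ i, IsSpanningTreeOn G (P ⁻¹' {i}) (tP i)) ∧
      (∀ i, IsSpanningTreeOn G (Q ⁻¹' {i}) (tQ i)) ∧
      Nat.card ↥(Set.range (fun i : Fin k => P ⁻¹' {i}) \ Set.range (fun j : Fin k => Q ⁻¹' {j})) =
        Nat.card ↥((⋃ i, (tP i).edgeSet) \ ⋃ i, (tQ i).edgeSet)) := by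
  have hsub := bud_sub hp hP hQ
  have hsub' := bud_sub hp hQ hP
  have hne : ∀ i, ∃ v, P v = i := fun i => by
    obtain ⟨⟨v, hv⟩⟩ := (hP.1 i).nonempty; exact ⟨v, hv⟩
  rw [bud_card hne]
  constructor
  · rintro ⟨m, L, σ, -, hinj, -, H, -, h1, h2, h3, -, h4, h5⟩
    exact bud_good_two hP.1 hQ.1 hsub (bud_one_good hP.1 hinj h1 h2 h3 h4 h5)
  · rintro ⟨tP, tQ, h1, h2, h3⟩
    exact bud_good_one hQ.1 hsub hsub' (bud_hall hp hP hQ) (bud_two_good hP.1 hsub h1 h2 h3)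
end

section
/- Every vertex of a simple grid graph G has a neighbor in G directly to its left or directly to its right; that is, for each v = (x, y) ∈ V(G), at least one of (x − 1, y) and (x + 1, y) is a vertex of G joined to v by an edge of G. -/
open SimpleGraph

/-- The square lattice graph on `ℤ × ℤ`: points at Euclidean distance 1 are adjacent. -/
def latticeGraph : SimpleGraph (ℤ × ℤ) :=
  SimpleGraph.fromRel (fun u v => (u.1 - v.1) ^ 2 + (u.2 - v.2) ^ 2 = 1)

/-- Given a set `A` of lattice edges (thought of as the edges of a simple closed
lattice loop), the point `(q.1, q.2 + 1/2)` is interior to the loop iff the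
horizontal ray from it to the right crosses an odd number of vertical loop
edges.  For `q ∉ loop`, this also decides whether the lattice point `q` itself
is interior, and whether the vertical lattice edge from `q` to `q + (0,1)` is
interior. -/
def vInterior (A : Set (Sym2 (ℤ × ℤ))) (q : ℤ × ℤ) : Prop :=
  Odd (Nat.card {x : ℤ // q.1 < x ∧ s(((x, q.2) : ℤ × ℤ), ((x, q.2 + 1) : ℤ × ℤ)) ∈ A})

/-- Whether the horizontal lattice edge from `q` to `q + (1,0)` is interior to
the loop with edge set `A`: the vertical ray upwards from its midpoint crosses
an odd number of horizontal loop edges. -/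
def hInterior (A : Set (Sym2 (ℤ × ℤ))) (q : ℤ × ℤ) : Prop :=
  Odd (Nat.card {y : ℤ // q.2 < y ∧ s(((q.1, y) : ℤ × ℤ), ((q.1 + 1, y) : ℤ × ℤ)) ∈ A})

/-- The lattice edge `{u, v}` lies on or interior to the loop with edge set `A`. -/
def edgeOK (A : Set (Sym2 (ℤ × ℤ))) (u v : ℤ × ℤ) : Prop :=
  s(u, v) ∈ A ∨
  (u.1 = v.1 ∧ vInterior A (u.1, min u.2 v.2)) ∨
  (u.2 = v.2 ∧ hInterior A (min u.1 v.1, u.2))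

/-- A simple grid graph, presented by a simple closed loop in the square
lattice: the data of a closed walk in `latticeGraph` that is a cycle. -/
structure SimpleGridGraph where
  /-- basepoint of the loop -/
  base : ℤ × ℤ
  /-- the boundary loop -/
  loop : latticeGraph.Walk base base
  /-- the loop is a simple closed loop (a cycle) -/
  isCycle : loop.IsCycle

/-- The set of edges of the boundary loop. -/
def SimpleGridGraph.loopEdges (Γ : SimpleGridGraph) : Set (Sym2 (ℤ × ℤ)) :=
  {e | e ∈ Γ.loop.edges}

/-- The boundary `∂G`: the vertices of the loop. -/
def SimpleGridGraph.boundary (Γ : SimpleGridGraph) : Set (ℤ × ℤ) :=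
  {v | v ∈ Γ.loop.support}

/-- The vertex set of the simple grid graph: all lattice points on or interior
to the boundary loop. -/
def SimpleGridGraph.verts (Γ : SimpleGridGraph) : Set (ℤ × ℤ) :=
  Γ.boundary ∪ {v | vInterior Γ.loopEdges v}

/-- The simple grid graph itself: its vertices are the lattice points on or
interior to the loop, and its edges are the lattice edges on or interior to
the loop. -/
def SimpleGridGraph.graph (Γ : SimpleGridGraph) : SimpleGraph ↥Γ.verts :=
  SimpleGraph.fromRel (fun u v => latticeGraph.Adj u.1 v.1 ∧ edgeOK Γ.loopEdges u.1 v.1)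


lemma lat_adj_iff (u v : ℤ × ℤ) : latticeGraph.Adj u v ↔
    v = (u.1 + 1, u.2) ∨ v = (u.1 - 1, u.2) ∨ v = (u.1, u.2 + 1) ∨ v = (u.1, u.2 - 1) := by
  obtain ⟨a, b⟩ := u
  obtain ⟨c, d⟩ := v
  simp only [latticeGraph, SimpleGraph.fromRel_adj, Prod.mk.injEq, ne_eq]
  constructor
  · rintro ⟨-, h⟩
    have h : (c - a) ^ 2 + (d - b) ^ 2 = 1 := by rcases h with h | h <;> nlinarith
    have h1 : c - a ≤ 1 := by nlinarith [sq_nonneg (d - b)]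
    have h2 : -1 ≤ c - a := by nlinarith [sq_nonneg (d - b)]
    have h3 : d - b ≤ 1 := by nlinarith [sq_nonneg (c - a)]
    have h4 : -1 ≤ d - b := by nlinarith [sq_nonneg (c - a)]
    obtain ⟨s, hs⟩ : ∃ s, s = c - a := ⟨_, rfl⟩
    obtain ⟨t, ht⟩ : ∃ t, t = d - b := ⟨_, rfl⟩
    rw [← hs, ← ht] at h
    rw [← hs] at h1 h2
    rw [← ht] at h3 h4
    interval_cases s <;> interval_cases t <;> simp at h <;> omega
  · rintro (⟨rfl, rfl⟩ | ⟨rfl, rfl⟩ | ⟨rfl, rfl⟩ | ⟨rfl, rfl⟩) <;> simp <;> omega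

def RP (q : ℤ × ℤ) (e : Sym2 (ℤ × ℤ)) : Prop :=
  ∃ x, q.1 < x ∧ s(((x, q.2) : ℤ × ℤ), ((x, q.2 + 1) : ℤ × ℤ)) = e

def UP (q : ℤ × ℤ) (e : Sym2 (ℤ × ℤ)) : Prop :=
  ∃ y, q.2 < y ∧ s(((q.1, y) : ℤ × ℤ), ((q.1 + 1, y) : ℤ × ℤ)) = e

lemma RP_iff (q a b : ℤ × ℤ) : RP q s(a, b) ↔
    q.1 < a.1 ∧ a.1 = b.1 ∧ ((a.2 = q.2 ∧ b.2 = q.2 + 1) ∨ (b.2 = q.2 ∧ a.2 = q.2 + 1)) := by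
  obtain ⟨a1, a2⟩ := a
  obtain ⟨b1, b2⟩ := b
  simp only [RP, Sym2.eq_iff, Prod.mk.injEq]
  constructor
  · rintro ⟨x, hx, h⟩
    omega
  · intro h
    exact ⟨a1, by omega⟩

lemma UP_iff (q a b : ℤ × ℤ) : UP q s(a, b) ↔
    q.2 < a.2 ∧ a.2 = b.2 ∧ ((a.1 = q.1 ∧ b.1 = q.1 + 1) ∨ (b.1 = q.1 ∧ a.1 = q.1 + 1)) := by
  obtain ⟨a1, a2⟩ := a
  obtain ⟨b1, b2⟩ := b
  simp only [UP, Sym2.eq_iff, Prod.mk.injEq]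
  constructor
  · rintro ⟨x, hx, h⟩
    omega
  · intro h
    exact ⟨a2, by omega⟩

open Classical in
lemma walk_parity (q : ℤ × ℤ) {u w : ℤ × ℤ} (p : latticeGraph.Walk u w) :
    Even (p.edges.countP (fun e => decide (RP q e)) + p.edges.countP (fun e => decide (UP q e))) ↔
    ((q.1 < u.1 ∧ q.2 < u.2) ↔ (q.1 < w.1 ∧ q.2 < w.2)) := by
  induction p with
  | nil => simp
  | @cons u v w h p ih =>
    rw [Walk.edges_cons, List.countP_cons, List.countP_cons]
    simp only [decide_eq_true_eq, RP_iff, UP_iff]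
    generalize List.countP _ _ = m at *
    generalize List.countP _ _ = n at *
    rw [Nat.even_iff] at *
    obtain ⟨q1, q2⟩ := q
    obtain ⟨u1, u2⟩ := u
    obtain ⟨w1, w2⟩ := w
    rcases (lat_adj_iff _ _).1 h with rfl | rfl | rfl | rfl <;>
    · simp only [true_and] at ih ⊢
      generalize (q1 < w1 ∧ q2 < w2) = W at ih ⊢
      by_cases hW : W <;> simp only [hW, iff_true, iff_false] at ih ⊢ <;> split_ifs <;> omega

open Classical in
lemma card_countP (l : List (Sym2 (ℤ × ℤ))) (hl : l.Nodup) (a : ℤ) (f : ℤ → Sym2 (ℤ × ℤ))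
    (hf : Function.Injective f) :
    Nat.card {x : ℤ // a < x ∧ f x ∈ {e | e ∈ l}} =
      l.countP (fun e => decide (∃ x, a < x ∧ f x = e)) := by
  have h1 : Nat.card {x : ℤ // a < x ∧ f x ∈ {e | e ∈ l}} =
      Set.ncard {x : ℤ | a < x ∧ f x ∈ l} := rfl
  rw [h1, ← Set.ncard_image_of_injective _ hf, List.countP_eq_length_filter,
    ← List.toFinset_card_of_nodup (hl.filter _), ← Set.ncard_coe_finset]
  congr 1
  ext e
  simp only [Set.mem_image, Set.mem_ofPred_eq, List.coe_toFinset, List.mem_filter,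
    decide_eq_true_eq]
  constructor
  · rintro ⟨x, ⟨h, h'⟩, rfl⟩
    exact ⟨h', x, h, rfl⟩
  · rintro ⟨h', x, h, rfl⟩
    exact ⟨x, ⟨h, h'⟩, rfl⟩

lemma vinj (y : ℤ) : Function.Injective
    (fun x : ℤ => s(((x, y) : ℤ × ℤ), ((x, y + 1) : ℤ × ℤ))) := by
  intro a b h
  simp only [Sym2.eq_iff, Prod.mk.injEq] at h
  omega

lemma hinj (x : ℤ) : Function.Injective
    (fun y : ℤ => s(((x, y) : ℤ × ℤ), ((x + 1, y) : ℤ × ℤ))) := by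
  intro a b h
  simp only [Sym2.eq_iff, Prod.mk.injEq] at h
  omega

lemma vh (Γ : SimpleGridGraph) (q : ℤ × ℤ) :
    vInterior Γ.loopEdges q ↔ hInterior Γ.loopEdges q := by
  classical
  have hn : Γ.loop.edges.Nodup := Γ.isCycle.isTrail.edges_nodup
  have := walk_parity q Γ.loop
  simp only [iff_self, iff_true] at this
  have h1 := card_countP _ hn q.1 _ (vinj q.2)
  have h2 := card_countP _ hn q.2 _ (hinj q.1)
  unfold vInterior hInterior SimpleGridGraph.loopEdges
  rw [h1, h2]
  unfold RP UP at this
  rw [Nat.even_add] at this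
  rw [← Nat.not_even_iff_odd, ← Nat.not_even_iff_odd, this]

lemma vstep (Γ : SimpleGridGraph) (x y : ℤ) :
    (vInterior Γ.loopEdges (x - 1, y) ↔ vInterior Γ.loopEdges (x, y)) ↔
    s(((x, y) : ℤ × ℤ), ((x, y + 1) : ℤ × ℤ)) ∉ Γ.loopEdges := by
  have hfin : ∀ a : ℤ, {z : ℤ | a < z ∧
      s(((z, y) : ℤ × ℤ), ((z, y + 1) : ℤ × ℤ)) ∈ Γ.loopEdges}.Finite := by
    intro a
    have : (Γ.loopEdges).Finite := List.finite_toSet _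
    exact (this.preimage ((vinj y).injOn)).subset (fun z hz => hz.2)
  have e1 : vInterior Γ.loopEdges (x - 1, y) ↔ Odd (Set.ncard {z : ℤ | x - 1 < z ∧
      s(((z, y) : ℤ × ℤ), ((z, y + 1) : ℤ × ℤ)) ∈ Γ.loopEdges}) := Iff.rfl
  have e2 : vInterior Γ.loopEdges (x, y) ↔ Odd (Set.ncard {z : ℤ | x < z ∧
      s(((z, y) : ℤ × ℤ), ((z, y + 1) : ℤ × ℤ)) ∈ Γ.loopEdges}) := Iff.rfl
  rw [e1, e2]
  by_cases h : s(((x, y) : ℤ × ℤ), ((x, y + 1) : ℤ × ℤ)) ∈ Γ.loopEdges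
  · have : {z : ℤ | x - 1 < z ∧ s(((z, y) : ℤ × ℤ), ((z, y + 1) : ℤ × ℤ)) ∈ Γ.loopEdges} =
      insert x {z : ℤ | x < z ∧ s(((z, y) : ℤ × ℤ), ((z, y + 1) : ℤ × ℤ)) ∈ Γ.loopEdges} := by
      ext z
      simp only [Set.mem_ofPred_eq, Set.mem_insert_iff]
      constructor
      · rintro ⟨h1, h2⟩
        by_cases hz : z = x
        · exact Or.inl hz
        · exact Or.inr ⟨by omega, h2⟩
      · rintro (rfl | ⟨h1, h2⟩)
        · exact ⟨by omega, h⟩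
        · exact ⟨by omega, h2⟩
    rw [this, Set.ncard_insert_of_notMem (by simp) (hfin x)]
    simp only [h, not_true, iff_false, Nat.odd_add_one]
    tauto
  · have : {z : ℤ | x - 1 < z ∧ s(((z, y) : ℤ × ℤ), ((z, y + 1) : ℤ × ℤ)) ∈ Γ.loopEdges} =
      {z : ℤ | x < z ∧ s(((z, y) : ℤ × ℤ), ((z, y + 1) : ℤ × ℤ)) ∈ Γ.loopEdges} := by
      ext z
      simp only [Set.mem_ofPred_eq]
      constructor
      · rintro ⟨h1, h2⟩
        refine ⟨?_, h2⟩
        by_contra hz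
        obtain rfl : z = x := by omega
        exact h h2
      · rintro ⟨h1, h2⟩
        exact ⟨by omega, h2⟩
    rw [this]
    simp [h]

lemma mem_boundary {Γ : SimpleGridGraph} {a b : ℤ × ℤ} (h : s(a, b) ∈ Γ.loopEdges) :
    a ∈ Γ.boundary ∧ b ∈ Γ.boundary :=
  ⟨Γ.loop.fst_mem_support_of_mem_edges h, Γ.loop.snd_mem_support_of_mem_edges h⟩

lemma graph_adj (Γ : SimpleGridGraph) (u v : Γ.verts) (h : latticeGraph.Adj u.1 v.1)
    (h' : edgeOK Γ.loopEdges u.1 v.1) : Γ.graph.Adj u v := by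
  refine (SimpleGraph.fromRel_adj _ _ _).2 ⟨?_, Or.inl ⟨h, h'⟩⟩
  rintro rfl
  exact h.ne rfl

lemma exists_nbr (Γ : SimpleGridGraph) (v w : ℤ × ℤ) (hv : v ∈ Γ.boundary) :
    ∃ u, u ≠ w ∧ latticeGraph.Adj v u ∧ s(v, u) ∈ Γ.loopEdges := by
  have h := Γ.isCycle.ncard_neighborSet_toSubgraph_eq_two hv
  obtain ⟨u, hu, hne⟩ := Set.exists_ne_of_one_lt_ncard (by rw [h]; norm_num) w
  have hu : Γ.loop.toSubgraph.Adj v u := hu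
  exact ⟨u, hne, hu.adj_sub, (Walk.mem_edges_toSubgraph _).1 hu⟩

/-- Every vertex of a simple grid graph has a neighbor in the graph directly to
its left or directly to its right. -/
theorem stmt5 (Γ : SimpleGridGraph) (v : ℤ × ℤ) (hv : v ∈ Γ.verts) :
    (∃ h : ((v.1 - 1, v.2) : ℤ × ℤ) ∈ Γ.verts,
      Γ.graph.Adj ⟨v, hv⟩ ⟨(v.1 - 1, v.2), h⟩) ∨
    (∃ h : ((v.1 + 1, v.2) : ℤ × ℤ) ∈ Γ.verts,
      Γ.graph.Adj ⟨v, hv⟩ ⟨(v.1 + 1, v.2), h⟩) := by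
  obtain ⟨x, y⟩ := v
  have hR : latticeGraph.Adj (x, y) (x + 1, y) := (lat_adj_iff _ _).2 (by simp)
  have hL : latticeGraph.Adj (x, y) (x - 1, y) := (lat_adj_iff _ _).2 (by simp)
  by_cases hi : vInterior Γ.loopEdges (x, y)
  · right
    have hm : ((x + 1, y) : ℤ × ℤ) ∈ Γ.verts := by
      have hs := vstep Γ (x + 1) y
      rw [add_sub_cancel_right] at hs
      by_cases h : vInterior Γ.loopEdges (x + 1, y)
      · exact Or.inr h
      · left
        have : s(((x + 1, y) : ℤ × ℤ), ((x + 1, y + 1) : ℤ × ℤ)) ∈ Γ.loopEdges := by tauto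
        exact (mem_boundary this).1
    refine ⟨hm, graph_adj Γ _ _ hR (Or.inr (Or.inr ⟨rfl, ?_⟩))⟩
    have : min x (x + 1) = x := by omega
    simp only [this]
    exact (vh Γ _).1 hi
  · have hb : ((x, y) : ℤ × ℤ) ∈ Γ.boundary := hv.resolve_right hi
    obtain ⟨u, hne, hadj, he⟩ := exists_nbr Γ (x, y) (x, y - 1) hb
    rcases (lat_adj_iff _ _).1 hadj with rfl | rfl | rfl | rfl
    · exact Or.inr ⟨Or.inl (mem_boundary he).2, graph_adj Γ _ _ hR (Or.inl he)⟩
    · exact Or.inl ⟨Or.inl (mem_boundary he).2, graph_adj Γ _ _ hL (Or.inl he)⟩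
    · left
      have hs := vstep Γ x y
      have h : vInterior Γ.loopEdges (x - 1, y) := by
        simp only at he
        tauto
      refine ⟨Or.inr h, graph_adj Γ _ _ hL (Or.inr (Or.inr ⟨rfl, ?_⟩))⟩
      have : min x (x - 1) = x - 1 := by omega
      simp only [this]
      exact (vh Γ _).1 h
    · exact absurd rfl hne
end

section
/- Let G be a finite connected unweighted graph, let a + b = |V(G)|, let T ∈ B_2^{a,b}(G), and let T_1, T_2 be the subtrees obtained by removing an edge of T with |V(T_1)| = a and |V(T_2)| = b. For each i ∈ {1, 2}, let e_i be an edge of T_i whose removal partitions T_i into subtrees K_i and H_i. Assume |V(H_1)| = |V(H_2)|, that some vertex of H_1 is adjacent in G to some vertex of K_2, and that some vertex of H_2 is adjacent in G to some vertex of K_1. Then at most 2 BUD steps on B_2^{a,b}(G) transform T into a tree T̃ ∈ B_2^{a,b}(G) whose corresponding subtrees T̃_1, T̃_2 satisfy V(T̃_1) = V(K_1) ∪ V(H_2) and V(T̃_2) = V(K_2) ∪ V(H_1). -/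
open SimpleGraph

/-- `T ∈ B_2^{a,b}(G)`: `T` is a spanning tree of `G` containing an edge whose
removal splits it into two subtrees, on vertex sets `A` and `Aᶜ`, of sizes `a`
and `b` respectively. -/
def MemB2 {V : Type*} (G : SimpleGraph V) (a b : ℕ) (T : SimpleGraph V) : Prop :=
  T ≤ G ∧ T.IsTree ∧ ∃ g ∈ T.edgeSet, ∃ A : Set V,
    (∀ v w : V, (T.deleteEdges {g}).Reachable v w ↔ (v ∈ A ↔ w ∈ A)) ∧
    Nat.card ↥A = a ∧ Nat.card ↥(Aᶜ) = b

/-- A step of the BUD walk on `B_2^{a,b}(G)`: add an edge `e ∈ E(G) \ E(T)`,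
then remove an edge `f` of the resulting unique cycle (equivalently, an edge
whose removal leaves a tree), so that the result is again in `B_2^{a,b}(G)`. -/
def BUDStep2 {V : Type*} (G : SimpleGraph V) (a b : ℕ) (T T' : SimpleGraph V) : Prop :=
  MemB2 G a b T ∧ MemB2 G a b T' ∧
  ∃ e ∈ G.edgeSet \ T.edgeSet, ∃ f ∈ (T ⊔ SimpleGraph.fromEdgeSet {e}).edgeSet,
    T' = (T ⊔ SimpleGraph.fromEdgeSet {e}).deleteEdges {f}

theorem aux_mono_s6 {V : Type*} {J J' : SimpleGraph V} (S : Set V)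
    (h : ∀ v w, v ∈ S → J.Adj v w → w ∈ S ∧ J'.Adj v w) {v w : V}
    (hv : v ∈ S) (hr : J.Reachable v w) : J'.Reachable v w := by
  obtain ⟨p⟩ := hr
  induction p with
  | nil => exact Reachable.refl _
  | cons a p ih =>
    obtain ⟨h1, h2⟩ := h _ _ hv a
    exact h2.reachable.trans (ih h1)

theorem aux_iff {V : Type*} {J : SimpleGraph V} (S : Set V)
    (h : ∀ v w, J.Adj v w → v ∈ S → w ∈ S)
    (h1 : ∀ v ∈ S, ∀ w ∈ S, J.Reachable v w)
    (h2 : ∀ v ∉ S, ∀ w ∉ S, J.Reachable v w) (v w : V) :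
    J.Reachable v w ↔ (v ∈ S ↔ w ∈ S) := by
  constructor
  · rintro ⟨p⟩
    induction p with
    | nil => rfl
    | cons a p ih => exact Iff.trans ⟨h _ _ a, h _ _ a.symm⟩ ih
  · intro hh
    by_cases hv : v ∈ S
    · exact h1 v hv w (hh.1 hv)
    · exact h2 v hv w (fun hw => hv (hh.2 hw))

theorem aux_swap_s6 {V : Type*} {T : SimpleGraph V} (hT : T.IsTree) (f : Sym2 V) (S : Set V)
    (hS : ∀ v w : V, (T.deleteEdges {f}).Reachable v w ↔ (v ∈ S ↔ w ∈ S))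
    (x y : V) (hx : x ∈ S) (hy : y ∉ S) (hne : s(x, y) ≠ f) :
    ((T ⊔ SimpleGraph.fromEdgeSet {s(x, y)}).deleteEdges {f}).IsTree ∧
    ((T ⊔ SimpleGraph.fromEdgeSet {s(x, y)}).deleteEdges {f}).deleteEdges {s(x, y)}
      = T.deleteEdges {f} := by
  have hxy : x ≠ y := fun h => hy (h ▸ hx)
  have hnr : ¬ (T.deleteEdges {f}).Reachable x y := by
    rw [hS]; tauto
  have hna : ¬ (T.deleteEdges {f}).Adj x y := fun h => hnr h.reachable
  have e1 : (T ⊔ SimpleGraph.fromEdgeSet {s(x, y)}).deleteEdges {f}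
      = T.deleteEdges {f} ⊔ edge x y := by
    ext v w
    simp only [deleteEdges_adj, sup_adj, fromEdgeSet_adj, edge, Set.mem_singleton_iff]
    constructor
    · tauto
    · rintro (h | h)
      · tauto
      · refine ⟨Or.inr h, ?_⟩
        rw [h.1]; exact hne
  constructor
  · rw [e1]
    have hadj : (T.deleteEdges {f} ⊔ edge x y).Adj x y := by
      simp [edge, hxy]
    have hm : ∀ v w, (T.deleteEdges {f}).Reachable v w →
      (T.deleteEdges {f} ⊔ edge x y).Reachable v w := fun v w h => h.mono le_sup_left
    refine ⟨?_, ?_⟩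
    · have hx' : ∀ v, (T.deleteEdges {f} ⊔ edge x y).Reachable v x := by
        intro v
        by_cases hv : v ∈ S
        · exact hm _ _ ((hS _ _).2 (by tauto))
        · exact (hm _ _ ((hS v y).2 (by tauto))).trans hadj.symm.reachable
      haveI : Nonempty V := ⟨x⟩
      exact ⟨fun v w => (hx' v).trans (hx' w).symm⟩
    · exact IsAcyclic.sup_edge_of_not_reachable hnr (hT.2.anti (deleteEdges_le _))
  · ext v w
    simp only [deleteEdges_adj, sup_adj, fromEdgeSet_adj, Set.mem_singleton_iff]
    constructor
    · tauto
    · rintro ⟨h, h'⟩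
      refine ⟨⟨Or.inl h, h'⟩, ?_⟩
      intro h2
      apply hna
      have : s(v, w) ∈ (T.deleteEdges {f}).edgeSet := by
        simp [h, h']
      rw [h2] at this
      exact this

theorem aux_edge {V : Type*} {T : SimpleGraph V} {g e : Sym2 V} {A H K : Set V}
    (hA : ∀ v w : V, (T.deleteEdges {g}).Reachable v w ↔ (v ∈ A ↔ w ∈ A))
    (h1 : H ∪ K = A) (h1d : Disjoint H K) (h1H : H.Nonempty) (h1K : K.Nonempty)
    (h1n : ∀ v ∈ H, ∀ w ∈ K, ¬ (T.deleteEdges {g, e}).Reachable v w) :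
    (∃ x ∈ H, ∃ y ∈ K, e = s(x, y)) ∧
    (∀ v w, T.Adj v w → s(v, w) ≠ g → s(v, w) ≠ e → v ∈ H → w ∈ H) ∧
    (∀ v w, T.Adj v w → s(v, w) ≠ g → s(v, w) ≠ e → v ∈ K → w ∈ K) := by
  have hmv : ∀ v w, T.Adj v w → s(v, w) ≠ g → (v ∈ A ↔ w ∈ A) := by
    intro v w h h'
    rw [← hA]
    exact Adj.reachable (by simp [h, h'])
  have hd : ∀ v, v ∈ H → v ∈ K → False := fun v a b => Set.disjoint_left.1 h1d a b
  have hH : ∀ v w, T.Adj v w → s(v, w) ≠ g → s(v, w) ≠ e → v ∈ H → w ∈ H := by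
    intro v w h hg he hv
    have : w ∈ A := (hmv v w h hg).1 (h1 ▸ Or.inl hv)
    rw [← h1] at this
    refine this.resolve_right fun hw => h1n v hv w hw (Adj.reachable ?_)
    simp [h, hg, he]
  have hK : ∀ v w, T.Adj v w → s(v, w) ≠ g → s(v, w) ≠ e → v ∈ K → w ∈ K := by
    intro v w h hg he hv
    have : w ∈ A := (hmv v w h hg).1 (h1 ▸ Or.inr hv)
    rw [← h1] at this
    refine this.resolve_left fun hw => h1n w hw v hv (Adj.reachable ?_)
    have := h.symm
    simp [this, Sym2.eq_swap, hg, he]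
  refine ⟨?_, hH, hK⟩
  obtain ⟨x, hx⟩ := h1H
  obtain ⟨y, hy⟩ := h1K
  have hxA : x ∈ A := h1 ▸ Or.inl hx
  have hyA : y ∈ A := h1 ▸ Or.inr hy
  obtain ⟨p⟩ := (hA x y).2 (by tauto)
  obtain ⟨d, -, d1, d2⟩ := p.exists_boundary_dart H hx (fun h => hd _ h hy)
  have := d.adj
  simp only [deleteEdges_adj, Set.mem_singleton_iff] at this
  have hz : d.snd ∈ A := (hmv _ _ this.1 this.2).1 (h1 ▸ Or.inl d1)
  rw [← h1] at hz
  refine ⟨d.fst, d1, d.snd, hz.resolve_left d2, ?_⟩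
  by_contra hne
  exact d2 (hH _ _ this.1 this.2 (fun h => hne h.symm) d1)

theorem aux_ne {V : Type*} {v w p q : V} (S : Set V) (hp : p ∈ S) (hq : q ∈ S)
    (h : v ∉ S ∨ w ∉ S) : s(v, w) ≠ s(p, q) := by
  intro he
  rw [Sym2.eq_iff] at he
  rcases he with ⟨rfl, rfl⟩ | ⟨rfl, rfl⟩ <;> tauto

theorem aux_core {V : Type*} [Fintype V] (G : SimpleGraph V)
    (a b : ℕ) (hab : a + b = Fintype.card V)
    (T : SimpleGraph V) (hTG : T ≤ G) (hTree : T.IsTree)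
    (u x : V) (hg : T.Adj u x)
    (A : Set V)
    (hA : ∀ v w : V, (T.deleteEdges {s(u, x)}).Reachable v w ↔ (v ∈ A ↔ w ∈ A))
    (hca : Nat.card ↥A = a) (hcb : Nat.card ↥(Aᶜ) = b)
    (e₁ e₂ : Sym2 V) (he₁ : e₁ ∈ T.edgeSet) (he₂ : e₂ ∈ T.edgeSet)
    (hge₁ : e₁ ≠ s(u, x)) (hge₂ : e₂ ≠ s(u, x))
    (H₁ K₁ H₂ K₂ : Set V)
    (h1 : H₁ ∪ K₁ = A) (h1d : Disjoint H₁ K₁) (h1H : H₁.Nonempty) (h1K : K₁.Nonempty)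
    (h1r : ∀ v ∈ H₁, ∀ w ∈ H₁, (T.deleteEdges {s(u, x), e₁}).Reachable v w)
    (h1r' : ∀ v ∈ K₁, ∀ w ∈ K₁, (T.deleteEdges {s(u, x), e₁}).Reachable v w)
    (h1n : ∀ v ∈ H₁, ∀ w ∈ K₁, ¬ (T.deleteEdges {s(u, x), e₁}).Reachable v w)
    (h2 : H₂ ∪ K₂ = Aᶜ) (h2d : Disjoint H₂ K₂) (h2H : H₂.Nonempty) (h2K : K₂.Nonempty)
    (h2r : ∀ v ∈ H₂, ∀ w ∈ H₂, (T.deleteEdges {s(u, x), e₂}).Reachable v w)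
    (h2r' : ∀ v ∈ K₂, ∀ w ∈ K₂, (T.deleteEdges {s(u, x), e₂}).Reachable v w)
    (h2n : ∀ v ∈ H₂, ∀ w ∈ K₂, ¬ (T.deleteEdges {s(u, x), e₂}).Reachable v w)
    (hcard : Nat.card ↥H₁ = Nat.card ↥H₂)
    (hu : u ∈ H₁) (hx : x ∈ K₂)
    (hadj2 : ∃ u ∈ H₂, ∃ x ∈ K₁, G.Adj u x) :
    ∃ T' : SimpleGraph V, BUDStep2 G a b T T' ∧ 
      ∃ g' ∈ T'.edgeSet,
        (∀ v w : V, (T'.deleteEdges {g'}).Reachable v w ↔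
          (v ∈ K₁ ∪ H₂ ↔ w ∈ K₁ ∪ H₂)) ∧
        Nat.card ↥(K₁ ∪ H₂) = a ∧ Nat.card ↥((K₁ ∪ H₂)ᶜ) = b := by
  have hA' : ∀ v w : V, (T.deleteEdges {s(u, x)}).Reachable v w ↔ (v ∈ Aᶜ ↔ w ∈ Aᶜ) := by
    intro v w; rw [hA]; simp only [Set.mem_compl_iff]; tauto
  obtain ⟨⟨p1, hp1, q1, hq1, rfl⟩, hH1, hK1⟩ := aux_edge hA h1 h1d h1H h1K h1n
  obtain ⟨⟨p2, hp2, q2, hq2, rfl⟩, hH2, hK2⟩ := aux_edge hA' h2 h2d h2H h2K h2n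
  obtain ⟨y, hy, z, hz, hyz⟩ := hadj2
  have m1 : ∀ v, v ∈ A ↔ v ∈ H₁ ∨ v ∈ K₁ := by intro v; rw [← h1]; rfl
  have m2 : ∀ v, v ∉ A ↔ v ∈ H₂ ∨ v ∈ K₂ := by
    intro v; rw [← Set.mem_compl_iff, ← h2]; rfl
  have m3 : ∀ v, v ∈ H₁ → v ∉ K₁ := fun v a b => Set.disjoint_left.1 h1d a b
  have m4 : ∀ v, v ∈ H₂ → v ∉ K₂ := fun v a b => Set.disjoint_left.1 h2d a b
  have p1A : p1 ∈ A := (m1 _).2 (Or.inl hp1)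
  have q1A : q1 ∈ A := (m1 _).2 (Or.inr hq1)
  have uA : u ∈ A := (m1 _).2 (Or.inl hu)
  have zA : z ∈ A := (m1 _).2 (Or.inr hz)
  have p2A : p2 ∉ A := (m2 _).2 (Or.inl hp2)
  have q2A : q2 ∉ A := (m2 _).2 (Or.inr hq2)
  have yA : y ∉ A := (m2 _).2 (Or.inl hy)
  have xA : x ∉ A := (m2 _).2 (Or.inr hx)
  have kA : ∀ v ∈ K₁, v ∈ A := fun v h => (m1 v).2 (Or.inr h)
  have hA1 : ∀ v ∈ H₁, v ∈ A := fun v h => (m1 v).2 (Or.inl h)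
  have kA2 : ∀ v ∈ K₂, v ∉ A := fun v h => (m2 v).2 (Or.inr h)
  have hA2 : ∀ v ∈ H₂, v ∉ A := fun v h => (m2 v).2 (Or.inl h)
  have uK : u ∈ K₁ᶜ := m3 u hu
  have xK : x ∈ K₁ᶜ := fun h => xA (kA x h)
  have uB : u ∈ (K₁ ∪ H₂)ᶜ := fun h => h.elim uK (fun h => hA2 u h uA)
  have xB : x ∈ (K₁ ∪ H₂)ᶜ := fun h => h.elim xK (fun h => m4 x h hx)
  have hmv : ∀ v w, T.Adj v w → s(v, w) ≠ s(u, x) → (v ∈ A ↔ w ∈ A) := by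
    intro v w h h'
    rw [← hA]
    exact Adj.reachable (by simp [h, h'])
  have hzy : z ≠ y := hyz.ne'
  have hK1iff : ∀ v w : V, (T.deleteEdges {s(p1, q1)}).Reachable v w ↔ (v ∈ K₁ ↔ w ∈ K₁) := by
    have hux : (T.deleteEdges {s(p1, q1)}).Reachable u x := by
      apply Adj.reachable
      simp only [deleteEdges_adj, Set.mem_singleton_iff]
      exact ⟨hg, fun h => hge₁ h.symm⟩
    have rH : ∀ v ∈ H₁, (T.deleteEdges {s(p1, q1)}).Reachable v u := fun v hv =>
      (h1r v hv u hu).mono (deleteEdges_anti (by simp))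
    have rA : ∀ v ∉ A, (T.deleteEdges {s(p1, q1)}).Reachable v x := by
      intro v hv
      refine aux_mono_s6 Aᶜ ?_ hv ((hA v x).2 (by tauto))
      intro v w hv h
      simp only [deleteEdges_adj, Set.mem_singleton_iff, Set.mem_compl_iff] at h hv ⊢
      have := hmv _ _ h.1 h.2
      exact ⟨by tauto, h.1, aux_ne A p1A q1A (Or.inl hv)⟩
    have rC : ∀ v ∉ K₁, (T.deleteEdges {s(p1, q1)}).Reachable v u := by
      intro v hv
      by_cases hvA : v ∈ A
      · exact rH v (((m1 v).1 hvA).resolve_right hv)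
      · exact (rA v hvA).trans hux.symm
    apply aux_iff
    · intro v w h hv
      simp only [deleteEdges_adj, Set.mem_singleton_iff] at h
      exact hK1 v w h.1 (aux_ne K₁ᶜ uK xK (Or.inl (fun h => h hv))) h.2 hv
    · intro v hv w hw
      exact (h1r' v hv w hw).mono (deleteEdges_anti (by simp))
    · intro v hv w hw
      exact (rC v hv).trans (rC w hw).symm
  have hne : s(z, y) ≠ s(p1, q1) := aux_ne A p1A q1A (Or.inr yA)
  have hnT : ¬ T.Adj z y := by
    intro h
    have := hmv z y h (aux_ne K₁ᶜ uK xK (Or.inl (fun h => h hz)))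
    tauto
  obtain ⟨t1, t2⟩ := aux_swap_s6 hTree _ K₁ hK1iff z y hz (fun h => yA (kA y h)) hne
  set T' := (T ⊔ SimpleGraph.fromEdgeSet {s(z, y)}).deleteEdges {s(p1, q1)} with hT'
  have adj' : ∀ v w, T'.Adj v w ↔ (T.Adj v w ∧ s(v, w) ≠ s(p1, q1)) ∨ s(v, w) = s(z, y) := by
    intro v w
    simp only [hT', deleteEdges_adj, sup_adj, fromEdgeSet_adj, Set.mem_singleton_iff]
    constructor
    · tauto
    · rintro (h | h)
      · tauto
      · refine ⟨Or.inr ⟨h, ?_⟩, by rw [h]; exact hne⟩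
        rintro rfl
        rw [Sym2.eq_iff] at h
        rcases h with ⟨rfl, rfl⟩ | ⟨rfl, rfl⟩ <;> exact hzy rfl
  have hle : T' ≤ G := by
    intro v w h
    rcases (adj' v w).1 h with h | h
    · exact hTG h.1
    · have : s(v, w) ∈ G.edgeSet := by rw [h]; exact hyz.symm
      exact this
  have hg' : s(p2, q2) ∈ T'.edgeSet := by
    rw [mem_edgeSet, adj']
    exact Or.inl ⟨he₂, aux_ne A p1A q1A (Or.inl p2A)⟩
  have adj2 : ∀ v w, (T'.deleteEdges {s(p2, q2)}).Adj v w ↔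
      (T.Adj v w ∧ s(v, w) ≠ s(p1, q1) ∧ s(v, w) ≠ s(p2, q2)) ∨ s(v, w) = s(z, y) := by
    intro v w
    simp only [deleteEdges_adj, adj', Set.mem_singleton_iff]
    constructor
    · tauto
    · rintro (h | h)
      · tauto
      · exact ⟨Or.inr h, by rw [h]; exact aux_ne Aᶜ p2A q2A (Or.inl (fun h => h zA))⟩
  have hR : ∀ v w : V, (T'.deleteEdges {s(p2, q2)}).Reachable v w ↔
          (v ∈ K₁ ∪ H₂ ↔ w ∈ K₁ ∪ H₂) := by
    have rH1 : ∀ v ∈ H₁, (T'.deleteEdges {s(p2, q2)}).Reachable v u := by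
      intro v hv
      refine aux_mono_s6 H₁ ?_ hv (h1r v hv u hu)
      intro v w hv h
      simp only [deleteEdges_adj, Set.mem_insert_iff, Set.mem_singleton_iff, not_or] at h
      exact ⟨hH1 _ _ h.1 h.2.1 h.2.2 hv, (adj2 _ _).2 (Or.inl ⟨h.1, h.2.2, aux_ne Aᶜ p2A q2A (Or.inl (fun h => h (hA1 v hv)))⟩)⟩
    have rK1 : ∀ v ∈ K₁, (T'.deleteEdges {s(p2, q2)}).Reachable v z := by
      intro v hv
      refine aux_mono_s6 K₁ ?_ hv (h1r' v hv z hz)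
      intro v w hv h
      simp only [deleteEdges_adj, Set.mem_insert_iff, Set.mem_singleton_iff, not_or] at h
      exact ⟨hK1 _ _ h.1 h.2.1 h.2.2 hv, (adj2 _ _).2 (Or.inl ⟨h.1, h.2.2, aux_ne Aᶜ p2A q2A (Or.inl (fun h => h (kA v hv)))⟩)⟩
    have rH2 : ∀ v ∈ H₂, (T'.deleteEdges {s(p2, q2)}).Reachable v y := by
      intro v hv
      refine aux_mono_s6 H₂ ?_ hv (h2r v hv y hy)
      intro v w hv h
      simp only [deleteEdges_adj, Set.mem_insert_iff, Set.mem_singleton_iff, not_or] at h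
      exact ⟨hH2 _ _ h.1 h.2.1 h.2.2 hv, (adj2 _ _).2 (Or.inl ⟨h.1, aux_ne A p1A q1A (Or.inl (hA2 v hv)), h.2.2⟩)⟩
    have rK2 : ∀ v ∈ K₂, (T'.deleteEdges {s(p2, q2)}).Reachable v x := by
      intro v hv
      refine aux_mono_s6 K₂ ?_ hv (h2r' v hv x hx)
      intro v w hv h
      simp only [deleteEdges_adj, Set.mem_insert_iff, Set.mem_singleton_iff, not_or] at h
      exact ⟨hK2 _ _ h.1 h.2.1 h.2.2 hv, (adj2 _ _).2 (Or.inl ⟨h.1, aux_ne A p1A q1A (Or.inl (kA2 v hv)), h.2.2⟩)⟩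
    have ruX : (T'.deleteEdges {s(p2, q2)}).Reachable x u :=
      Adj.reachable (((adj2 u x).2 (Or.inl ⟨hg, hge₁.symm, hge₂.symm⟩)).symm)
    have rzy : (T'.deleteEdges {s(p2, q2)}).Reachable y z :=
      Adj.reachable (((adj2 z y).2 (Or.inr rfl)).symm)
    have r1 : ∀ v ∈ K₁ ∪ H₂, (T'.deleteEdges {s(p2, q2)}).Reachable v z := by
      rintro v (hv | hv)
      · exact rK1 v hv
      · exact (rH2 v hv).trans rzy
    have r2 : ∀ v ∉ K₁ ∪ H₂, (T'.deleteEdges {s(p2, q2)}).Reachable v u := by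
      intro v hv
      rw [Set.mem_union, not_or] at hv
      by_cases hvA : v ∈ A
      · exact rH1 v (((m1 v).1 hvA).resolve_right hv.1)
      · exact (rK2 v (((m2 v).1 hvA).resolve_left hv.2)).trans ruX
    apply aux_iff
    · intro v w h hv
      rw [adj2] at h
      rw [Set.mem_union] at hv ⊢
      rcases h with ⟨h, ha, hb⟩ | h
      · have hgg : s(v, w) ≠ s(u, x) :=
          aux_ne (K₁ ∪ H₂)ᶜ uB xB (Or.inl (fun h => h hv))
        exact hv.imp (hK1 v w h hgg ha) (hH2 v w h hgg hb)
      · rw [Sym2.eq_iff] at h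
        rcases h with ⟨rfl, rfl⟩ | ⟨rfl, rfl⟩ <;> tauto
    · exact fun v hv w hw => (r1 v hv).trans (r1 w hw).symm
    · exact fun v hv w hw => (r2 v hv).trans (r2 w hw).symm
  have c1 : Nat.card ↥(K₁ ∪ H₂) = a := by
    simp only [Nat.card_coe_set_eq] at hcard hca ⊢
    rw [Set.ncard_union_eq (Set.disjoint_left.2 (fun v h h' => hA2 v h' (kA v h)))]
    rw [← hca, ← h1, Set.ncard_union_eq h1d, hcard, add_comm]
  have c2 : Nat.card ↥((K₁ ∪ H₂)ᶜ) = b := by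
    have := Set.ncard_add_ncard_compl (K₁ ∪ H₂)
    rw [Nat.card_coe_set_eq] at c1 ⊢
    rw [Nat.card_eq_fintype_card] at this
    omega
  refine ⟨T', ⟨⟨hTG, hTree, s(u, x), hg, A, hA, hca, hcb⟩,
    ⟨hle, t1, s(p2, q2), hg', K₁ ∪ H₂, hR, c1, c2⟩, s(z, y), ⟨hyz.symm, hnT⟩, s(p1, q1), ?_, hT'⟩,
    s(p2, q2), hg', hR, c1, c2⟩
  simp only [edgeSet_sup]
  exact Or.inl he₁

/-- Lemma (k = 2 exchange): given a split of `T` into subtrees on `A` (size `a`)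
and `Aᶜ` (size `b`), an edge `e₁` splitting the `A`-side into `H₁, K₁` and an
edge `e₂` splitting the `Aᶜ`-side into `H₂, K₂`, with `|H₁| = |H₂|`, `H₁`
adjacent to `K₂` and `H₂` adjacent to `K₁`, at most 2 BUD steps transform `T`
into a tree whose two split pieces have vertex sets `K₁ ∪ H₂` and `K₂ ∪ H₁`. -/
theorem stmt6 {V : Type*} [Fintype V] (G : SimpleGraph V) (hG : G.Connected)
    (a b : ℕ) (hab : a + b = Fintype.card V)
    (T : SimpleGraph V) (hTG : T ≤ G) (hTree : T.IsTree)
    (g : Sym2 V) (hg : g ∈ T.edgeSet)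
    (A : Set V)
    (hA : ∀ v w : V, (T.deleteEdges {g}).Reachable v w ↔ (v ∈ A ↔ w ∈ A))
    (hca : Nat.card ↥A = a) (hcb : Nat.card ↥(Aᶜ) = b)
    (e₁ e₂ : Sym2 V) (he₁ : e₁ ∈ T.edgeSet) (he₂ : e₂ ∈ T.edgeSet)
    (hge₁ : e₁ ≠ g) (hge₂ : e₂ ≠ g)
    (H₁ K₁ H₂ K₂ : Set V)
    (h1 : H₁ ∪ K₁ = A) (h1d : Disjoint H₁ K₁) (h1H : H₁.Nonempty) (h1K : K₁.Nonempty)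
    (h1r : ∀ v ∈ H₁, ∀ w ∈ H₁, (T.deleteEdges {g, e₁}).Reachable v w)
    (h1r' : ∀ v ∈ K₁, ∀ w ∈ K₁, (T.deleteEdges {g, e₁}).Reachable v w)
    (h1n : ∀ v ∈ H₁, ∀ w ∈ K₁, ¬ (T.deleteEdges {g, e₁}).Reachable v w)
    (h2 : H₂ ∪ K₂ = Aᶜ) (h2d : Disjoint H₂ K₂) (h2H : H₂.Nonempty) (h2K : K₂.Nonempty)
    (h2r : ∀ v ∈ H₂, ∀ w ∈ H₂, (T.deleteEdges {g, e₂}).Reachable v w)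
    (h2r' : ∀ v ∈ K₂, ∀ w ∈ K₂, (T.deleteEdges {g, e₂}).Reachable v w)
    (h2n : ∀ v ∈ H₂, ∀ w ∈ K₂, ¬ (T.deleteEdges {g, e₂}).Reachable v w)
    (hcard : Nat.card ↥H₁ = Nat.card ↥H₂)
    (hadj1 : ∃ u ∈ H₁, ∃ x ∈ K₂, G.Adj u x)
    (hadj2 : ∃ u ∈ H₂, ∃ x ∈ K₁, G.Adj u x) :
    ∃ m ≤ 2, ∃ c : ℕ → SimpleGraph V, c 0 = T ∧
      (∀ i < m, BUDStep2 G a b (c i) (c (i + 1))) ∧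
      MemB2 G a b (c m) ∧
      ∃ g' ∈ (c m).edgeSet,
        (∀ v w : V, ((c m).deleteEdges {g'}).Reachable v w ↔
          (v ∈ K₁ ∪ H₂ ↔ w ∈ K₁ ∪ H₂)) ∧
        Nat.card ↥(K₁ ∪ H₂) = a ∧ Nat.card ↥((K₁ ∪ H₂)ᶜ) = b := by
  obtain ⟨u, hu, x, hx, hux⟩ := hadj1
  by_cases hgp : s(u, x) = g
  · subst hgp
    obtain ⟨T', hs, hh⟩ := aux_core G a b hab T hTG hTree u x hg A hA hca hcb e₁ e₂ he₁ he₂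
      hge₁ hge₂ H₁ K₁ H₂ K₂ h1 h1d h1H h1K h1r h1r' h1n h2 h2d h2H h2K h2r h2r' h2n hcard
      hu hx hadj2
    refine ⟨1, by omega, fun i => if i = 0 then T else T', rfl, ?_, hs.2.1, hh⟩
    intro i hi
    obtain rfl : i = 0 := by omega
    exact hs
  · have huA : u ∈ A := h1 ▸ Or.inl hu
    have hxA : x ∉ A := by
      have : x ∈ Aᶜ := h2 ▸ Or.inr hx
      exact this
    obtain ⟨t1, t2⟩ := aux_swap_s6 hTree g A hA u x huA hxA hgp
    have hnT : ¬ T.Adj u x := by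
      intro h
      have : (T.deleteEdges {g}).Reachable u x := Adj.reachable (by simp [h, hgp])
      rw [hA] at this
      tauto
    set T₁ := (T ⊔ SimpleGraph.fromEdgeSet {s(u, x)}).deleteEdges {g} with hT₁
    have hle : T₁ ≤ G := by
      refine (deleteEdges_le _).trans (sup_le hTG ?_)
      rw [fromEdgeSet_le]
      rintro e ⟨rfl, -⟩
      exact hux
    have hgT : T₁.Adj u x := by
      simp [hT₁, hgp, hux.ne]
    have hed : ∀ e, e ∈ T.edgeSet → e ≠ g → e ∈ T₁.edgeSet := by
      intro e he hne
      simp only [hT₁, edgeSet_deleteEdges, edgeSet_sup]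
      exact ⟨Or.inl he, hne⟩
    have hdel : ∀ e, T₁.deleteEdges {s(u, x), e} = T.deleteEdges {g, e} := by
      intro e
      rw [Set.insert_eq, Set.insert_eq, ← deleteEdges_deleteEdges, t2, deleteEdges_deleteEdges]
    have hstep : BUDStep2 G a b T T₁ := by
      refine ⟨⟨hTG, hTree, g, hg, A, hA, hca, hcb⟩,
        ⟨hle, t1, s(u, x), hgT, A, by rw [t2]; exact hA, hca, hcb⟩,
        s(u, x), ⟨hux, hnT⟩, g, ?_, hT₁⟩
      simp only [edgeSet_sup]
      exact Or.inl hg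
    obtain ⟨T', hs, hh⟩ := aux_core G a b hab T₁ hle t1 u x hgT A (by rw [t2]; exact hA) hca hcb
      e₁ e₂ (hed _ he₁ hge₁) (hed _ he₂ hge₂)
      (fun h => hnT (by rw [h] at he₁; exact he₁)) (fun h => hnT (by rw [h] at he₂; exact he₂))
      H₁ K₁ H₂ K₂ h1 h1d h1H h1K
      (by rw [hdel]; exact h1r) (by rw [hdel]; exact h1r') (by rw [hdel]; exact h1n)
      h2 h2d h2H h2K
      (by rw [hdel]; exact h2r) (by rw [hdel]; exact h2r') (by rw [hdel]; exact h2n) hcard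
      hu hx hadj2
    refine ⟨2, le_rfl, fun i => if i = 0 then T else if i = 1 then T₁ else T', rfl, ?_,
      hs.2.1, hh⟩
    intro i hi
    obtain rfl | rfl : i = 0 ∨ i = 1 := by omega
    · exact hstep
    · exact hs
end

section
/- Let T be a spanning tree of a finite connected graph G and let v ∈ V(G) be a vertex that is not a cut vertex of G. Then there exists a sequence of at most deg_T(v) − 1 spanning trees T = T_0, T_1, …, T_m of G, each obtained from the previous one by adding one edge of G and removing one edge of the resulting cycle, such that v is a leaf of T_m. -/
open SimpleGraph

theorem stmt7_step {V : Type*} [Fintype V] (G : SimpleGraph V)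
    (T : SimpleGraph V) (hTG : T ≤ G) (hTree : T.IsTree)
    (v : V) (hv : (G.induce (({v} : Set V)ᶜ)).Connected)
    (hd : 1 < Nat.card ↥(T.neighborSet v)) :
    ∃ T' : SimpleGraph V, T' ≤ G ∧ T'.IsTree ∧
      (∃ e ∈ G.edgeSet \ T.edgeSet,
        ∃ f ∈ (T ⊔ SimpleGraph.fromEdgeSet {e}).edgeSet,
          T' = (T ⊔ SimpleGraph.fromEdgeSet {e}).deleteEdges {f}) ∧
      Nat.card ↥(T'.neighborSet v) + 1 = Nat.card ↥(T.neighborSet v) := by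
  classical
  rw [Nat.card_coe_set_eq, Set.one_lt_ncard] at hd
  obtain ⟨u, hu, w, hw, huw⟩ := hd
  simp only [mem_neighborSet] at hu hw
  set D := T.deleteEdges {s(v, u)} with hD
  have hDT : D ≤ T := deleteEdges_le _
  have hDadj : ∀ a b, D.Adj a b ↔ T.Adj a b ∧ s(a, b) ≠ s(v, u) := by
    intro a b; simp [hD]
  have hnr : ¬ D.Reachable v u := by
    have := isAcyclic_iff_forall_adj_isBridge.mp hTree.IsAcyclic hu
    have h2 := isBridge_iff.mp this
    first | exact h2 | exact h2.2
  have hvw : D.Adj v w := by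
    rw [hDadj]
    refine ⟨hw, ?_⟩
    intro h
    rcases Sym2.eq_iff.mp h with ⟨_, h⟩ | ⟨h, _⟩
    · exact huw h.symm
    · exact hu.ne h
  have hwC : ¬ D.Reachable u w := fun h => hnr (hvw.reachable.trans h.symm)
  have hcov : ∀ z, D.Reachable u z ∨ D.Reachable v z := by
    intro z
    obtain ⟨p⟩ := hTree.connected.preconnected z v
    induction p with
    | nil => exact Or.inr (Reachable.refl _)
    | @cons a b c h p ih =>
      by_cases hab : s(a, b) = s(c, u)
      · rcases Sym2.eq_iff.mp hab with ⟨h, _⟩ | ⟨h, _⟩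
        · exact Or.inr (h ▸ Reachable.refl _)
        · exact Or.inl (h ▸ Reachable.refl _)
      · have : D.Adj b a := ((hDadj _ _).2 ⟨h, hab⟩).symm
        exact (ih hv hu hw hD hDT hDadj hnr hvw hwC).imp (·.trans this.reachable) (·.trans this.reachable)
  have hcross : ∃ x y, G.Adj x y ∧ x ≠ v ∧ y ≠ v ∧ D.Reachable u x ∧ ¬ D.Reachable u y := by
    by_contra hcon
    push Not at hcon
    have key : ∀ a b : (({v} : Set V)ᶜ : Set V), (G.induce (({v} : Set V)ᶜ)).Walk a b →
        D.Reachable u a → D.Reachable u b := by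
      intro a b p
      induction p with
      | nil => exact id
      | @cons a b c h p ih =>
        intro ha
        exact ih (hcon a b h a.2 b.2 ha)
    obtain ⟨p⟩ := hv.preconnected ⟨u, hu.ne'⟩ ⟨w, hw.ne'⟩
    exact hwC (key _ _ p (Reachable.refl _))
  obtain ⟨x, y, hxy, hxv, hyv, hx, hy⟩ := hcross
  have hyD : D.Reachable v y := (hcov y).resolve_left hy
  have hne : s(x, y) ≠ s(v, u) := by
    intro h
    rcases Sym2.eq_iff.mp h with ⟨h, _⟩ | ⟨_, h⟩
    · exact hxv h
    · exact hyv h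
  have hTxy : ¬ T.Adj x y := fun h =>
    hy (hx.trans ((hDadj _ _).2 ⟨h, hne⟩).reachable)
  have hEq : (T ⊔ fromEdgeSet {s(x, y)}).deleteEdges {s(v, u)} = D ⊔ edge x y := by
    ext a b
    simp only [deleteEdges_adj, sup_adj, fromEdgeSet_adj, Set.mem_singleton_iff, edge, hDadj]
    constructor
    · rintro ⟨h | h, h'⟩
      · exact Or.inl ⟨h, h'⟩
      · exact Or.inr h
    · rintro (⟨h, h'⟩ | h)
      · exact ⟨Or.inl h, h'⟩
      · exact ⟨Or.inr h, h.1 ▸ hne⟩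
  have hnxy : ¬ D.Reachable x y := fun h => hy (hx.trans h)
  have hNadj : (D ⊔ edge x y).Adj x y := by
    right; simp [edge, hxy.ne]
  have hNvu : (D ⊔ edge x y).Reachable v u :=
    (hyD.mono le_sup_left).trans (hNadj.symm.reachable.trans (hx.mono le_sup_left).symm)
  refine ⟨D ⊔ edge x y, ?_, ⟨?_, ?_⟩, ⟨s(x, y), ⟨hxy, hTxy⟩, s(v, u), Or.inl hu, hEq.symm⟩, ?_⟩
  · refine sup_le (hDT.trans hTG) ?_
    intro a b h
    simp only [edge, fromEdgeSet_adj, Set.mem_singleton_iff] at h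
    rw [← mem_edgeSet, h.1]
    exact hxy
  · haveI : Nonempty V := ⟨v⟩
    have hall : ∀ z, (D ⊔ edge x y).Reachable v z := fun z =>
      (hcov z).elim (fun h => hNvu.trans (h.mono le_sup_left)) (fun h => h.mono le_sup_left)
    exact ⟨fun a b => (hall a).symm.trans (hall b)⟩
  · exact (isAcyclic_add_edge_iff_of_not_reachable x y hnxy).2 (hTree.IsAcyclic.anti hDT)
  · have : (D ⊔ edge x y).neighborSet v = T.neighborSet v \ {u} := by
      ext z
      simp only [mem_neighborSet, sup_adj, hDadj, edge, fromEdgeSet_adj, Set.mem_diff,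
        Set.mem_singleton_iff]
      constructor
      · rintro (⟨h, h'⟩ | ⟨h, _⟩)
        · exact ⟨h, fun e => h' (by rw [e])⟩
        · rcases Sym2.eq_iff.mp h with ⟨h, _⟩ | ⟨h, _⟩
          · exact absurd h.symm hxv
          · exact absurd h.symm hyv
      · rintro ⟨h, h'⟩
        refine Or.inl ⟨h, fun e => ?_⟩
        rcases Sym2.eq_iff.mp e with ⟨_, h⟩ | ⟨h, _⟩
        · exact h' h
        · exact hu.ne h
    rw [this, Nat.card_coe_set_eq, Nat.card_coe_set_eq]
    exact Set.ncard_diff_singleton_add_one hu (Set.toFinite _)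

theorem stmt7_aux {V : Type*} [Fintype V] (G : SimpleGraph V)
    (v : V) (hv : (G.induce (({v} : Set V)ᶜ)).Connected) (n : ℕ) :
    ∀ (T : SimpleGraph V) (_ : T ≤ G) (_ : T.IsTree)
    (_ : Nat.card ↥(T.neighborSet v) = n + 1),
    ∃ c : ℕ → SimpleGraph V,
      c 0 = T ∧
      (∀ i ≤ n, c i ≤ G ∧ (c i).IsTree) ∧
      (∀ i < n, ∃ e ∈ G.edgeSet \ (c i).edgeSet,
        ∃ f ∈ (c i ⊔ SimpleGraph.fromEdgeSet {e}).edgeSet,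
          c (i + 1) = (c i ⊔ SimpleGraph.fromEdgeSet {e}).deleteEdges {f}) ∧
      Nat.card ↥((c n).neighborSet v) = 1 := by
  induction n with
  | zero =>
    intro T h1 h2 h3
    exact ⟨fun _ => T, rfl, fun _ _ => ⟨h1, h2⟩, fun i hi => absurd hi (Nat.not_lt_zero _), h3⟩
  | succ n ih =>
    intro T h1 h2 h3
    obtain ⟨T', a1, a2, a3, a4⟩ := stmt7_step G T h1 h2 v hv (by omega)
    obtain ⟨c, c0, c1, c2, c3⟩ := ih T' a1 a2 (by omega)
    refine ⟨fun i => Nat.casesOn i T c, rfl, ?_, ?_, c3⟩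
    · rintro (_ | i) hi
      · exact ⟨h1, h2⟩
      · exact c1 i (by omega)
    · rintro (_ | i) hi
      · rw [← c0] at a3; exact a3
      · exact c2 i (by omega)

/-- If `T` is a spanning tree of a finite connected graph `G` and `v` is not a
cut vertex of `G` (deleting `v` leaves a connected graph), then a sequence of at
most `deg_T(v) - 1` edge-exchange steps (each adding one edge of `G` and
removing one edge of the resulting cycle, staying a spanning tree) turns `v`
into a leaf. -/
theorem stmt7 {V : Type*} [Fintype V] (G : SimpleGraph V) (hG : G.Connected)
    (T : SimpleGraph V) (hTG : T ≤ G) (hTree : T.IsTree)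
    (v : V) (hv : (G.induce (({v} : Set V)ᶜ)).Connected) :
    ∃ m ≤ Nat.card ↥(T.neighborSet v) - 1, ∃ c : ℕ → SimpleGraph V,
      c 0 = T ∧
      (∀ i ≤ m, c i ≤ G ∧ (c i).IsTree) ∧
      (∀ i < m, ∃ e ∈ G.edgeSet \ (c i).edgeSet,
        ∃ f ∈ (c i ⊔ SimpleGraph.fromEdgeSet {e}).edgeSet,
          c (i + 1) = (c i ⊔ SimpleGraph.fromEdgeSet {e}).deleteEdges {f}) ∧
      Nat.card ↥((c m).neighborSet v) = 1 := by
  have hpos : 0 < Nat.card ↥(T.neighborSet v) := by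
    obtain ⟨w, hw⟩ := hv.nonempty
    obtain ⟨p⟩ := hTree.connected.preconnected v w
    cases p with
    | nil => exact absurd rfl hw
    | @cons _ b _ h p =>
      haveI : Nonempty ↥(T.neighborSet v) := ⟨⟨b, h⟩⟩
      exact Nat.card_pos
  exact ⟨_, le_rfl, stmt7_aux G v hv _ T hTG hTree (by omega)⟩
end
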